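/- Let d ≥ 1, 1 < p < ∞, λ > 0. Let Q be a symmetric positive definite real d×d matrix with ⟨Qξ,ξ⟩ ≥ λ|ξ|^2 for all ξ ∈ ℝ^d, and let A be a real d×d matrix. Define the Ornstein-Uhlenbeck operator 𝒜w(x) = Tr(Q D^2 w(x)) + ⟨Ax, Dw(x)⟩. Then there exists a constant C > 0, depending only on d, p, and A (and independent of Q and λ), such that for every w ∈ C_0^∞(ℝ^d) and all i,j ∈ {1,…,d}, ‖∂_{x_i x_j}^2 w‖_{L^p(ℝ^d)} ≤ (C/λ) (‖𝒜w‖_{L^p(ℝ^d)} + ‖w‖_{L^p(ℝ^d)}). -/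

import Mathlib

open MeasureTheory ENNReal

/-- First partial derivative `∂_{xᵢ} w` of `w : ℝᵈ → ℝ`. -/
noncomputable def pd1 {d : ℕ} (i : Fin d) (w : (Fin d → ℝ) → ℝ) (x : Fin d → ℝ) : ℝ :=
  fderiv ℝ w x (Pi.single i 1)

/-- Second partial derivative `∂²_{xᵢxⱼ} w` of `w : ℝᵈ → ℝ`. -/
noncomputable def pd2 {d : ℕ} (i j : Fin d) (w : (Fin d → ℝ) → ℝ) : (Fin d → ℝ) → ℝ :=
  pd1 i (pd1 j w)

/-- Correlation of a kernel `K` with a function `f` on the plane. -/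
noncomputable def corr (K f : ℝ × ℝ → ℝ) (z : ℝ × ℝ) : ℝ := ∫ w, K w * f (z + w)

theorem measurable_corr {K f : ℝ × ℝ → ℝ} (hK : Measurable K) (hf : Measurable f) :
    Measurable (corr K f) := by
  have : StronglyMeasurable (fun q : (ℝ × ℝ) × (ℝ × ℝ) => K q.2 * f (q.1 + q.2)) :=
    ((hK.comp measurable_snd).mul
      (hf.comp (measurable_fst.add measurable_snd))).stronglyMeasurable
  exact this.integral_prod_right'.measurable

theorem integrable_mul_of_bounded {α : Type*} [MeasurableSpace α] {μ : Measure α}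
    {K f : α → ℝ} (hK : Integrable K μ) (hf : AEStronglyMeasurable f μ) {M : ℝ}
    (hM : ∀ z, |f z| ≤ M) : Integrable (fun w => K w * f w) μ :=
  hK.mul_bdd (c := M) hf (Filter.Eventually.of_forall hM)

theorem corr_bounded {K f : ℝ × ℝ → ℝ} (hK : Integrable K) {M : ℝ}
    (hM : ∀ z, |f z| ≤ M) (z : ℝ × ℝ) : |corr K f z| ≤ (∫ w, |K w|) * M := by
  rw [corr, ← integral_mul_const]
  refine (abs_integral_le_integral_abs).trans ?_
  refine integral_mono_of_nonneg (Filter.Eventually.of_forall fun _ => abs_nonneg _)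
    (hK.abs.mul_const M) (Filter.Eventually.of_forall fun w => ?_)
  simp only [abs_mul]
  exact mul_le_mul_of_nonneg_left (hM _) (abs_nonneg _)

theorem corr_sub {K f g : ℝ × ℝ → ℝ} (hK : Integrable K) (hf : Measurable f)
    (hg : Measurable g) {M N : ℝ} (hM : ∀ z, |f z| ≤ M) (hN : ∀ z, |g z| ≤ N) (z : ℝ × ℝ) :
    corr K (f - g) z = corr K f z - corr K g z := by
  simp only [corr, Pi.sub_apply, mul_sub]
  exact integral_sub
    (integrable_mul_of_bounded hK
      (hf.comp (measurable_const.add measurable_id)).aestronglyMeasurable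
      (fun w => hM _))
    (integrable_mul_of_bounded hK
      (hg.comp (measurable_const.add measurable_id)).aestronglyMeasurable
      (fun w => hN _))

theorem enorm_corr_le (K f : ℝ × ℝ → ℝ) (z : ℝ × ℝ) :
    ‖corr K f z‖ₑ ≤ ∫⁻ w, ‖K w‖ₑ * ‖f (z + w)‖ₑ := by
  refine (enorm_integral_le_lintegral_enorm _).trans (le_of_eq ?_)
  simp only [enorm_mul]

/-- **Young's inequality** for an integrable kernel, in integrated form. -/
theorem lintegral_corr_rpow_le {p : ℝ} (hp : 1 < p) {K f : ℝ × ℝ → ℝ} (hK : Measurable K)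
    (hf : Measurable f) :
    ∫⁻ z, ‖corr K f z‖ₑ ^ p ≤ (∫⁻ w, ‖K w‖ₑ) ^ p * ∫⁻ z, ‖f z‖ₑ ^ p := by
  have hp0 : 0 < p := by linarith
  obtain ⟨q, hpq⟩ : ∃ q, p.HolderConjugate q := ⟨_, Real.HolderConjugate.conjExponent hp⟩
  have hq0 : 0 < q := hpq.symm.pos
  set N := ∫⁻ w, ‖K w‖ₑ with hN
  have hKe : Measurable fun w => ‖K w‖ₑ := hK.enorm
  have key : ∀ z, ‖corr K f z‖ₑ ^ p ≤ N ^ (p - 1) * ∫⁻ w, ‖K w‖ₑ * ‖f (z + w)‖ₑ ^ p := by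
    intro z
    have hfz : Measurable fun w => ‖f (z + w)‖ₑ :=
      (hf.comp (measurable_const.add measurable_id)).enorm
    have h1 := ENNReal.lintegral_mul_le_Lp_mul_Lq volume hpq
      (f := fun w => ‖K w‖ₑ ^ (1 / p) * ‖f (z + w)‖ₑ) (g := fun w => ‖K w‖ₑ ^ (1 / q))
      ((hKe.pow_const _).mul hfz).aemeasurable (hKe.pow_const _).aemeasurable
    have e1 : ∀ w, ((fun w => ‖K w‖ₑ ^ (1 / p) * ‖f (z + w)‖ₑ) * fun w => ‖K w‖ₑ ^ (1 / q)) w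
        = ‖K w‖ₑ * ‖f (z + w)‖ₑ := by
      intro w
      simp only [Pi.mul_apply]
      rw [mul_right_comm, ← ENNReal.rpow_add_of_nonneg _ _ (by positivity) (by positivity)]
      have : 1 / p + 1 / q = 1 := by simpa using hpq.inv_add_inv_eq_one
      rw [this, ENNReal.rpow_one]
    have e2 : ∀ w, (‖K w‖ₑ ^ (1 / p) * ‖f (z + w)‖ₑ) ^ p = ‖K w‖ₑ * ‖f (z + w)‖ₑ ^ p := by
      intro w
      rw [ENNReal.mul_rpow_of_nonneg _ _ hp0.le, ← ENNReal.rpow_mul,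
        one_div_mul_cancel hp0.ne', ENNReal.rpow_one]
    have e3 : ∀ w, (‖K w‖ₑ ^ (1 / q)) ^ q = ‖K w‖ₑ := by
      intro w
      rw [← ENNReal.rpow_mul, one_div_mul_cancel hq0.ne', ENNReal.rpow_one]
    simp only [e1, e2, e3] at h1
    have h2 := ENNReal.rpow_le_rpow ((enorm_corr_le K f z).trans h1) hp0.le
    rw [ENNReal.mul_rpow_of_nonneg _ _ hp0.le, ← ENNReal.rpow_mul, ← ENNReal.rpow_mul,
      one_div_mul_cancel hp0.ne', ENNReal.rpow_one, mul_comm] at h2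
    have e4 : 1 / q * p = p - 1 := by
      rw [one_div_mul_eq_div, hpq.div_conj_eq_sub_one]
    rwa [e4] at h2
  calc ∫⁻ z, ‖corr K f z‖ₑ ^ p
      ≤ ∫⁻ z, N ^ (p - 1) * ∫⁻ w, ‖K w‖ₑ * ‖f (z + w)‖ₑ ^ p := lintegral_mono key
    _ = N ^ (p - 1) * ∫⁻ z, ∫⁻ w, ‖K w‖ₑ * ‖f (z + w)‖ₑ ^ p := by
        rw [lintegral_const_mul]
        exact Measurable.lintegral_prod_right' (f := fun q : (ℝ × ℝ) × (ℝ × ℝ) =>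
          ‖K q.2‖ₑ * ‖f (q.1 + q.2)‖ₑ ^ p) (by fun_prop)
    _ = N ^ (p - 1) * ∫⁻ w, ∫⁻ z, ‖K w‖ₑ * ‖f (z + w)‖ₑ ^ p := by
        rw [lintegral_lintegral_swap]
        exact Measurable.aemeasurable (by
          change Measurable fun q : (ℝ × ℝ) × (ℝ × ℝ) => ‖K q.2‖ₑ * ‖f (q.1 + q.2)‖ₑ ^ p
          fun_prop)
    _ = N ^ (p - 1) * ∫⁻ w, ‖K w‖ₑ * ∫⁻ z, ‖f z‖ₑ ^ p := by
        congr 1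
        refine lintegral_congr fun w => ?_
        rw [lintegral_const_mul _ (by fun_prop),
          lintegral_add_right_eq_self (fun z => ‖f z‖ₑ ^ p) w]
    _ = N ^ p * ∫⁻ z, ‖f z‖ₑ ^ p := by
        rw [lintegral_mul_const _ hKe, ← mul_assoc, ← hN]
        congr 1
        conv_lhs => rw [← ENNReal.rpow_one N]
        rw [← ENNReal.rpow_mul, mul_comm, one_mul,
          ← ENNReal.rpow_add_of_nonneg _ _ zero_le_one (by linarith)]
        congr 1; ring

theorem eLpNorm_ofReal_eq {α : Type*} [MeasurableSpace α] {μ : Measure α} {p : ℝ} (hp : 1 < p)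
    (f : α → ℝ) :
    eLpNorm f (ENNReal.ofReal p) μ = (∫⁻ z, ‖f z‖ₑ ^ p ∂μ) ^ (1 / p) := by
  have hp0 : 0 < p := by linarith
  rw [eLpNorm_eq_lintegral_rpow_enorm_toReal (by simpa using hp0) (by simp),
    ENNReal.toReal_ofReal hp0.le]

theorem eLpNorm_corr_le {p : ℝ} (hp : 1 < p) {K f : ℝ × ℝ → ℝ} (hK : Measurable K)
    (hf : Measurable f) :
    eLpNorm (corr K f) (ENNReal.ofReal p) volume
      ≤ (∫⁻ w, ‖K w‖ₑ) * eLpNorm f (ENNReal.ofReal p) volume := by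
  have hp0 : 0 < p := by linarith
  rw [eLpNorm_ofReal_eq hp, eLpNorm_ofReal_eq hp]
  refine (ENNReal.rpow_le_rpow (lintegral_corr_rpow_le hp hK hf) (by positivity)).trans
    (le_of_eq ?_)
  rw [ENNReal.mul_rpow_of_nonneg _ _ (by positivity), ← ENNReal.rpow_mul,
    mul_one_div_cancel hp0.ne', ENNReal.rpow_one]

/-- Extension by density: a uniform `L^p` bound for `corr K` on continuous compactly supported
functions extends to bounded measurable functions. -/
theorem eLpNorm_corr_le_of_dense {p : ℝ} (hp : 1 < p) {K : ℝ × ℝ → ℝ} (hK : Measurable K)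
    (hKi : Integrable K) {C : ℝ≥0∞} (hC0 : C ≠ 0)
    (H : ∀ f : ℝ × ℝ → ℝ, Continuous f → HasCompactSupport f →
      eLpNorm (corr K f) (ENNReal.ofReal p) volume ≤ C * eLpNorm f (ENNReal.ofReal p) volume)
    {f : ℝ × ℝ → ℝ} (hf : Measurable f) {M : ℝ} (hM : ∀ z, |f z| ≤ M) :
    eLpNorm (corr K f) (ENNReal.ofReal p) volume ≤ C * eLpNorm f (ENNReal.ofReal p) volume := by
  have hp1 : (1 : ℝ≥0∞) ≤ ENNReal.ofReal p := by
    rw [← ENNReal.ofReal_one]; exact ENNReal.ofReal_le_ofReal hp.le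
  by_cases htop : eLpNorm f (ENNReal.ofReal p) volume = ∞
  · rw [htop, ENNReal.mul_top hC0]; exact le_top
  by_cases hCtop : C = ∞
  · by_cases h0 : eLpNorm f (ENNReal.ofReal p) volume = 0
    · refine (eLpNorm_corr_le hp hK hf).trans ?_
      simp [h0]
    · rw [hCtop, ENNReal.top_mul h0]; exact le_top
  have hfm : MemLp f (ENNReal.ofReal p) volume :=
    ⟨hf.aestronglyMeasurable, lt_top_iff_ne_top.2 htop⟩
  set N := ∫⁻ w, ‖K w‖ₑ with hN
  have hNtop : N ≠ ∞ := hKi.2.ne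
  have step : ∀ ε : ℝ≥0∞, ε ≠ 0 → eLpNorm (corr K f) (ENNReal.ofReal p) volume
      ≤ C * eLpNorm f (ENNReal.ofReal p) volume + (C + N) * ε := by
    intro ε hε
    obtain ⟨g, hgc, hfg, hg, hgm⟩ := hfm.exists_hasCompactSupport_eLpNorm_sub_le (by simp) hε
    obtain ⟨M', hM'⟩ := hgc.exists_bound_of_continuous hg
    have hd : corr K f = corr K g + corr K (f - g) := by
      ext z
      rw [Pi.add_apply, corr_sub hKi hf hg.measurable hM hM']; ring
    have hg' : eLpNorm g (ENNReal.ofReal p) volume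
        ≤ eLpNorm f (ENNReal.ofReal p) volume + ε := by
      have : g = f - (f - g) := by simp
      rw [this]
      exact (eLpNorm_sub_le hf.aestronglyMeasurable (hf.sub hg.measurable).aestronglyMeasurable
        hp1).trans (by gcongr)
    calc eLpNorm (corr K f) (ENNReal.ofReal p) volume
        ≤ eLpNorm (corr K g) (ENNReal.ofReal p) volume
          + eLpNorm (corr K (f - g)) (ENNReal.ofReal p) volume := by
          rw [hd]
          exact eLpNorm_add_le (measurable_corr hK hg.measurable).aestronglyMeasurable
            (measurable_corr hK (hf.sub hg.measurable)).aestronglyMeasurable hp1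
      _ ≤ C * (eLpNorm f (ENNReal.ofReal p) volume + ε) + N * ε := by
          gcongr
          · exact (H g hg hgc).trans (by gcongr)
          · exact (eLpNorm_corr_le hp hK (hf.sub hg.measurable)).trans (by gcongr)
      _ = _ := by ring
  refine ENNReal.le_of_forall_pos_le_add fun ε hε _ => ?_
  have hCN : C + N ≠ ∞ := by simp [hCtop, hNtop]
  have hCN0 : C + N ≠ 0 := by simp [hC0]
  refine (step (ε / (C + N)) ?_).trans ?_
  · simp [ENNReal.div_eq_zero_iff, hε.ne', hCN]
  · rw [ENNReal.mul_div_cancel hCN0 hCN]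

/-- Index of the parabolic dyadic cell of generation `n` containing `z`. -/
noncomputable def cellIdx (n : ℤ) (z : ℝ × ℝ) : ℤ × ℤ := (⌊(4 : ℝ) ^ n * z.1⌋, ⌊(2 : ℝ) ^ n * z.2⌋)

/-- The parabolic dyadic cell with a given generation and index. -/
def dcell (q : ℤ × ℤ × ℤ) : Set (ℝ × ℝ) := {z | cellIdx q.1 z = q.2}

theorem floor_zpow_mul_eq {b : ℕ} (hb : 0 < b) {m n : ℤ} (hmn : m ≤ n) {x y : ℝ}
    (h : ⌊(b : ℝ) ^ n * x⌋ = ⌊(b : ℝ) ^ n * y⌋) : ⌊(b : ℝ) ^ m * x⌋ = ⌊(b : ℝ) ^ m * y⌋ := by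
  obtain ⟨j, rfl⟩ := Int.exists_add_of_le hmn
  have hb' : (b : ℝ) ≠ 0 := by positivity
  have e : ∀ u : ℝ, (b : ℝ) ^ m * u = ((b : ℝ) ^ (m + (j : ℤ)) * u) / ((b ^ j : ℕ) : ℝ) := by
    intro u
    rw [zpow_add₀ hb', zpow_natCast, Nat.cast_pow]
    field_simp
  rw [e x, e y, Int.floor_div_natCast, Int.floor_div_natCast, h]

theorem cellIdx_eq_of_le {m n : ℤ} (hmn : m ≤ n) {z z' : ℝ × ℝ}
    (h : cellIdx n z = cellIdx n z') : cellIdx m z = cellIdx m z' := by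
  simp only [cellIdx, Prod.mk.injEq] at h ⊢
  exact ⟨floor_zpow_mul_eq (b := 4) (by norm_num) hmn (by exact_mod_cast h.1),
    floor_zpow_mul_eq (b := 2) (by norm_num) hmn (by exact_mod_cast h.2)⟩

theorem preimage_floor_zpow {b : ℝ} (hb : 0 < b) (n k : ℤ) :
    {x : ℝ | ⌊b ^ n * x⌋ = k} = Set.Ico (k * b ^ (-n)) (k * b ^ (-n) + b ^ (-n)) := by
  ext x
  have hp : 0 < b ^ n := by positivity
  simp only [Set.mem_ofPred_eq, Int.floor_eq_iff, Set.mem_Ico, zpow_neg]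
  rw [← div_eq_mul_inv, div_le_iff₀' hp, show (k : ℝ) / b ^ n + (b ^ n)⁻¹ = (k + 1) / b ^ n by
    field_simp, lt_div_iff₀' hp]

theorem dcell_eq_prod (q : ℤ × ℤ × ℤ) :
    dcell q = Set.Ico (q.2.1 * (4 : ℝ) ^ (-q.1)) (q.2.1 * (4 : ℝ) ^ (-q.1) + (4 : ℝ) ^ (-q.1)) ×ˢ
      Set.Ico (q.2.2 * (2 : ℝ) ^ (-q.1)) (q.2.2 * (2 : ℝ) ^ (-q.1) + (2 : ℝ) ^ (-q.1)) := by
  rw [← preimage_floor_zpow (by norm_num), ← preimage_floor_zpow (by norm_num)]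
  ext z
  simp [dcell, cellIdx, Prod.ext_iff]

theorem measurableSet_dcell (q : ℤ × ℤ × ℤ) : MeasurableSet (dcell q) := by
  rw [dcell_eq_prod]; exact measurableSet_Ico.prod measurableSet_Ico

theorem volume_dcell (q : ℤ × ℤ × ℤ) : volume (dcell q) = ENNReal.ofReal ((8 : ℝ) ^ (-q.1)) := by
  rw [dcell_eq_prod, Measure.volume_eq_prod, Measure.prod_prod, Real.volume_Ico, Real.volume_Ico,
    ← ENNReal.ofReal_mul (by simp; positivity), add_sub_cancel_left, add_sub_cancel_left,
    ← mul_zpow]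
  norm_num

theorem mem_dcell_cellIdx (n : ℤ) (z : ℝ × ℝ) : z ∈ dcell (n, cellIdx n z) := rfl

theorem dcell_subset_of_le {m n : ℤ} (hmn : m ≤ n) (z : ℝ × ℝ) :
    dcell (n, cellIdx n z) ⊆ dcell (m, cellIdx m z) := fun _ hz => cellIdx_eq_of_le hmn hz

/-- Stopping-time selection of the dyadic cells at height `α`. -/
theorem exists_stopping_cells {f : ℝ × ℝ → ℝ} (hf : Continuous f) (hfc : HasCompactSupport f)
    {α : ℝ} (hα : 0 < α) :
    ∃ 𝓑 : Set (ℤ × ℤ × ℤ), 𝓑.PairwiseDisjoint dcell ∧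
      (∀ q ∈ 𝓑, ∫⁻ z in dcell q, ‖f z‖ₑ ≤ 8 * ENNReal.ofReal α * volume (dcell q)) ∧
      (∀ q ∈ 𝓑, ENNReal.ofReal α * volume (dcell q) ≤ ∫⁻ z in dcell q, ‖f z‖ₑ) ∧
      ∀ z, (∀ q ∈ 𝓑, z ∉ dcell q) → |f z| ≤ α := by
  classical
  set Bad : ℤ → ℝ × ℝ → Prop := fun n z =>
    ENNReal.ofReal α * volume (dcell (n, cellIdx n z)) < ∫⁻ y in dcell (n, cellIdx n z), ‖f y‖ₑ
    with hBad
  have hBadc : ∀ {m n : ℤ}, m ≤ n → ∀ {z z' : ℝ × ℝ}, cellIdx n z = cellIdx n z' →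
      (Bad m z ↔ Bad m z') := by
    intro m n hmn z z' h
    simp only [hBad, cellIdx_eq_of_le hmn h]
  refine ⟨{q | ∃ z, cellIdx q.1 z = q.2 ∧ Bad q.1 z ∧ ∀ m < q.1, ¬ Bad m z}, ?_, ?_, ?_, ?_⟩
  · rintro ⟨n, k⟩ ⟨z, hz, hb, hm⟩ ⟨n', k'⟩ ⟨z', hz', hb', hm'⟩ hne
    rw [Function.onFun, Set.disjoint_left]
    intro y hy hy'
    simp only [dcell, Set.mem_ofPred_eq] at hy hy' hz hz'
    rcases lt_trichotomy n n' with h | h | h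
    · refine hm' n h ?_
      exact (hBadc h.le (hy'.trans hz'.symm)).1 ((hBadc le_rfl (hy.trans hz.symm)).2 hb)
    · subst h
      exact hne (by rw [← hy, ← hy'])
    · refine hm n' h ?_
      exact (hBadc h.le (hy.trans hz.symm)).1 ((hBadc le_rfl (hy'.trans hz'.symm)).2 hb')
  · rintro ⟨n, k⟩ ⟨z, hz, hb, hm⟩
    simp only at hz hb hm
    subst hz
    have h1 := not_lt.1 (hm (n - 1) (by omega))
    calc ∫⁻ y in dcell (n, cellIdx n z), ‖f y‖ₑ
        ≤ ∫⁻ y in dcell (n - 1, cellIdx (n - 1) z), ‖f y‖ₑ :=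
          lintegral_mono_set (dcell_subset_of_le (by omega) z)
      _ ≤ ENNReal.ofReal α * volume (dcell (n - 1, cellIdx (n - 1) z)) := h1
      _ = 8 * ENNReal.ofReal α * volume (dcell (n, cellIdx n z)) := by
          rw [volume_dcell, volume_dcell, mul_comm 8, mul_assoc]
          congr 1
          rw [show (8 : ℝ≥0∞) = ENNReal.ofReal 8 by simp, ← ENNReal.ofReal_mul (by norm_num)]
          congr 1
          simp only
          rw [show -(n - 1) = -n + 1 by ring, zpow_add₀ (by norm_num)]
          ring
  · rintro ⟨n, k⟩ ⟨z, hz, hb, hm⟩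
    simp only at hz hb
    subst hz
    exact hb.le
  · intro z hz
    by_contra! hlt
    -- some cell around `z` is bad
    obtain ⟨c, hc1, hc2⟩ := exists_between hlt
    have hopen : ∀ᶠ y in nhds z, c < |f y| :=
      (hf.abs.tendsto z).eventually (lt_mem_nhds hc2)
    obtain ⟨δ, hδ, hball⟩ := Metric.eventually_nhds_iff.1 hopen
    obtain ⟨j, hj⟩ := exists_pow_lt_of_lt_one hδ (show (1 / 2 : ℝ) < 1 by norm_num)
    have hexists : ∃ n : ℤ, Bad n z := by
      refine ⟨j, ?_⟩
      have hsub : ∀ y ∈ dcell (j, cellIdx j z), c < |f y| := by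
        intro y hy
        apply hball
        have hz := mem_dcell_cellIdx j z
        rw [dcell_eq_prod] at hy hz
        simp only [Set.mem_prod, Set.mem_Ico] at hy hz
        have h4 : (4 : ℝ) ^ (-(j : ℤ)) ≤ (1 / 2) ^ j := by
          rw [zpow_neg, zpow_natCast, one_div, inv_pow]
          gcongr; norm_num
        have h2 : (2 : ℝ) ^ (-(j : ℤ)) = (1 / 2) ^ j := by
          rw [zpow_neg, zpow_natCast, one_div, inv_pow]
        rw [Prod.dist_eq, Real.dist_eq, Real.dist_eq]
        refine lt_of_le_of_lt (max_le ?_ ?_) hj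
        · rw [abs_le]; constructor <;> linarith [hy.1.1, hy.1.2, hz.1.1, hz.1.2]
        · rw [abs_le]; constructor <;> linarith [hy.2.1, hy.2.2, hz.2.1, hz.2.2]
      have hc0 : ENNReal.ofReal α < ENNReal.ofReal c :=
        (ENNReal.ofReal_lt_ofReal_iff (hα.trans hc1)).2 hc1
      simp only [hBad]
      calc ENNReal.ofReal α * volume (dcell (j, cellIdx j z))
          < ENNReal.ofReal c * volume (dcell (j, cellIdx j z)) := by
            rw [volume_dcell]
            refine (ENNReal.mul_lt_mul_iff_left ?_ ENNReal.ofReal_ne_top).2 hc0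
            exact (ENNReal.ofReal_pos.2 (by positivity)).ne'
        _ = ∫⁻ y in dcell (j, cellIdx j z), ENNReal.ofReal c := by simp
        _ ≤ _ := by
            refine setLIntegral_mono' (measurableSet_dcell _) fun y hy => ?_
            rw [← ofReal_norm]
            exact ENNReal.ofReal_le_ofReal (hsub y hy).le
    -- generations of bad cells are bounded below
    have hint : Integrable f := hf.integrable_of_hasCompactSupport hfc
    obtain ⟨n0, hn0⟩ : ∃ n0 : ℤ, ∀ n, Bad n z → n0 ≤ n := by
      obtain ⟨i, hi⟩ := pow_unbounded_of_one_lt ((∫⁻ y, ‖f y‖ₑ).toReal / α)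
        (show (1 : ℝ) < 8 by norm_num)
      refine ⟨-(i : ℤ), fun n hn => ?_⟩
      by_contra! hni
      refine absurd hn (not_lt.2 ?_)
      calc ∫⁻ y in dcell (n, cellIdx n z), ‖f y‖ₑ ≤ ∫⁻ y, ‖f y‖ₑ := setLIntegral_le_lintegral _ _
        _ = ENNReal.ofReal (∫⁻ y, ‖f y‖ₑ).toReal := (ENNReal.ofReal_toReal hint.2.ne).symm
        _ ≤ ENNReal.ofReal (α * 8 ^ (-n)) := by
            apply ENNReal.ofReal_le_ofReal
            rw [div_lt_iff₀ hα] at hi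
            have : (8 : ℝ) ^ i ≤ 8 ^ (-n) := by
              rw [← zpow_natCast]
              exact zpow_le_zpow_right₀ (by norm_num) (by omega)
            nlinarith
        _ = _ := by rw [ENNReal.ofReal_mul hα.le, volume_dcell]
    obtain ⟨n, hn, hmin⟩ := Int.exists_least_of_bdd ⟨n0, hn0⟩ hexists
    exact hz (n, cellIdx n z) ⟨z, rfl, hn, fun m hm hbm => by have := hmin m hbm; omega⟩
      (mem_dcell_cellIdx n z)

theorem corr_eq_integral_sub (K f : ℝ × ℝ → ℝ) (z : ℝ × ℝ) :
    corr K f z = ∫ y, K (y - z) * f y := by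
  rw [corr, ← integral_add_left_eq_self (fun y => K (y - z) * f y) z]
  simp

/-- Cancellation estimate for a mean-zero function on one cell. -/
theorem lintegral_enorm_setIntegral_le {K b : ℝ × ℝ → ℝ} (hK : Measurable K) (hKi : Integrable K)
    (hb : Measurable b) {M : ℝ} (hM : ∀ z, |b z| ≤ M) {D S : Set (ℝ × ℝ)}
    (hD : MeasurableSet D) (hDv : volume D ≠ ∞) (h0 : ∫ y in D, b y = 0)
    (c : ℝ × ℝ) {B : ℝ≥0∞}
    (hB : ∀ y ∈ D, ∫⁻ z in S, ‖K (y - z) - K (c - z)‖ₑ ≤ B) :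
    ∫⁻ z in S, ‖∫ y in D, K (y - z) * b y‖ₑ ≤ B * ∫⁻ y in D, ‖b y‖ₑ := by
  have : IsFiniteMeasure (volume.restrict D) := ⟨by simpa using hDv.lt_top⟩
  have hbi : Integrable b (volume.restrict D) := by
    have := (integrable_const (1 : ℝ) (μ := volume.restrict D)).mul_bdd (c := M)
      hb.aestronglyMeasurable (Filter.Eventually.of_forall hM)
    simpa using this
  have e : ∀ z, ∫ y in D, K (y - z) * b y = ∫ y in D, (K (y - z) - K (c - z)) * b y := by
    intro z
    simp only [sub_mul]
    rw [integral_sub, integral_const_mul, h0, mul_zero, sub_zero]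
    · exact integrable_mul_of_bounded ((hKi.comp_sub_right z).restrict) hb.aestronglyMeasurable hM
    · exact hbi.const_mul _
  calc ∫⁻ z in S, ‖∫ y in D, K (y - z) * b y‖ₑ
      ≤ ∫⁻ z in S, ∫⁻ y in D, ‖K (y - z) - K (c - z)‖ₑ * ‖b y‖ₑ := by
        refine lintegral_mono fun z => ?_
        simp only [e]
        refine (enorm_integral_le_lintegral_enorm _).trans (le_of_eq ?_)
        simp only [enorm_mul]
    _ = ∫⁻ y in D, ∫⁻ z in S, ‖K (y - z) - K (c - z)‖ₑ * ‖b y‖ₑ := by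
        refine lintegral_lintegral_swap (Measurable.aemeasurable ?_)
        have h1 : Measurable fun q : (ℝ × ℝ) × (ℝ × ℝ) => K (q.2 - q.1) - K (c - q.1) :=
          (hK.comp (measurable_snd.sub measurable_fst)).sub
            (hK.comp (measurable_const.sub measurable_fst))
        exact h1.enorm.mul (hb.comp measurable_snd).enorm
    _ ≤ ∫⁻ y in D, B * ‖b y‖ₑ := by
        refine setLIntegral_mono' hD fun y hy => ?_
        rw [lintegral_mul_const]
        · exact mul_le_mul_left (hB y hy) _
        · exact ((hK.comp (measurable_const.sub measurable_id)).sub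
            (hK.comp (measurable_const.sub measurable_id))).enorm
    _ = _ := lintegral_const_mul _ hb.enorm

/-- Doubled box around the corner of a cell. -/
def bigBox (q : ℤ × ℤ × ℤ) : Set (ℝ × ℝ) :=
  {z | |q.2.1 * (4 : ℝ) ^ (-q.1) - z.1| ≤ 4 * ((2 : ℝ) ^ (-q.1)) ^ 2 ∧
    |q.2.2 * (2 : ℝ) ^ (-q.1) - z.2| ≤ 2 * (2 : ℝ) ^ (-q.1)}

theorem bigBox_eq (q : ℤ × ℤ × ℤ) :
    bigBox q = Metric.closedBall (q.2.1 * (4 : ℝ) ^ (-q.1)) (4 * ((2 : ℝ) ^ (-q.1)) ^ 2) ×ˢ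
      Metric.closedBall (q.2.2 * (2 : ℝ) ^ (-q.1)) (2 * (2 : ℝ) ^ (-q.1)) := by
  ext z
  simp [bigBox, Metric.mem_closedBall, Real.dist_eq, abs_sub_comm]

theorem measurableSet_bigBox (q : ℤ × ℤ × ℤ) : MeasurableSet (bigBox q) := by
  rw [bigBox_eq]; exact measurableSet_closedBall.prod measurableSet_closedBall

theorem volume_bigBox (q : ℤ × ℤ × ℤ) : volume (bigBox q) = 32 * volume (dcell q) := by
  rw [bigBox_eq, Measure.volume_eq_prod, Measure.prod_prod, Real.volume_closedBall,
    Real.volume_closedBall, ← Measure.volume_eq_prod, volume_dcell,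
    ← ENNReal.ofReal_mul (by positivity), show (32 : ℝ≥0∞) = ENNReal.ofReal 32 by simp,
    ← ENNReal.ofReal_mul (by norm_num), show (8 : ℝ) = 2 ^ (3 : ℤ) by norm_num, ← zpow_mul]
  congr 1
  rw [mul_comm 3, zpow_mul]
  norm_cast
  ring

/-- Hörmander's regularity condition at parabolic scale. -/
def ParabolicHormander (K : ℝ × ℝ → ℝ) (B : ℝ≥0∞) : Prop :=
  ∀ l : ℝ, 0 < l → ∀ s a : ℝ, |s| ≤ l ^ 2 → |a| ≤ l →
    ∫⁻ u in {u : ℝ × ℝ | ¬ (|u.1| ≤ 4 * l ^ 2 ∧ |u.2| ≤ 2 * l)}, ‖K (u + (s, a)) - K u‖ₑ ≤ B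

theorem ParabolicHormander.cell {K : ℝ × ℝ → ℝ} {B : ℝ≥0∞} (h : ParabolicHormander K B)
    (q : ℤ × ℤ × ℤ) {y : ℝ × ℝ} (hy : y ∈ dcell q) :
    ∫⁻ z in (bigBox q)ᶜ, ‖K (y - z) -
      K ((q.2.1 * (4 : ℝ) ^ (-q.1), q.2.2 * (2 : ℝ) ^ (-q.1)) - z)‖ₑ ≤ B := by
  set c : ℝ × ℝ := (q.2.1 * (4 : ℝ) ^ (-q.1), q.2.2 * (2 : ℝ) ^ (-q.1)) with hc
  set l : ℝ := (2 : ℝ) ^ (-q.1) with hl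
  have hl4 : (4 : ℝ) ^ (-q.1) = l ^ 2 := by
    rw [hl, ← zpow_natCast, ← zpow_mul, mul_comm, zpow_mul]; norm_num
  rw [dcell_eq_prod] at hy
  simp only [Set.mem_prod, Set.mem_Ico, hl4] at hy
  have h2 := h l (by positivity) (y.1 - c.1) (y.2 - c.2)
    (by simp only [hc, hl4]; rw [abs_le]; constructor <;> nlinarith [hy.1.1, hy.1.2])
    (by simp only [hc]; rw [abs_le]; constructor <;> nlinarith [hy.2.1, hy.2.2])
  refine le_trans (le_of_eq ?_) h2
  have hmp : MeasurePreserving (fun z : ℝ × ℝ => c - z) volume volume :=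
    Measure.measurePreserving_sub_left volume c
  have hS : (bigBox q)ᶜ = (fun z : ℝ × ℝ => c - z) ⁻¹'
      {u : ℝ × ℝ | ¬ (|u.1| ≤ 4 * l ^ 2 ∧ |u.2| ≤ 2 * l)} := by
    rfl
  rw [hS]
  refine Eq.trans ?_ (hmp.setLIntegral_comp_preimage_emb
    (MeasurableEquiv.subLeft c).measurableEmbedding
    (fun u => ‖K (u + (y.1 - c.1, y.2 - c.2)) - K u‖ₑ) _)
  refine lintegral_congr fun z => ?_
  have : c - z + (y.1 - c.1, y.2 - c.2) = y - z := by
    ext <;> simp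
  simp only [this]

theorem volume_dcell_pos (q : ℤ × ℤ × ℤ) : volume (dcell q) ≠ 0 := by
  rw [volume_dcell]; exact (ENNReal.ofReal_pos.2 (by positivity)).ne'

theorem volume_dcell_ne_top (q : ℤ × ℤ × ℤ) : volume (dcell q) ≠ ∞ := by
  rw [volume_dcell]; exact ENNReal.ofReal_ne_top

theorem volume_stopping_le {f : ℝ × ℝ → ℝ} (hf : Measurable f) {α : ℝ} (hα : 0 < α)
    {D : Set (ℝ × ℝ)} (hDt : volume D ≠ ∞)
    (h : ENNReal.ofReal α * volume D ≤ ∫⁻ z in D, ‖f z‖ₑ) :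
    volume D ≤ 2 / ENNReal.ofReal α *
      ∫⁻ z in D, {z | α / 2 < |f z|}.indicator (fun z => ‖f z‖ₑ) z := by
  have hm : MeasurableSet {z | α / 2 < |f z|} := measurableSet_lt measurable_const hf.abs
  have h1 : ∫⁻ z in D, ‖f z‖ₑ ≤ (∫⁻ z in D, {z | α / 2 < |f z|}.indicator (fun z => ‖f z‖ₑ) z)
      + ENNReal.ofReal (α / 2) * volume D := by
    rw [← setLIntegral_const, ← lintegral_add_left (hf.enorm.indicator hm)]
    refine lintegral_mono fun z => ?_
    by_cases hz : α / 2 < |f z|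
    · rw [Set.indicator_of_mem (by exact hz)]; exact le_self_add
    · refine le_add_left ?_
      rw [← ofReal_norm]
      exact ENNReal.ofReal_le_ofReal (not_lt.1 hz)
  have h2 := h.trans h1
  set I := ∫⁻ z in D, {z | α / 2 < |f z|}.indicator (fun z => ‖f z‖ₑ) z
  have h3 : ENNReal.ofReal (α / 2) * volume D ≤ I := by
    have e : ENNReal.ofReal α * volume D =
        ENNReal.ofReal (α / 2) * volume D + ENNReal.ofReal (α / 2) * volume D := by
      rw [← add_mul, ← ENNReal.ofReal_add (by positivity) (by positivity), add_halves]
    rw [e] at h2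
    exact (ENNReal.add_le_add_iff_right (ENNReal.mul_ne_top ENNReal.ofReal_ne_top hDt)).1 h2
  have ha : ENNReal.ofReal α ≠ 0 := (ENNReal.ofReal_pos.2 hα).ne'
  calc volume D = 2 / ENNReal.ofReal α * (ENNReal.ofReal (α / 2) * volume D) := by
        rw [ENNReal.ofReal_div_of_pos (by norm_num), ← mul_assoc]
        simp only [ENNReal.ofReal_ofNat, div_eq_mul_inv]
        rw [show 2 * (ENNReal.ofReal α)⁻¹ * (ENNReal.ofReal α * 2⁻¹) =
          (2 * 2⁻¹) * (ENNReal.ofReal α * (ENNReal.ofReal α)⁻¹) by ring,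
          ENNReal.mul_inv_cancel ha ENNReal.ofReal_ne_top,
          ENNReal.mul_inv_cancel (by norm_num) (by norm_num)]
        simp
    _ ≤ _ := mul_le_mul_right h3 _

/-- The Calderón–Zygmund decomposition. -/
theorem exists_cz_decomposition {f : ℝ × ℝ → ℝ} (hf : Continuous f) (hfc : HasCompactSupport f)
    {α : ℝ} (hα : 0 < α) :
    ∃ (𝓑 : Set (ℤ × ℤ × ℤ)) (g : ℝ × ℝ → ℝ) (M : ℝ), 𝓑.PairwiseDisjoint dcell ∧ Measurable g ∧
      (∀ z, |g z| ≤ M) ∧ (∀ z, |f z| ≤ M) ∧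
      (∀ z, (∀ q ∈ 𝓑, z ∉ dcell q) → g z = f z ∧ |f z| ≤ α) ∧
      (∀ q ∈ 𝓑, ∀ z ∈ dcell q, |g z| ≤ 8 * α) ∧
      (∀ q ∈ 𝓑, ∫ z in dcell q, (f - g) z = 0) ∧
      (∀ q ∈ 𝓑, ∫⁻ z in dcell q, ‖(f - g) z‖ₑ ≤ 16 * ENNReal.ofReal α * volume (dcell q)) ∧
      (∀ q ∈ 𝓑, ENNReal.ofReal α * volume (dcell q) ≤ ∫⁻ z in dcell q, ‖f z‖ₑ) := by
  obtain ⟨𝓑, hdis, hup, hlow, hoff⟩ := exists_stopping_cells hf hfc hα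
  have hint : Integrable f := hf.integrable_of_hasCompactSupport hfc
  set avg : ℤ × ℤ × ℤ → ℝ := fun q => ⨍ z in dcell q, f z with havg
  have havg_le : ∀ q ∈ 𝓑, |avg q| ≤ 8 * α := by
    intro q hq
    have hV : 0 < volume.real (dcell q) :=
      ENNReal.toReal_pos (volume_dcell_pos q) (volume_dcell_ne_top q)
    have h1 : |∫ z in dcell q, f z| ≤ 8 * α * volume.real (dcell q) := by
      rw [← Real.norm_eq_abs]
      have := (enorm_integral_le_lintegral_enorm (μ := volume.restrict (dcell q)) f).trans
        (hup q hq)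
      rw [← ofReal_norm] at this
      have h2 := ENNReal.toReal_mono
        (ENNReal.mul_ne_top (by finiteness) (volume_dcell_ne_top q)) this
      rw [ENNReal.toReal_ofReal (norm_nonneg _)] at h2
      refine h2.trans (le_of_eq ?_)
      simp [ENNReal.toReal_ofReal hα.le, Measure.real]
    simp only [havg, setAverage_eq, smul_eq_mul, abs_mul, abs_inv, abs_of_pos hV]
    rw [inv_mul_le_iff₀ hV]; linarith
  obtain ⟨g, hgm, hg⟩ := exists_measurable_piecewise
    (fun o : Option 𝓑 => o.elim (⋃ q ∈ 𝓑, dcell q)ᶜ fun q => dcell q)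
    (by
      rintro (_ | q)
      · exact (MeasurableSet.biUnion (Set.to_countable _) fun q _ => measurableSet_dcell q).compl
      · exact measurableSet_dcell _)
    (fun o : Option 𝓑 => o.elim f fun q _ => avg q)
    (by
      rintro (_ | q)
      · exact hf.measurable
      · exact measurable_const)
    (by
      rintro (_ | q) (_ | q') hne z hz
      · rfl
      · exact absurd (Set.mem_biUnion q'.2 hz.2) hz.1
      · exact absurd (Set.mem_biUnion q.2 hz.1) hz.2
      · exact absurd hz.2 (Set.disjoint_left.1
          (hdis q.2 q'.2 fun e => hne (by rw [Subtype.ext e])) hz.1))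
  have hg_off : ∀ z, (∀ q ∈ 𝓑, z ∉ dcell q) → g z = f z := fun z hz => hg none (by simpa using hz)
  have hg_on : ∀ q ∈ 𝓑, ∀ z ∈ dcell q, g z = avg q := fun q hq z hz => hg (some ⟨q, hq⟩) hz
  obtain ⟨M, hM⟩ : ∃ M, ∀ z, |f z| ≤ M := by
    simpa using hf.bounded_above_of_compact_support hfc
  have hgint : ∀ q ∈ 𝓑, IntegrableOn g (dcell q) := fun q hq =>
    (integrableOn_const (volume_dcell_ne_top q) (C := avg q)).congr_fun
      (fun z hz => (hg_on q hq z hz).symm) (measurableSet_dcell q)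
  have hgI : ∀ q ∈ 𝓑, ∫⁻ z in dcell q, ‖g z‖ₑ ≤ 8 * ENNReal.ofReal α * volume (dcell q) := by
    intro q hq
    rw [← setLIntegral_const]
    refine setLIntegral_mono' (measurableSet_dcell q) fun z hz => ?_
    rw [hg_on q hq z hz, ← ofReal_norm, show (8 : ℝ≥0∞) = ENNReal.ofReal 8 by simp,
      ← ENNReal.ofReal_mul (by norm_num)]
    exact ENNReal.ofReal_le_ofReal (havg_le q hq)
  refine ⟨𝓑, g, max M (8 * α), hdis, hgm, ?_, fun z => (hM z).trans (le_max_left _ _),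
    fun z hz => ⟨hg_off z hz, hoff z hz⟩, fun q hq z hz => ?_, fun q hq => ?_, fun q hq => ?_, hlow⟩
  · intro z
    by_cases h : ∀ q ∈ 𝓑, z ∉ dcell q
    · rw [hg_off z h]; exact (hM z).trans (le_max_left _ _)
    · push Not at h
      obtain ⟨q, hq, hz⟩ := h
      rw [hg_on q hq z hz]; exact (havg_le q hq).trans (le_max_right _ _)
  · rw [hg_on q hq z hz]; exact havg_le q hq
  · simp only [Pi.sub_apply]
    rw [integral_sub hint.integrableOn (hgint q hq),
      setIntegral_congr_fun (measurableSet_dcell q) (fun z hz => hg_on q hq z hz),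
      setIntegral_const, sub_eq_zero]
    exact (measure_smul_setAverage f (volume_dcell_ne_top q)).symm
  · calc ∫⁻ z in dcell q, ‖(f - g) z‖ₑ ≤ ∫⁻ z in dcell q, (‖f z‖ₑ + ‖g z‖ₑ) :=
        lintegral_mono fun z => enorm_sub_le
      _ = (∫⁻ z in dcell q, ‖f z‖ₑ) + ∫⁻ z in dcell q, ‖g z‖ₑ :=
        lintegral_add_left hf.measurable.enorm _
      _ ≤ _ := by
        refine (add_le_add (hup q hq) (hgI q hq)).trans (le_of_eq ?_)
        ring

/-- Weak-type bound for parabolic Calderón–Zygmund kernels, in truncated form. -/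
theorem volume_lt_corr_le {K : ℝ × ℝ → ℝ} (hK : Measurable K) (hKi : Integrable K) {B : ℝ≥0∞}
    (hL2 : ∀ g : ℝ × ℝ → ℝ, Measurable g → ∀ M : ℝ, (∀ z, |g z| ≤ M) →
      ∫⁻ z, ‖corr K g z‖ₑ ^ 2 ≤ B * ∫⁻ z, ‖g z‖ₑ ^ 2)
    (hH : ParabolicHormander K B) {f : ℝ × ℝ → ℝ} (hf : Continuous f) (hfc : HasCompactSupport f)
    {α : ℝ} (hα : 0 < α) :
    volume {z | α < |corr K f z|} ≤
      4 * B / ENNReal.ofReal α ^ 2 * (∫⁻ z, {z | |f z| ≤ α}.indicator (fun z => ‖f z‖ₑ ^ 2) z) +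
      (288 * B + 32) * (2 / ENNReal.ofReal α *
        ∫⁻ z, {z | α / 2 < |f z|}.indicator (fun z => ‖f z‖ₑ) z) := by
  obtain ⟨𝓑, g, M, hdis, hgm, hgM, hfM, hoff, hon, hmean, hb, hlow⟩ :=
    exists_cz_decomposition hf hfc hα
  set a := ENNReal.ofReal α with ha
  have ha0 : a ≠ 0 := (ENNReal.ofReal_pos.2 hα).ne'
  have hat : a ≠ ∞ := ENNReal.ofReal_ne_top
  have hfm := hf.measurable
  set Ω : Set (ℝ × ℝ) := ⋃ q ∈ 𝓑, dcell q with hΩ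
  set Ω' : Set (ℝ × ℝ) := ⋃ q ∈ 𝓑, bigBox q with hΩ'
  have hcount : 𝓑.Countable := Set.to_countable _
  have hΩm : MeasurableSet Ω := MeasurableSet.biUnion hcount fun q _ => measurableSet_dcell q
  have hΩ'm : MeasurableSet Ω' := MeasurableSet.biUnion hcount fun q _ => measurableSet_bigBox q
  have hΩv : volume Ω = ∑' q : 𝓑, volume (dcell q) :=
    measure_biUnion hcount hdis fun q _ => measurableSet_dcell q
  have hΩle : volume Ω ≤ 2 / a * ∫⁻ z, {z | α / 2 < |f z|}.indicator (fun z => ‖f z‖ₑ) z := by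
    rw [hΩv]
    calc ∑' q : 𝓑, volume (dcell q)
        ≤ ∑' q : 𝓑, 2 / a * ∫⁻ z in dcell q, {z | α / 2 < |f z|}.indicator (fun z => ‖f z‖ₑ) z :=
          ENNReal.tsum_le_tsum fun q =>
            volume_stopping_le hfm hα (volume_dcell_ne_top _) (hlow q q.2)
      _ = 2 / a * ∫⁻ z in Ω, {z | α / 2 < |f z|}.indicator (fun z => ‖f z‖ₑ) z := by
          rw [ENNReal.tsum_mul_left, hΩ,
            lintegral_biUnion hcount (fun q _ => measurableSet_dcell q) hdis]
      _ ≤ _ := by gcongr; exact Measure.restrict_le_self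
  have hΩ'le : volume Ω' ≤ 32 * volume Ω := by
    rw [hΩv, ← ENNReal.tsum_mul_left]
    refine (measure_biUnion_le _ hcount _).trans ?_
    simp only [volume_bigBox, le_refl]
  have hbm : Measurable (f - g) := hfm.sub hgm
  have hbM : ∀ z, |(f - g) z| ≤ M + M := fun z =>
    (abs_sub _ _).trans (add_le_add (hfM z) (hgM z))
  -- the good part
  have hgood : volume {z | α / 2 ≤ |corr K g z|} ≤ 4 * B / a ^ 2 *
      (∫⁻ z, {z | |f z| ≤ α}.indicator (fun z => ‖f z‖ₑ ^ 2) z) + 256 * B * volume Ω := by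
    have hg2 : ∫⁻ z, ‖g z‖ₑ ^ 2 ≤
        (∫⁻ z, {z | |f z| ≤ α}.indicator (fun z => ‖f z‖ₑ ^ 2) z) + 64 * a ^ 2 * volume Ω := by
      rw [← setLIntegral_const, ← lintegral_indicator hΩm, ← lintegral_add_right _
        (measurable_const.indicator hΩm)]
      refine lintegral_mono fun z => ?_
      by_cases hz : z ∈ Ω
      · refine le_add_left ?_
        rw [Set.indicator_of_mem hz]
        obtain ⟨q, hq, hzq⟩ := Set.mem_iUnion₂.1 hz
        have h8 : ‖g z‖ₑ ≤ 8 * a := by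
          rw [← ofReal_norm, show (8 : ℝ≥0∞) = ENNReal.ofReal 8 by simp,
            ← ENNReal.ofReal_mul (by norm_num)]
          exact ENNReal.ofReal_le_ofReal (hon q hq z hzq)
        calc ‖g z‖ₑ ^ 2 ≤ (8 * a) ^ 2 := by gcongr
          _ = 64 * a ^ 2 := by ring
      · refine le_add_right ?_
        have := hoff z fun q hq hzq => hz (Set.mem_biUnion hq hzq)
        rw [Set.indicator_of_mem (by exact this.2), this.1]
    have hcheb := mul_meas_ge_le_lintegral₀ (μ := volume)
      ((measurable_corr hK hgm).enorm.pow_const 2).aemeasurable ((a / 2) ^ 2)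
    have hset : {z | α / 2 ≤ |corr K g z|} ⊆ {z | (a / 2) ^ 2 ≤ ‖corr K g z‖ₑ ^ 2} := by
      intro z hz
      have : a / 2 ≤ ‖corr K g z‖ₑ := by
        rw [← ofReal_norm, ha, show (2 : ℝ≥0∞) = ENNReal.ofReal 2 by simp,
          ← ENNReal.ofReal_div_of_pos (by norm_num)]
        exact ENNReal.ofReal_le_ofReal hz
      exact pow_le_pow_left' this 2
    have ha2 : (a / 2) ^ 2 ≠ 0 := by
      simp [ha0]
    have ha2t : (a / 2) ^ 2 ≠ ∞ := by
      finiteness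
    calc volume {z | α / 2 ≤ |corr K g z|} ≤ volume {z | (a / 2) ^ 2 ≤ ‖corr K g z‖ₑ ^ 2} :=
          measure_mono hset
      _ ≤ (∫⁻ z, ‖corr K g z‖ₑ ^ 2) / (a / 2) ^ 2 := by
          rw [ENNReal.le_div_iff_mul_le (Or.inl ha2) (Or.inl ha2t), mul_comm]; exact hcheb
      _ ≤ (B * ((∫⁻ z, {z | |f z| ≤ α}.indicator (fun z => ‖f z‖ₑ ^ 2) z) +
            64 * a ^ 2 * volume Ω)) / (a / 2) ^ 2 := by
          gcongr
          exact (hL2 g hgm M hgM).trans (by gcongr)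
      _ = _ := by
          have e1 : ((a / 2) ^ 2)⁻¹ = 4 * (a ^ 2)⁻¹ := by
            rw [div_eq_mul_inv, mul_pow,
              ENNReal.mul_inv (Or.inr (by finiteness)) (Or.inr (by simp)),
              ← ENNReal.inv_pow (a := 2), inv_inv, mul_comm]
            norm_num
          rw [div_eq_mul_inv, e1, div_eq_mul_inv]
          have e2 : a ^ 2 * (a ^ 2)⁻¹ = 1 :=
            ENNReal.mul_inv_cancel (by simp [ha0]) (by finiteness)
          calc _ = 4 * B * (a ^ 2)⁻¹ *
                (∫⁻ z, {z | |f z| ≤ α}.indicator (fun z => ‖f z‖ₑ ^ 2) z) +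
                256 * B * volume Ω * (a ^ 2 * (a ^ 2)⁻¹) := by ring
            _ = _ := by rw [e2, mul_one]
  -- the bad part
  have hbad : ∫⁻ z in Ω'ᶜ, ‖corr K (f - g) z‖ₑ ≤ 16 * a * B * volume Ω := by
    have hpt : ∀ z, ‖corr K (f - g) z‖ₑ ≤
        ∑' q : 𝓑, ‖∫ y in dcell q, K (y - z) * (f - g) y‖ₑ := by
      intro z
      have hi : Integrable fun y => K (y - z) * (f - g) y :=
        integrable_mul_of_bounded (hKi.comp_sub_right z) hbm.aestronglyMeasurable hbM
      have e : corr K (f - g) z = ∑' q : 𝓑, ∫ y in dcell q, K (y - z) * (f - g) y := by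
        rw [corr_eq_integral_sub, ← setIntegral_eq_integral_of_forall_compl_eq_zero (s := Ω),
          hΩ, Set.biUnion_eq_iUnion, integral_iUnion (ι := 𝓑) (fun q => measurableSet_dcell _)
            (fun q q' hne => hdis q.2 q'.2 fun e => hne (Subtype.ext e)) hi.integrableOn]
        intro y hy
        have := hoff y fun q hq hzq => hy (Set.mem_biUnion hq hzq)
        simp [this.1]
      rw [e]
      exact enorm_tsum_le_tsum_enorm
    calc ∫⁻ z in Ω'ᶜ, ‖corr K (f - g) z‖ₑ
        ≤ ∫⁻ z in Ω'ᶜ, ∑' q : 𝓑, ‖∫ y in dcell q, K (y - z) * (f - g) y‖ₑ :=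
          lintegral_mono hpt
      _ = ∑' q : 𝓑, ∫⁻ z in Ω'ᶜ, ‖∫ y in dcell q, K (y - z) * (f - g) y‖ₑ := by
          refine lintegral_tsum fun q => Measurable.aemeasurable ?_
          have : StronglyMeasurable fun r : (ℝ × ℝ) × (ℝ × ℝ) => K (r.2 - r.1) * (f - g) r.2 :=
            ((hK.comp (measurable_snd.sub measurable_fst)).mul
              (hbm.comp measurable_snd)).stronglyMeasurable
          exact this.integral_prod_right'.measurable.enorm
      _ ≤ ∑' q : 𝓑, B * (16 * a * volume (dcell q)) := by
          refine ENNReal.tsum_le_tsum fun q => ?_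
          calc _ ≤ ∫⁻ z in (bigBox q)ᶜ, ‖∫ y in dcell q, K (y - z) * (f - g) y‖ₑ :=
                lintegral_mono_set (Set.compl_subset_compl.2 (Set.subset_biUnion_of_mem q.2))
            _ ≤ B * ∫⁻ y in dcell q, ‖(f - g) y‖ₑ :=
                lintegral_enorm_setIntegral_le hK hKi hbm hbM (measurableSet_dcell _)
                  (volume_dcell_ne_top _) (hmean q q.2) _ fun y hy => hH.cell q hy
            _ ≤ _ := by gcongr; exact hb q q.2
      _ = _ := by
          rw [ENNReal.tsum_mul_left, ENNReal.tsum_mul_left, ← hΩv]; ring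
  have hbad' : volume {z | α / 2 ≤ |corr K (f - g) z|} ≤ (32 + 32 * B) * volume Ω := by
    have hcheb := mul_meas_ge_le_lintegral₀ (μ := volume.restrict Ω'ᶜ)
      ((measurable_corr hK hbm).enorm).aemeasurable (a / 2)
    have hSm : MeasurableSet {z | a / 2 ≤ ‖corr K (f - g) z‖ₑ} :=
      measurableSet_le measurable_const (measurable_corr hK hbm).enorm
    rw [Measure.restrict_apply hSm] at hcheb
    have hsub : {z | α / 2 ≤ |corr K (f - g) z|} ⊆
        Ω' ∪ ({z | a / 2 ≤ ‖corr K (f - g) z‖ₑ} ∩ Ω'ᶜ) := by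
      intro z hz
      by_cases hzΩ : z ∈ Ω'
      · exact Or.inl hzΩ
      · refine Or.inr ⟨?_, hzΩ⟩
        change a / 2 ≤ _
        rw [← ofReal_norm, ha, show (2 : ℝ≥0∞) = ENNReal.ofReal 2 by simp,
          ← ENNReal.ofReal_div_of_pos (by norm_num)]
        exact ENNReal.ofReal_le_ofReal hz
    have ha2 : a / 2 ≠ 0 := by simp [ha0]
    have ha2t : a / 2 ≠ ∞ := by finiteness
    have h3 : volume ({z | a / 2 ≤ ‖corr K (f - g) z‖ₑ} ∩ Ω'ᶜ) ≤ 32 * B * volume Ω := by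
      refine (ENNReal.mul_le_mul_iff_right ha2 ha2t).1 ?_
      refine (hcheb.trans hbad).trans (le_of_eq ?_)
      have : (32 : ℝ≥0∞) = 2 * 16 := by norm_num
      rw [this, div_eq_mul_inv, show a * 2⁻¹ * (2 * 16 * B * volume Ω) =
        (2 * 2⁻¹) * (16 * a * B * volume Ω) by ring,
        ENNReal.mul_inv_cancel (by norm_num) (by norm_num), one_mul]
    calc _ ≤ volume Ω' + volume ({z | a / 2 ≤ ‖corr K (f - g) z‖ₑ} ∩ Ω'ᶜ) :=
          (measure_mono hsub).trans (measure_union_le _ _)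
      _ ≤ 32 * volume Ω + 32 * B * volume Ω := add_le_add hΩ'le h3
      _ = _ := by ring
  have hsplit : {z | α < |corr K f z|} ⊆
      {z | α / 2 ≤ |corr K g z|} ∪ {z | α / 2 ≤ |corr K (f - g) z|} := by
    intro z hz
    by_contra hcon
    simp only [Set.mem_union, Set.mem_ofPred_eq, not_or, not_le] at hcon hz
    rw [corr_sub hKi hfm hgm hfM hgM] at hcon
    have h := abs_add_le (corr K g z) (corr K f z - corr K g z)
    rw [add_sub_cancel] at h
    linarith [hcon.1, hcon.2]
  calc volume {z | α < |corr K f z|} ≤ _ := measure_mono hsplit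
    _ ≤ _ := measure_union_le _ _
    _ ≤ (4 * B / a ^ 2 * (∫⁻ z, {z | |f z| ≤ α}.indicator (fun z => ‖f z‖ₑ ^ 2) z) +
        256 * B * volume Ω) + (32 + 32 * B) * volume Ω := add_le_add hgood hbad'
    _ = 4 * B / a ^ 2 * (∫⁻ z, {z | |f z| ≤ α}.indicator (fun z => ‖f z‖ₑ ^ 2) z) +
        (288 * B + 32) * volume Ω := by ring
    _ ≤ _ := by gcongr

theorem lintegral_upper_tail_le {p : ℝ} (hp2 : p < 2) (y : ℝ) :
    ∫⁻ t in Set.Ioi (0 : ℝ), {t | |y| ≤ t}.indicator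
      (fun t => ‖y‖ₑ ^ 2 * ENNReal.ofReal (t ^ (p - 3))) t ≤
      ENNReal.ofReal (1 / (2 - p)) * ‖y‖ₑ ^ p := by
  by_cases hy : y = 0
  · subst hy
    simp
  have hy0 : 0 < |y| := abs_pos.2 hy
  calc _ ≤ ∫⁻ t, {t | |y| ≤ t}.indicator
        (fun t => ‖y‖ₑ ^ 2 * ENNReal.ofReal (t ^ (p - 3))) t :=
        setLIntegral_le_lintegral _ _
    _ = ∫⁻ t in Set.Ioi |y|, ‖y‖ₑ ^ 2 * ENNReal.ofReal (t ^ (p - 3)) := by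
        rw [restrict_Ioi_eq_restrict_Ici]
        exact lintegral_indicator measurableSet_Ici _
    _ = ‖y‖ₑ ^ 2 * ENNReal.ofReal (∫ t in Set.Ioi |y|, t ^ (p - 3)) := by
        rw [lintegral_const_mul _ (by fun_prop), ofReal_integral_eq_lintegral_ofReal
          (integrableOn_Ioi_rpow_of_lt (by linarith) hy0)]
        filter_upwards [ae_restrict_mem measurableSet_Ioi] with t ht
        exact Real.rpow_nonneg (hy0.trans ht).le _
    _ = ENNReal.ofReal (1 / (2 - p)) * ‖y‖ₑ ^ p := by
        rw [integral_Ioi_rpow_of_lt (by linarith) hy0, ← ofReal_norm, Real.norm_eq_abs,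
          ENNReal.ofReal_rpow_of_pos hy0, ← ENNReal.ofReal_pow hy0.le,
          ← ENNReal.ofReal_mul (by positivity),
          ← ENNReal.ofReal_mul (by rw [one_div, inv_nonneg]; linarith)]
        congr 1
        have h2 : 2 - p ≠ 0 := by linarith
        have e : |y| ^ p = |y| ^ 2 * |y| ^ (p - 2) := by
          rw [← Real.rpow_natCast, ← Real.rpow_add hy0]; congr 1; push_cast; ring
        rw [e, show p - 3 + 1 = -(2 - p) by ring, neg_div_neg_eq, neg_sub]
        ring

theorem lintegral_lower_tail_le {p : ℝ} (hp : 1 < p) (y : ℝ) :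
    ∫⁻ t in Set.Ioi (0 : ℝ), {t | t / 2 < |y|}.indicator
      (fun t => ‖y‖ₑ * ENNReal.ofReal (t ^ (p - 2))) t ≤
      ENNReal.ofReal (2 ^ (p - 1) / (p - 1)) * ‖y‖ₑ ^ p := by
  by_cases hy : y = 0
  · subst hy
    simp
  have hy0 : 0 < |y| := abs_pos.2 hy
  have hii := intervalIntegral.intervalIntegrable_rpow' (a := 0) (b := 2 * |y|)
    (show -1 < p - 2 by linarith)
  rw [intervalIntegrable_iff_integrableOn_Ioc_of_le (by positivity)] at hii
  calc _ = ∫⁻ t, (Set.Ioi (0 : ℝ)).indicator ({t | t / 2 < |y|}.indicator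
        (fun t => ‖y‖ₑ * ENNReal.ofReal (t ^ (p - 2)))) t :=
        (lintegral_indicator measurableSet_Ioi _).symm
    _ ≤ ∫⁻ t, (Set.Ioc 0 (2 * |y|)).indicator (fun t => ‖y‖ₑ * ENNReal.ofReal (t ^ (p - 2))) t := by
        refine lintegral_mono fun t => ?_
        rw [Set.indicator_indicator]
        refine Set.indicator_le_indicator_of_subset ?_ (fun _ => zero_le) t
        rintro t ⟨ht0, ht⟩
        simp only [Set.mem_Ioi, Set.mem_ofPred_eq] at ht0 ht
        exact ⟨ht0, by linarith⟩
    _ = ∫⁻ t in Set.Ioc 0 (2 * |y|), ‖y‖ₑ * ENNReal.ofReal (t ^ (p - 2)) :=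
        lintegral_indicator measurableSet_Ioc _
    _ = ‖y‖ₑ * ENNReal.ofReal (∫ t in Set.Ioc 0 (2 * |y|), t ^ (p - 2)) := by
        rw [lintegral_const_mul _ (by fun_prop), ofReal_integral_eq_lintegral_ofReal hii]
        filter_upwards [ae_restrict_mem measurableSet_Ioc] with t ht
        exact Real.rpow_nonneg ht.1.le _
    _ = ENNReal.ofReal (2 ^ (p - 1) / (p - 1)) * ‖y‖ₑ ^ p := by
        have hp1 : 0 < p - 1 := by linarith
        rw [← intervalIntegral.integral_of_le (by positivity),
          integral_rpow (Or.inl (by linarith)), ← ofReal_norm, Real.norm_eq_abs,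
          ENNReal.ofReal_rpow_of_pos hy0,
          ← ENNReal.ofReal_mul (by positivity), ← ENNReal.ofReal_mul (by positivity)]
        congr 1
        rw [show p - 2 + 1 = p - 1 by ring, Real.zero_rpow hp1.ne',
          Real.mul_rpow (by norm_num) hy0.le]
        have : |y| ^ p = |y| * |y| ^ (p - 1) := by
          rw [show p = 1 + (p - 1) by ring, Real.rpow_add hy0, Real.rpow_one]
          ring_nf
        rw [this]
        field_simp
        ring

/-- Marcinkiewicz-type interpolation for one function satisfying a truncated weak-type bound. -/
theorem lintegral_rpow_le_of_truncated_weak {α : Type*} [MeasurableSpace α] {μ : Measure α}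
    [SFinite μ] {f h : α → ℝ} (hf : Measurable f) (hh : Measurable h) {p : ℝ} (hp : 1 < p)
    (hp2 : p < 2) {c₁ c₂ : ℝ≥0∞}
    (H : ∀ t : ℝ, 0 < t → μ {z | t < |h z|} ≤
      c₁ / ENNReal.ofReal t ^ 2 * (∫⁻ z, {z | |f z| ≤ t}.indicator (fun z => ‖f z‖ₑ ^ 2) z ∂μ) +
      c₂ / ENNReal.ofReal t * ∫⁻ z, {z | t / 2 < |f z|}.indicator (fun z => ‖f z‖ₑ) z ∂μ) :
    ∫⁻ z, ‖h z‖ₑ ^ p ∂μ ≤ ENNReal.ofReal p * (c₁ * ENNReal.ofReal (1 / (2 - p)) +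
      c₂ * ENNReal.ofReal (2 ^ (p - 1) / (p - 1))) * ∫⁻ z, ‖f z‖ₑ ^ p ∂μ := by
  have hp0 : 0 < p := by linarith
  have e0 : ∫⁻ z, ‖h z‖ₑ ^ p ∂μ = ∫⁻ z, ENNReal.ofReal (|h z| ^ p) ∂μ := by
    refine lintegral_congr fun z => ?_
    rw [← ofReal_norm, Real.norm_eq_abs, ENNReal.ofReal_rpow_of_nonneg (abs_nonneg _) hp0.le]
  rw [e0, lintegral_rpow_eq_lintegral_meas_lt_mul μ
    (Filter.Eventually.of_forall fun _ => abs_nonneg _)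
    hh.abs.aemeasurable hp0, mul_assoc]
  refine mul_le_mul_right ?_ _
  set F₁ : ℝ → α → ℝ≥0∞ := fun t z => {t | |f z| ≤ t}.indicator
      (fun t => ‖f z‖ₑ ^ 2 * ENNReal.ofReal (t ^ (p - 3))) t with hF₁
  set F₂ : ℝ → α → ℝ≥0∞ := fun t z => {t | t / 2 < |f z|}.indicator
      (fun t => ‖f z‖ₑ * ENNReal.ofReal (t ^ (p - 2))) t with hF₂
  have hfs : Measurable fun q : ℝ × α => |f q.2| := (hf.comp measurable_snd).abs
  have hm₁ : Measurable (Function.uncurry F₁) := by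
    have : Function.uncurry F₁ = {q : ℝ × α | |f q.2| ≤ q.1}.indicator
      (fun q => ‖f q.2‖ₑ ^ 2 * ENNReal.ofReal (q.1 ^ (p - 3))) := by
      ext ⟨t, z⟩; simp [hF₁, Function.uncurry, Set.indicator]
    rw [this]
    refine Measurable.indicator ?_ (measurableSet_le hfs measurable_fst)
    exact ((hf.comp measurable_snd).enorm.pow_const 2).mul
      (measurable_fst.pow_const _).ennreal_ofReal
  have hm₂ : Measurable (Function.uncurry F₂) := by
    have : Function.uncurry F₂ = {q : ℝ × α | q.1 / 2 < |f q.2|}.indicator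
      (fun q => ‖f q.2‖ₑ * ENNReal.ofReal (q.1 ^ (p - 2))) := by
      ext ⟨t, z⟩; simp [hF₂, Function.uncurry, Set.indicator]
    rw [this]
    refine Measurable.indicator ?_ (measurableSet_lt (measurable_fst.div_const _) hfs)
    exact ((hf.comp measurable_snd).enorm).mul (measurable_fst.pow_const _).ennreal_ofReal
  calc ∫⁻ t in Set.Ioi (0 : ℝ), μ {z | t < |h z|} * ENNReal.ofReal (t ^ (p - 1))
      ≤ ∫⁻ t in Set.Ioi (0 : ℝ), (c₁ * ∫⁻ z, F₁ t z ∂μ) + c₂ * ∫⁻ z, F₂ t z ∂μ := by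
        refine setLIntegral_mono' measurableSet_Ioi fun t ht => ?_
        have ht : 0 < t := ht
        have ha0 : ENNReal.ofReal t ≠ 0 := (ENNReal.ofReal_pos.2 ht).ne'
        refine (mul_le_mul_left (H t ht) _).trans (le_of_eq ?_)
        have e1 : ENNReal.ofReal (t ^ (p - 1)) =
          ENNReal.ofReal t ^ 2 * ENNReal.ofReal (t ^ (p - 3)) := by
          rw [← ENNReal.ofReal_pow ht.le, ← ENNReal.ofReal_mul (by positivity),
            ← Real.rpow_natCast, ← Real.rpow_add ht]
          congr 2; push_cast; ring
        have e2 : ENNReal.ofReal (t ^ (p - 1)) =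
          ENNReal.ofReal t * ENNReal.ofReal (t ^ (p - 2)) := by
          rw [← ENNReal.ofReal_mul ht.le]
          congr 1
          rw [show p - 1 = 1 + (p - 2) by ring, Real.rpow_add ht, Real.rpow_one]
        have i1 : ∫⁻ z, F₁ t z ∂μ = (∫⁻ z, {z | |f z| ≤ t}.indicator (fun z => ‖f z‖ₑ ^ 2) z ∂μ) *
            ENNReal.ofReal (t ^ (p - 3)) := by
          rw [← lintegral_mul_const _ ((hf.enorm.pow_const 2).indicator
            (measurableSet_le hf.abs measurable_const))]
          refine lintegral_congr fun z => ?_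
          simp [hF₁, Set.indicator]
        have i2 : ∫⁻ z, F₂ t z ∂μ = (∫⁻ z, {z | t / 2 < |f z|}.indicator (fun z => ‖f z‖ₑ) z ∂μ) *
            ENNReal.ofReal (t ^ (p - 2)) := by
          rw [← lintegral_mul_const _ (hf.enorm.indicator
            (measurableSet_lt measurable_const hf.abs))]
          refine lintegral_congr fun z => ?_
          simp [hF₂, Set.indicator]
        rw [add_mul, i1, i2]
        have c1 : (ENNReal.ofReal t ^ 2)⁻¹ * ENNReal.ofReal t ^ 2 = 1 :=
          ENNReal.inv_mul_cancel (by simp [ht]) (by finiteness)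
        have c2 : (ENNReal.ofReal t)⁻¹ * ENNReal.ofReal t = 1 :=
          ENNReal.inv_mul_cancel ha0 (by finiteness)
        congr 1
        · rw [e1, div_eq_mul_inv]
          calc _ = c₁ * (∫⁻ z, {z | |f z| ≤ t}.indicator (fun z => ‖f z‖ₑ ^ 2) z ∂μ) *
                ENNReal.ofReal (t ^ (p - 3)) *
                ((ENNReal.ofReal t ^ 2)⁻¹ * ENNReal.ofReal t ^ 2) := by ring
            _ = _ := by rw [c1]; ring
        · rw [e2, div_eq_mul_inv]
          calc _ = c₂ * (∫⁻ z, {z | t / 2 < |f z|}.indicator (fun z => ‖f z‖ₑ) z ∂μ) *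
                ENNReal.ofReal (t ^ (p - 2)) *
                ((ENNReal.ofReal t)⁻¹ * ENNReal.ofReal t) := by ring
            _ = _ := by rw [c2]; ring
    _ = (c₁ * ∫⁻ z, (∫⁻ t in Set.Ioi (0 : ℝ), F₁ t z) ∂μ) +
          c₂ * ∫⁻ z, (∫⁻ t in Set.Ioi (0 : ℝ), F₂ t z) ∂μ := by
        have k₁ : Measurable fun t => ∫⁻ z, F₁ t z ∂μ := hm₁.lintegral_prod_right'
        have k₂ : Measurable fun t => ∫⁻ z, F₂ t z ∂μ := hm₂.lintegral_prod_right'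
        rw [lintegral_add_left (k₁.const_mul _), lintegral_const_mul _ k₁,
          lintegral_const_mul _ k₂,
          lintegral_lintegral_swap hm₁.aemeasurable, lintegral_lintegral_swap hm₂.aemeasurable]
    _ ≤ c₁ * (∫⁻ z, ENNReal.ofReal (1 / (2 - p)) * ‖f z‖ₑ ^ p ∂μ) +
          c₂ * ∫⁻ z, ENNReal.ofReal (2 ^ (p - 1) / (p - 1)) * ‖f z‖ₑ ^ p ∂μ := by
        gcongr with z z
        · exact lintegral_upper_tail_le hp2 (f z)
        · exact lintegral_lower_tail_le hp (f z)
    _ = _ := by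
        rw [lintegral_const_mul _ (hf.enorm.pow_const _),
          lintegral_const_mul _ (hf.enorm.pow_const _)]
        ring

/-- A uniform `L²` bound for `corr K` on bounded measurable functions. -/
def L2Bounded (K : ℝ × ℝ → ℝ) (B : ℝ≥0∞) : Prop :=
  ∀ g : ℝ × ℝ → ℝ, Measurable g → ∀ M : ℝ, (∀ z, |g z| ≤ M) →
    ∫⁻ z, ‖corr K g z‖ₑ ^ 2 ≤ B * ∫⁻ z, ‖g z‖ₑ ^ 2

theorem corr_neg_eq (K g : ℝ × ℝ → ℝ) (z : ℝ × ℝ) :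
    corr (fun w => K (-w)) g z = corr K (fun y => g (-y)) (-z) := by
  rw [corr, corr, ← integral_neg_eq_self]
  simp only [neg_neg, neg_add_rev]
  refine integral_congr_ae (Filter.Eventually.of_forall fun w => ?_)
  simp
  left; congr 1; abel

theorem L2Bounded.reflect {K : ℝ × ℝ → ℝ} {B : ℝ≥0∞} (h : L2Bounded K B) :
    L2Bounded (fun w => K (-w)) B := by
  intro g hg M hM
  simp only [corr_neg_eq]
  rw [lintegral_neg_eq_self (μ := volume) (fun z => ‖corr K (fun y => g (-y)) z‖ₑ ^ 2),
    ← lintegral_neg_eq_self (μ := volume) (fun z => ‖g z‖ₑ ^ 2)]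
  exact h _ (hg.comp measurable_neg) M fun z => hM _

theorem ParabolicHormander.reflect {K : ℝ × ℝ → ℝ} {B : ℝ≥0∞} (h : ParabolicHormander K B) :
    ParabolicHormander (fun w => K (-w)) B := by
  intro l hl s a hs ha
  refine le_trans (le_of_eq ?_) (h l hl (-s) (-a) (by rwa [abs_neg]) (by rwa [abs_neg]))
  have hmp : MeasurePreserving (fun z : ℝ × ℝ => -z) volume volume :=
    Measure.measurePreserving_neg _
  refine Eq.trans ?_ (hmp.setLIntegral_comp_preimage_emb
    (MeasurableEquiv.neg (ℝ × ℝ)).measurableEmbedding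
    (fun u => ‖K (u + (-s, -a)) - K u‖ₑ) _)
  have : (fun z : ℝ × ℝ => -z) ⁻¹' {u : ℝ × ℝ | ¬ (|u.1| ≤ 4 * l ^ 2 ∧ |u.2| ≤ 2 * l)} =
      {u : ℝ × ℝ | ¬ (|u.1| ≤ 4 * l ^ 2 ∧ |u.2| ≤ 2 * l)} := by
    ext z; simp
  rw [this]
  refine lintegral_congr fun z => ?_
  have e : -(z + (s, a)) = -z + (-s, -a) := by ext <;> simp <;> ring
  simp only [e]

theorem integral_corr_mul {K f φ : ℝ × ℝ → ℝ} (hKi : Integrable K)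
    (hfi : Integrable f) (hφ : Measurable φ) {M : ℝ} (hM : ∀ z, |φ z| ≤ M) :
    ∫ z, corr K f z * φ z = ∫ y, f y * corr (fun w => K (-w)) φ y := by
  have hint : Integrable (fun q : (ℝ × ℝ) × (ℝ × ℝ) => K (q.2 - q.1) * f q.2 * φ q.1)
      (volume.prod volume) := by
    have h1 : Integrable (fun q : (ℝ × ℝ) × (ℝ × ℝ) => f q.1 * K (-q.2)) (volume.prod volume) :=
      hfi.mul_prod hKi.comp_neg
    have h2 := ((measurePreserving_prod_sub_swap (volume : Measure (ℝ × ℝ))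
      (volume : Measure (ℝ × ℝ))).integrable_comp h1.aestronglyMeasurable).2 h1
    have h3 := h2.mul_bdd (c := M) (hφ.comp measurable_fst).aestronglyMeasurable
      (Filter.Eventually.of_forall fun q => hM _)
    refine h3.congr (Filter.Eventually.of_forall fun q => ?_)
    simp [mul_comm (f q.2)]
  calc ∫ z, corr K f z * φ z = ∫ z, ∫ y, K (y - z) * f y * φ z := by
        simp only [corr_eq_integral_sub, integral_mul_const]
    _ = ∫ y, ∫ z, K (y - z) * f y * φ z := integral_integral_swap hint
    _ = _ := by
        refine integral_congr_ae (Filter.Eventually.of_forall fun y => ?_)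
        simp only [corr_eq_integral_sub, ← integral_const_mul, neg_sub]
        refine integral_congr_ae (Filter.Eventually.of_forall fun z => ?_)
        simp only; ring

theorem eLpNorm_corr_le_of_lt_two {p : ℝ} (hp : 1 < p) (hp2 : p < 2) (B : NNReal) :
    ∃ C : NNReal, C ≠ 0 ∧ ∀ K : ℝ × ℝ → ℝ, Measurable K → Integrable K → L2Bounded K B →
      ParabolicHormander K B → ∀ f : ℝ × ℝ → ℝ, Measurable f → ∀ M : ℝ, (∀ z, |f z| ≤ M) →
      eLpNorm (corr K f) (ENNReal.ofReal p) volume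
        ≤ C * eLpNorm f (ENNReal.ofReal p) volume := by
  have hp0 : 0 < p := by linarith
  set A : ℝ≥0∞ := ENNReal.ofReal p * (4 * B * ENNReal.ofReal (1 / (2 - p)) +
      ((288 * B + 32) * 2) * ENNReal.ofReal (2 ^ (p - 1) / (p - 1))) with hA
  have hAt : A ≠ ∞ := by finiteness
  have hA0 : A ≠ 0 := by
    have : 0 < 2 ^ (p - 1) / (p - 1) := div_pos (by positivity) (by linarith)
    simp [hA, hp0, this]
  refine ⟨(A ^ (1 / p)).toNNReal, ?_, fun K hK hKi hL2 hH f hf M hM => ?_⟩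
  · rw [Ne, ENNReal.toNNReal_eq_zero_iff, not_or]
    exact ⟨by simp [ENNReal.rpow_eq_zero_iff, hA0, hAt], by finiteness⟩
  · have hfin : A ^ (1 / p) ≠ ∞ := by finiteness
    rw [ENNReal.coe_toNNReal hfin]
    refine eLpNorm_corr_le_of_dense hp hK hKi
      (by simp [ENNReal.rpow_eq_zero_iff, hA0, hAt]) (fun f hf hfc => ?_) hf hM
    rw [eLpNorm_ofReal_eq hp, eLpNorm_ofReal_eq hp,
      ← ENNReal.mul_rpow_of_nonneg _ _ (by positivity)]
    refine ENNReal.rpow_le_rpow ?_ (by positivity)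
    refine lintegral_rpow_le_of_truncated_weak hf.measurable (measurable_corr hK hf.measurable)
      hp hp2 fun t ht => (volume_lt_corr_le hK hKi hL2 hH hf hfc ht).trans (le_of_eq ?_)
    simp only [div_eq_mul_inv]
    ring

theorem eLpNorm_corr_le_two {B : NNReal} {K f : ℝ × ℝ → ℝ} (hL2 : L2Bounded K B)
    (hf : Measurable f) {M : ℝ} (hM : ∀ z, |f z| ≤ M) :
    eLpNorm (corr K f) (ENNReal.ofReal 2) volume
      ≤ (B : ℝ≥0∞) ^ (1 / 2 : ℝ) * eLpNorm f (ENNReal.ofReal 2) volume := by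
  rw [eLpNorm_ofReal_eq one_lt_two, eLpNorm_ofReal_eq one_lt_two,
    ← ENNReal.mul_rpow_of_nonneg _ _ (by positivity)]
  refine ENNReal.rpow_le_rpow ?_ (by positivity)
  simpa using hL2 f hf M hM

/-- Duality step: an `L^q` bound for the reflected kernel gives an `L^p` bound. -/
theorem eLpNorm_corr_le_of_dual {p q : ℝ} (hpq : p.HolderConjugate q) (hp2 : 2 < p)
    {K : ℝ × ℝ → ℝ} (hK : Measurable K) (hKi : Integrable K) {C : NNReal} (hC : C ≠ 0)
    (H : ∀ f : ℝ × ℝ → ℝ, Measurable f → ∀ M : ℝ, (∀ z, |f z| ≤ M) →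
      eLpNorm (corr (fun w => K (-w)) f) (ENNReal.ofReal q) volume
        ≤ C * eLpNorm f (ENNReal.ofReal q) volume)
    {f : ℝ × ℝ → ℝ} (hf : Measurable f) {M : ℝ} (hM : ∀ z, |f z| ≤ M) :
    eLpNorm (corr K f) (ENNReal.ofReal p) volume ≤ C * eLpNorm f (ENNReal.ofReal p) volume := by
  have hp := hpq.lt
  have hq := hpq.symm.lt
  have hp0 := hpq.pos
  have hq0 := hpq.symm.pos
  refine eLpNorm_corr_le_of_dense hp hK hKi (by simpa using hC) (fun f hf hfc => ?_) hf hM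
  have hfm := hf.measurable
  obtain ⟨M, hM⟩ : ∃ M, ∀ z, |f z| ≤ M := by simpa using hf.bounded_above_of_compact_support hfc
  have hfi := hf.integrable_of_hasCompactSupport hfc (μ := volume)
  set h := corr K f with hh
  have hhm : Measurable h := measurable_corr hK hfm
  set M' := (∫ w, |K w|) * M with hM'
  have hhM : ∀ z, |h z| ≤ M' := corr_bounded hKi hM
  set φ : ℝ × ℝ → ℝ := fun z => h z * |h z| ^ (p - 2) with hφ
  have hφm : Measurable φ := hhm.mul (hhm.abs.pow_const _)
  have habs : ∀ z, |φ z| = |h z| ^ (p - 1) := by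
    intro z
    simp only [hφ, abs_mul, abs_of_nonneg (Real.rpow_nonneg (abs_nonneg (h z)) _)]
    rw [show p - 1 = 1 + (p - 2) by ring, Real.rpow_add_of_nonneg (abs_nonneg _) (by norm_num)
      (by linarith), Real.rpow_one]
  have hφM : ∀ z, |φ z| ≤ M' ^ (p - 1) := fun z => by
    rw [habs]; exact Real.rpow_le_rpow (abs_nonneg _) (hhM z) (by linarith)
  have hmul : ∀ z, h z * φ z = |h z| ^ p := by
    intro z
    have : h z * φ z = |h z| ^ (2 : ℝ) * |h z| ^ (p - 2) := by
      rw [Real.rpow_two, sq_abs]; simp only [hφ]; ring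
    rw [this, ← Real.rpow_add_of_nonneg (abs_nonneg _) (by norm_num) (by linarith)]
    congr 1; ring
  set X := ∫⁻ z, ‖h z‖ₑ ^ p with hX
  have hXt : X ≠ ∞ := by
    have h1 := lintegral_corr_rpow_le hp hK hfm
    refine ne_top_of_le_ne_top (ENNReal.mul_ne_top ?_ ?_) h1
    · have : ∫⁻ w, ‖K w‖ₑ ≠ ∞ := hKi.2.ne
      finiteness
    · have h2 : MemLp f (ENNReal.ofReal p) := hf.memLp_of_hasCompactSupport hfc
      have h3 := h2.2
      rw [eLpNorm_ofReal_eq hp, ENNReal.rpow_lt_top_iff_of_pos (by positivity)] at h3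
      exact h3.ne
  have eX : ∀ z, ‖h z‖ₑ ^ p = ENNReal.ofReal (|h z| ^ p) := fun z => by
    rw [← ofReal_norm, Real.norm_eq_abs, ENNReal.ofReal_rpow_of_nonneg (abs_nonneg _) hp0.le]
  have hφq : ∫⁻ z, ‖φ z‖ₑ ^ q = X := by
    refine lintegral_congr fun z => ?_
    rw [eX, ← ofReal_norm, Real.norm_eq_abs, ENNReal.ofReal_rpow_of_nonneg (abs_nonneg _) hq0.le,
      habs, ← Real.rpow_mul (abs_nonneg _), hpq.sub_one_mul_conj]
  have hint : Integrable fun z => |h z| ^ p := by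
    refine ⟨(hhm.abs.pow_const p).aestronglyMeasurable, ?_⟩
    rw [hasFiniteIntegral_iff_enorm, lt_top_iff_ne_top]
    convert! hXt using 1
    refine lintegral_congr fun z => ?_
    rw [eX, ← ofReal_norm, Real.norm_eq_abs, abs_of_nonneg (by positivity)]
  have key : X ≤ C * eLpNorm f (ENNReal.ofReal p) volume * X ^ (1 / q) := by
    calc X = ENNReal.ofReal (∫ z, h z * φ z) := by
          simp only [hmul]
          rw [ofReal_integral_eq_lintegral_ofReal hint
            (Filter.Eventually.of_forall fun z => by positivity), hX]
          simp only [eX]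
      _ = ENNReal.ofReal (∫ y, f y * corr (fun w => K (-w)) φ y) := by
          rw [hh, integral_corr_mul hKi hfi hφm hφM]
      _ ≤ ∫⁻ y, ‖f y‖ₑ * ‖corr (fun w => K (-w)) φ y‖ₑ := by
          refine (ENNReal.ofReal_le_ofReal (le_abs_self _)).trans ?_
          rw [← Real.norm_eq_abs, ofReal_norm]
          refine (enorm_integral_le_lintegral_enorm _).trans (le_of_eq ?_)
          simp only [enorm_mul]
      _ ≤ eLpNorm f (ENNReal.ofReal p) volume *
          eLpNorm (corr (fun w => K (-w)) φ) (ENNReal.ofReal q) volume := by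
          rw [eLpNorm_ofReal_eq hp, eLpNorm_ofReal_eq hq]
          exact ENNReal.lintegral_mul_le_Lp_mul_Lq volume hpq hfm.enorm.aemeasurable
            (measurable_corr (hK.comp measurable_neg) hφm).enorm.aemeasurable
      _ ≤ eLpNorm f (ENNReal.ofReal p) volume * (C * X ^ (1 / q)) := by
          gcongr
          refine (H φ hφm _ hφM).trans (le_of_eq ?_)
          rw [eLpNorm_ofReal_eq hq, hφq]
      _ = _ := by ring
  rw [eLpNorm_ofReal_eq hp h]
  change X ^ (1 / p) ≤ _
  by_cases hX0 : X = 0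
  · rw [hX0, ENNReal.zero_rpow_of_pos (by positivity)]; exact zero_le
  · have hXq0 : X ^ (1 / q) ≠ 0 := by simp [ENNReal.rpow_eq_zero_iff, hX0, hXt]
    have hXqt : X ^ (1 / q) ≠ ∞ := by finiteness
    refine (ENNReal.mul_le_mul_iff_left hXq0 hXqt).1 (le_trans (le_of_eq ?_) key)
    rw [← ENNReal.rpow_add _ _ hX0 hXt]
    have := hpq.inv_add_inv_eq_one
    rw [one_div, one_div, this, ENNReal.rpow_one]

/-- `L^p` boundedness of parabolic Calderón–Zygmund operators, with a constant depending only
on `p` and the kernel bound. -/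
theorem exists_eLpNorm_corr_le {p : ℝ} (hp : 1 < p) (B : NNReal) :
    ∃ C : NNReal, ∀ K : ℝ × ℝ → ℝ, Measurable K → Integrable K → L2Bounded K B →
      ParabolicHormander K B → ∀ f : ℝ × ℝ → ℝ, Measurable f → ∀ M : ℝ, (∀ z, |f z| ≤ M) →
      eLpNorm (corr K f) (ENNReal.ofReal p) volume
        ≤ C * eLpNorm f (ENNReal.ofReal p) volume := by
  rcases lt_trichotomy p 2 with h | rfl | h
  · obtain ⟨C, -, hC⟩ := eLpNorm_corr_le_of_lt_two hp h B
    exact ⟨C, hC⟩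
  · refine ⟨((B : ℝ≥0∞) ^ (1 / 2 : ℝ)).toNNReal, fun K hK hKi hL2 hH f hf M hM => ?_⟩
    rw [ENNReal.coe_toNNReal (by finiteness)]
    exact eLpNorm_corr_le_two hL2 hf hM
  · have hpq := Real.HolderConjugate.conjExponent hp
    have hq2 : p.conjExponent < 2 := by
      rw [Real.conjExponent, div_lt_iff₀ (by linarith)]; linarith
    obtain ⟨C, hC0, hC⟩ := eLpNorm_corr_le_of_lt_two hpq.symm.lt hq2 B
    exact ⟨C, fun K hK hKi hL2 hH f hf M hM => eLpNorm_corr_le_of_dual hpq h hK hKi hC0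
      (hC _ (hK.comp measurable_neg) hKi.comp_neg hL2.reflect hH.reflect) hf hM⟩

/-- The standard Gaussian density. -/
noncomputable def gam (z : ℝ) : ℝ := (Real.sqrt (2 * Real.pi))⁻¹ * Real.exp (-z ^ 2 / 2)

theorem gam_nonneg (z : ℝ) : 0 ≤ gam z := by unfold gam; positivity

theorem continuous_gam : Continuous gam := by unfold gam; fun_prop

theorem hasDerivAt_gam (z : ℝ) : HasDerivAt gam (-z * gam z) z := by
  have h : HasDerivAt (fun z : ℝ => -z ^ 2 / 2) (-z) z := by
    refine ((hasDerivAt_pow 2 z).fun_neg.div_const 2).congr_deriv ?_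
    norm_num; ring
  refine ((h.exp).const_mul (Real.sqrt (2 * Real.pi))⁻¹).congr_deriv ?_
  unfold gam; ring

theorem integrable_pow_mul_gam (n : ℕ) : Integrable fun z => z ^ n * gam z := by
  have h := integrable_rpow_mul_exp_neg_mul_sq (b := 1 / 2) (by norm_num) (s := n)
    (lt_of_lt_of_le (by norm_num) (Nat.cast_nonneg n))
  refine (h.const_mul (Real.sqrt (2 * Real.pi))⁻¹).congr (Filter.Eventually.of_forall fun z => ?_)
  simp only [gam, Real.rpow_natCast]
  rw [show -(1 / 2) * z ^ 2 = -z ^ 2 / 2 by ring]; ring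

theorem integral_gam : ∫ z, gam z = 1 := by
  have h := integral_gaussian (1 / 2)
  unfold gam
  rw [integral_const_mul]
  have e : ∀ z : ℝ, -z ^ 2 / 2 = -(1 / 2) * z ^ 2 := fun z => by ring
  simp only [e]
  rw [h, show Real.pi / (1 / 2) = 2 * Real.pi by ring, inv_mul_cancel₀]
  positivity

/-- Profiles of the spatial derivatives of the heat kernel. -/
noncomputable def prof2 (z : ℝ) : ℝ := (z ^ 2 - 1) * gam z
noncomputable def prof3 (z : ℝ) : ℝ := -(z ^ 3 - 3 * z) * gam z
noncomputable def prof4 (z : ℝ) : ℝ := (z ^ 4 - 6 * z ^ 2 + 3) * gam z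

theorem hasDerivAt_prof2 (z : ℝ) : HasDerivAt prof2 (prof3 z) z := by
  refine (((hasDerivAt_pow 2 z).sub_const 1).mul (hasDerivAt_gam z)).congr_deriv ?_
  unfold prof3
  norm_num; ring

theorem continuous_prof2 : Continuous prof2 := by unfold prof2; have := continuous_gam; fun_prop
theorem continuous_prof3 : Continuous prof3 := by unfold prof3; have := continuous_gam; fun_prop
theorem continuous_prof4 : Continuous prof4 := by unfold prof4; have := continuous_gam; fun_prop

theorem integrable_gam : Integrable gam := by simpa using integrable_pow_mul_gam 0

theorem integrable_prof2 : Integrable prof2 := by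
  refine ((integrable_pow_mul_gam 2).sub integrable_gam).congr
    (Filter.Eventually.of_forall fun z => ?_)
  simp [prof2]; ring

theorem integrable_sq_mul_prof2 : Integrable fun z => z ^ 2 * prof2 z := by
  refine ((integrable_pow_mul_gam 4).sub (integrable_pow_mul_gam 2)).congr
    (Filter.Eventually.of_forall fun z => ?_)
  simp [prof2]; ring

theorem integrable_prof3 : Integrable prof3 := by
  refine (((integrable_pow_mul_gam 1).const_mul 3).sub (integrable_pow_mul_gam 3)).congr
    (Filter.Eventually.of_forall fun z => ?_)
  simp [prof3]; ring

theorem integrable_prof4 : Integrable prof4 := by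
  refine (((integrable_pow_mul_gam 4).sub ((integrable_pow_mul_gam 2).const_mul 6)).add
    (integrable_gam.const_mul 3)).congr
    (Filter.Eventually.of_forall fun z => ?_)
  simp [prof4]; ring

/-- Inverse standard deviation of the heat kernel at time `r`. -/
noncomputable def isd (r : ℝ) : ℝ := (Real.sqrt (2 * r))⁻¹

theorem isd_pos {r : ℝ} (hr : 0 < r) : 0 < isd r := by unfold isd; positivity

theorem isd_sq {r : ℝ} (hr : 0 < r) : isd r ^ 2 = (2 * r)⁻¹ := by
  rw [isd, inv_pow, Real.sq_sqrt (by positivity)]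

theorem hasDerivAt_isd {r : ℝ} (hr : 0 < r) : HasDerivAt isd (-isd r ^ 3) r := by
  have h1 : HasDerivAt (fun r : ℝ => 2 * r) 2 r := by simpa using (hasDerivAt_id r).const_mul 2
  refine ((h1.sqrt (by positivity)).inv (by positivity)).congr_deriv ?_
  unfold isd
  have : Real.sqrt (2 * r) ≠ 0 := by positivity
  field_simp

/-- The second spatial derivative of the heat kernel. -/
noncomputable def heat2 (r y : ℝ) : ℝ := isd r ^ 3 * prof2 (isd r * y)

theorem hasDerivAt_heat2_path {r s y a θ : ℝ} (hr : 0 < r + θ * s) :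
    HasDerivAt (fun θ : ℝ => heat2 (r + θ * s) (y + θ * a))
      (s * (isd (r + θ * s) ^ 5 * prof4 (isd (r + θ * s) * (y + θ * a))) +
        a * (isd (r + θ * s) ^ 4 * prof3 (isd (r + θ * s) * (y + θ * a)))) θ := by
  have h1 : HasDerivAt (fun θ : ℝ => r + θ * s) s θ := by
    simpa using ((hasDerivAt_id θ).mul_const s).const_add r
  have h2 : HasDerivAt (fun θ : ℝ => y + θ * a) a θ := by
    simpa using ((hasDerivAt_id θ).mul_const a).const_add y
  have h3 : HasDerivAt (fun θ : ℝ => isd (r + θ * s)) (-isd (r + θ * s) ^ 3 * s) θ :=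
    HasDerivAt.comp (h₂ := isd) θ (hasDerivAt_isd hr) h1
  have h4 := (hasDerivAt_prof2 (isd (r + θ * s) * (y + θ * a))).comp θ (h3.mul h2)
  refine ((h3.pow 3).mul h4).congr_deriv ?_
  simp only [prof2, prof3, prof4, Function.comp, Pi.pow_apply, Pi.mul_apply]
  push_cast
  ring

theorem lintegral_comp_isd {P : ℝ → ℝ} {r : ℝ} (hr : 0 < r) (b : ℝ) (n : ℕ) :
    ∫⁻ y, ‖isd r ^ (n + 1) * P (isd r * (y + b))‖ₑ
      = ENNReal.ofReal (isd r ^ n) * ∫⁻ z, ‖P z‖ₑ := by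
  have hc := isd_pos hr
  rw [lintegral_add_right_eq_self (fun y => ‖isd r ^ (n + 1) * P (isd r * y)‖ₑ) b]
  have e : ∫⁻ y, ‖P (isd r * y)‖ₑ = ENNReal.ofReal (isd r)⁻¹ * ∫⁻ z, ‖P z‖ₑ := by
    have h := (Homeomorph.mulLeft₀ (isd r) hc.ne').measurableEmbedding.lintegral_map
      (μ := volume) (fun z => ‖P z‖ₑ)
    simp only [Homeomorph.coe_mulLeft₀] at h
    rw [← h, Real.map_volume_mul_left hc.ne', lintegral_smul_measure, abs_of_pos (by positivity),
      smul_eq_mul]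
  simp only [enorm_mul]
  rw [lintegral_const_mul' _ _ (by finiteness), e, ← mul_assoc, ← ofReal_norm, Real.norm_eq_abs,
    abs_of_pos (by positivity), ← ENNReal.ofReal_mul (by positivity)]
  congr 2
  field_simp
  ring

theorem lintegral_heat2 {r : ℝ} (hr : 0 < r) (b : ℝ) :
    ∫⁻ y, ‖heat2 r (y + b)‖ₑ = ENNReal.ofReal (2 * r)⁻¹ * ∫⁻ z, ‖prof2 z‖ₑ := by
  rw [← isd_sq hr, ← lintegral_comp_isd hr b 2]; rfl

theorem setLIntegral_heat2_tail_le {r l : ℝ} (hr : 0 < r) (hl : 0 < l) (b : ℝ) :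
    ∫⁻ y in {y | l ≤ |y + b|}, ‖heat2 r (y + b)‖ₑ
      ≤ ENNReal.ofReal (l ^ 2)⁻¹ * ∫⁻ z, ‖z ^ 2 * prof2 z‖ₑ := by
  have hc := isd_pos hr
  have h := lintegral_comp_isd (P := fun z => z ^ 2 * prof2 z) hr b 0
  simp only [pow_zero, ENNReal.ofReal_one, one_mul] at h
  rw [← h, ← lintegral_const_mul' _ _ ENNReal.ofReal_ne_top]
  refine (setLIntegral_mono' (measurableSet_le measurable_const (by fun_prop)) fun y hy => ?_).trans
    (setLIntegral_le_lintegral _ _)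
  have hy : l ≤ |y + b| := hy
  rw [← ofReal_norm, ← ofReal_norm, ← ENNReal.ofReal_mul (by positivity)]
  refine ENNReal.ofReal_le_ofReal ?_
  have hl2 : l ^ 2 ≤ (y + b) ^ 2 := by rw [← sq_abs (y + b)]; gcongr
  have e : (l ^ 2)⁻¹ * ‖isd r ^ (0 + 1) * ((isd r * (y + b)) ^ 2 * prof2 (isd r * (y + b)))‖ =
      ((l ^ 2)⁻¹ * (y + b) ^ 2) * ‖heat2 r (y + b)‖ := by
    simp only [heat2, norm_mul, Real.norm_eq_abs, abs_pow, abs_mul, abs_of_pos hc, ← sq_abs (y + b)]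
    ring
  rw [e]
  refine le_mul_of_one_le_left (norm_nonneg _) ?_
  rw [inv_mul_eq_div, one_le_div (by positivity)]
  exact hl2

theorem continuousOn_isd : ContinuousOn isd (Set.Ioi 0) := fun _ hr =>
  (hasDerivAt_isd hr).continuousAt.continuousWithinAt

theorem lintegral_heat2_path_le {r s a : ℝ} (hr : 0 < r) (hs : |s| ≤ r / 4) :
    ∫⁻ y, ‖heat2 (r + s) (y + a) - heat2 r y‖ₑ ≤
      ENNReal.ofReal (|s| * (r ^ 2)⁻¹) * (∫⁻ z, ‖prof4 z‖ₑ) +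
        ENNReal.ofReal (|a| * r ^ (-(3 / 2) : ℝ)) * ∫⁻ z, ‖prof3 z‖ₑ := by
  set F : ℝ → ℝ → ℝ := fun θ y =>
    s * (isd (r + θ * s) ^ 5 * prof4 (isd (r + θ * s) * (y + θ * a))) +
        a * (isd (r + θ * s) ^ 4 * prof3 (isd (r + θ * s) * (y + θ * a))) with hF
  have hρ : ∀ θ ∈ Set.Icc (0 : ℝ) 1, 3 / 4 * r ≤ r + θ * s := by
    intro θ hθ
    have : |θ * s| ≤ 1 * (r / 4) := by
      rw [abs_mul, abs_of_nonneg hθ.1]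
      exact mul_le_mul hθ.2 hs (abs_nonneg _) zero_le_one
    have := neg_le_of_abs_le this
    linarith
  have hρ0 : ∀ θ ∈ Set.Icc (0 : ℝ) 1, 0 < r + θ * s := fun θ hθ => by
    have := hρ θ hθ; nlinarith
  have hcont : ContinuousOn (Function.uncurry F) (Set.Icc 0 1 ×ˢ Set.univ) := by
    have h1 : ContinuousOn (fun q : ℝ × ℝ => isd (r + q.1 * s)) (Set.Icc 0 1 ×ˢ Set.univ) :=
      continuousOn_isd.comp (by fun_prop) fun q hq => hρ0 q.1 hq.1
    have h2 : ContinuousOn (fun q : ℝ × ℝ => isd (r + q.1 * s) * (q.2 + q.1 * a))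
      (Set.Icc 0 1 ×ˢ Set.univ) := h1.mul (by fun_prop)
    have h3 := continuous_prof3.comp_continuousOn h2
    have h4 := continuous_prof4.comp_continuousOn h2
    exact (continuousOn_const.mul ((h1.pow 5).mul h4)).add
      (continuousOn_const.mul ((h1.pow 4).mul h3))
  have hpt : ∀ y, ‖heat2 (r + s) (y + a) - heat2 r y‖ₑ ≤ ∫⁻ θ in Set.Icc (0 : ℝ) 1, ‖F θ y‖ₑ := by
    intro y
    have hc : ContinuousOn (fun θ => F θ y) (Set.uIcc 0 1) := by
      rw [Set.uIcc_of_le zero_le_one]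
      exact hcont.comp (f := fun θ => (θ, y)) (by fun_prop) fun θ hθ => ⟨hθ, trivial⟩
    have h1 := intervalIntegral.integral_eq_sub_of_hasDerivAt (a := 0) (b := 1)
      (f := fun θ : ℝ => heat2 (r + θ * s) (y + θ * a)) (f' := fun θ => F θ y)
      (fun θ hθ => hasDerivAt_heat2_path (hρ0 θ (by rwa [Set.uIcc_of_le zero_le_one] at hθ)))
      hc.intervalIntegrable
    simp only [one_mul, zero_mul, add_zero] at h1
    rw [← h1, intervalIntegral.integral_of_le zero_le_one, ← integral_Icc_eq_integral_Ioc]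
    exact enorm_integral_le_lintegral_enorm _
  have hmeas : AEMeasurable (Function.uncurry fun (y θ : ℝ) => ‖F θ y‖ₑ)
      (volume.prod (volume.restrict (Set.Icc 0 1))) := by
    have h1 := (hcont.aemeasurable (μ := volume.prod volume)
      (measurableSet_Icc.prod MeasurableSet.univ)).enorm
    rw [← Measure.prod_restrict, Measure.restrict_univ] at h1
    exact h1.prod_swap
  calc _ ≤ ∫⁻ y, ∫⁻ θ in Set.Icc (0 : ℝ) 1, ‖F θ y‖ₑ := lintegral_mono hpt
    _ = ∫⁻ θ in Set.Icc (0 : ℝ) 1, ∫⁻ y, ‖F θ y‖ₑ := lintegral_lintegral_swap hmeas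
    _ ≤ ∫⁻ θ in Set.Icc (0 : ℝ) 1, (ENNReal.ofReal (|s| * (r ^ 2)⁻¹) * (∫⁻ z, ‖prof4 z‖ₑ) +
        ENNReal.ofReal (|a| * r ^ (-(3 / 2) : ℝ)) * ∫⁻ z, ‖prof3 z‖ₑ) := by
        refine setLIntegral_mono' measurableSet_Icc fun θ hθ => ?_
        have hc := isd_pos (hρ0 θ hθ)
        have hsq : isd (r + θ * s) ^ 2 ≤ r⁻¹ := by
          rw [isd_sq (hρ0 θ hθ)]
          refine inv_anti₀ hr ?_
          linarith [hρ θ hθ]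
        have hle : isd (r + θ * s) ≤ r ^ (-(1 / 2) : ℝ) := by
          rw [Real.rpow_neg hr.le, ← Real.sqrt_eq_rpow, ← Real.sqrt_inv]
          exact Real.le_sqrt_of_sq_le hsq
        calc ∫⁻ y, ‖F θ y‖ₑ ≤
            ∫⁻ y, (‖s‖ₑ * ‖isd (r + θ * s) ^ 5 * prof4 (isd (r + θ * s) * (y + θ * a))‖ₑ +
              ‖a‖ₑ * ‖isd (r + θ * s) ^ 4 * prof3 (isd (r + θ * s) * (y + θ * a))‖ₑ) :=
              lintegral_mono fun y => (enorm_add_le _ _).trans (by simp only [enorm_mul, le_refl])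
          _ = ‖s‖ₑ * (ENNReal.ofReal (isd (r + θ * s) ^ 4) * ∫⁻ z, ‖prof4 z‖ₑ) +
              ‖a‖ₑ * (ENNReal.ofReal (isd (r + θ * s) ^ 3) * ∫⁻ z, ‖prof3 z‖ₑ) := by
              rw [lintegral_add_left, lintegral_const_mul' _ _ (by finiteness),
                lintegral_const_mul' _ _ (by finiteness), lintegral_comp_isd (hρ0 θ hθ),
                lintegral_comp_isd (hρ0 θ hθ)]
              have := continuous_prof4
              exact (Continuous.measurable (f := fun y => isd (r + θ * s) ^ 5 *
                prof4 (isd (r + θ * s) * (y + θ * a))) (by fun_prop)).enorm.const_mul _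
          _ ≤ _ := by
              rw [← mul_assoc, ← mul_assoc, ← ofReal_norm, ← ofReal_norm, Real.norm_eq_abs,
                Real.norm_eq_abs, ← ENNReal.ofReal_mul (abs_nonneg _),
                ← ENNReal.ofReal_mul (abs_nonneg _)]
              gcongr
              · calc isd (r + θ * s) ^ 4 = (isd (r + θ * s) ^ 2) ^ 2 := by ring
                  _ ≤ (r⁻¹) ^ 2 := by gcongr
                  _ = _ := by rw [inv_pow]
              · calc isd (r + θ * s) ^ 3 ≤ (r ^ (-(1 / 2) : ℝ)) ^ 3 := by gcongr
                  _ = _ := by rw [← Real.rpow_natCast, ← Real.rpow_mul hr.le]; norm_num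
    _ = _ := by simp

theorem integral_sq_mul_gam : ∫ z, z ^ 2 * gam z = 1 := by
  have h := integral_mul_deriv_eq_deriv_mul_of_integrable (u := fun z : ℝ => z) (v := gam)
    (u' := fun _ => 1) (v' := fun z => -z * gam z) (fun z _ => hasDerivAt_id z)
    (fun z _ => hasDerivAt_gam z)
    (by
      refine (integrable_pow_mul_gam 2).neg.congr (Filter.Eventually.of_forall fun z => ?_)
      simp; ring)
    (by
      refine integrable_gam.congr (Filter.Eventually.of_forall fun z => ?_)
      simp)
    (by
      refine (integrable_pow_mul_gam 1).congr (Filter.Eventually.of_forall fun z => ?_)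
      simp)
  simp only [one_mul, integral_gam] at h
  rw [← neg_inj, ← h, ← integral_neg]
  congr 1; ext z; ring

/-- Half-time profile whose self-correlation is the heat kernel's second derivative. -/
noncomputable def halfProf (c x : ℝ) : ℝ := x * Real.exp (-(c * x) ^ 2)

theorem integral_halfProf_mul {c : ℝ} (hc : 0 < c) (a b : ℝ) :
    ∫ x, halfProf c (x - a) * halfProf c (x - b)
      = -(Real.pi / (4 * c ^ 3)) * prof2 (c * (a - b)) := by
  have e : ∀ x, halfProf c (x - a) * halfProf c (x - b) =
      (fun v => (Real.sqrt (2 * Real.pi) / (4 * c ^ 2) * Real.exp (-(c * (a - b)) ^ 2 / 2)) *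
        ((v ^ 2 * gam v) - (c * (a - b)) ^ 2 * gam v)) (2 * c * (x - (a + b) / 2)) := by
    intro x
    have hs : Real.sqrt (2 * Real.pi) ≠ 0 := by positivity
    have e1 : Real.exp (-(c * (x - a)) ^ 2) * Real.exp (-(c * (x - b)) ^ 2) =
        Real.exp (-(c * (a - b)) ^ 2 / 2) * Real.exp (-(2 * c * (x - (a + b) / 2)) ^ 2 / 2) := by
      rw [← Real.exp_add, ← Real.exp_add]; congr 1; ring
    simp only [halfProf, gam]
    calc _ = (x - a) * (x - b) *
          (Real.exp (-(c * (x - a)) ^ 2) * Real.exp (-(c * (x - b)) ^ 2)) := by ring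
      _ = _ := by rw [e1]; field_simp; ring
  simp only [e]
  rw [integral_sub_right_eq_self (fun x => (fun v => (Real.sqrt (2 * Real.pi) / (4 * c ^ 2) *
    Real.exp (-(c * (a - b)) ^ 2 / 2)) * ((v ^ 2 * gam v) - (c * (a - b)) ^ 2 * gam v))
      (2 * c * x)), Measure.integral_comp_mul_left (fun v => (Real.sqrt (2 * Real.pi) / (4 * c ^ 2) *
    Real.exp (-(c * (a - b)) ^ 2 / 2)) * ((v ^ 2 * gam v) - (c * (a - b)) ^ 2 * gam v)),
    integral_const_mul, integral_sub (integrable_pow_mul_gam 2) (integrable_gam.const_mul _),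
    integral_const_mul, integral_sq_mul_gam, integral_gam, abs_of_pos (by positivity)]
  have hs : Real.sqrt (2 * Real.pi) * Real.sqrt (2 * Real.pi) = 2 * Real.pi :=
    Real.mul_self_sqrt (by positivity)
  have hs' : Real.sqrt (2 * Real.pi) ≠ 0 := by positivity
  simp only [prof2, gam, smul_eq_mul]
  field_simp
  rw [pow_two, hs]
  ring

theorem continuous_halfProf (c : ℝ) : Continuous (halfProf c) := by unfold halfProf; fun_prop

theorem integrable_halfProf {c : ℝ} (hc : 0 < c) : Integrable (halfProf c) := by
  refine (integrable_mul_exp_neg_mul_sq (b := c ^ 2) (by positivity)).congr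
    (Filter.Eventually.of_forall fun z => ?_)
  simp only [halfProf, mul_pow, neg_mul]

theorem halfProf_le {c : ℝ} (hc : 0 < c) (x : ℝ) : |halfProf c x| ≤ c⁻¹ := by
  unfold halfProf
  rw [abs_mul, Real.abs_exp, Real.exp_neg, ← div_eq_mul_inv, div_le_iff₀ (Real.exp_pos _)]
  have h1 := Real.add_one_le_exp ((c * x) ^ 2)
  have h2 : c * |x| ≤ (c * x) ^ 2 + 1 := by
    rw [← abs_of_pos hc, ← abs_mul, abs_of_pos hc, ← sq_abs]
    nlinarith [sq_nonneg (|c * x| - 1), abs_nonneg (c * x)]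
  calc |x| = c⁻¹ * (c * |x|) := by field_simp
    _ ≤ _ := by gcongr; linarith

/-- The bilinear form of the second derivative of the heat semigroup on the line. -/
noncomputable def heatForm (r : ℝ) (φ ψ : ℝ → ℝ) : ℝ :=
  ∫ y, (∫ w, heat2 r w * φ (y + w)) * ψ y

theorem integrable_comp_sub_mul {q φ : ℝ → ℝ} (hq : Integrable q) (hφ : Integrable φ) :
    Integrable (fun z : ℝ × ℝ => q (z.1 - z.2) * φ z.2) (volume.prod volume) := by
  have := hφ.convolution_integrand (ContinuousLinearMap.mul ℝ ℝ) hq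
  refine this.congr (Filter.Eventually.of_forall fun z => ?_)
  simp [mul_comm]

theorem heatForm_eq {r : ℝ} (hr : 0 < r) {φ ψ : ℝ → ℝ} {M : ℝ} (hφi : Integrable φ)
    (hψi : Integrable ψ) (hφ : ∀ x, |φ x| ≤ M) :
    heatForm r φ ψ = -(4 * isd r ^ 6 / Real.pi) *
      ∫ x, (∫ a, halfProf (isd r) (x - a) * φ a) * ∫ a, halfProf (isd r) (x - a) * ψ a := by
  have hc := isd_pos hr
  set c := isd r with hcdef
  set q := halfProf c
  have hqi : Integrable q := integrable_halfProf hc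
  have hqm : Continuous q := continuous_halfProf c
  have hU : Integrable fun x => ∫ a, q (x - a) * φ a :=
    (integrable_comp_sub_mul hqi hφi).integral_prod_left
  have h2 : ∀ a y, heat2 r (a - y) = -(4 * c ^ 6 / Real.pi) * ∫ x, q (x - a) * q (x - y) := by
    intro a y
    rw [integral_halfProf_mul hc, heat2, ← hcdef]
    have := Real.pi_ne_zero
    field_simp
  have h3 : ∀ y, ∫ w, heat2 r w * φ (y + w) =
      -(4 * c ^ 6 / Real.pi) * ∫ x, q (x - y) * ∫ a, q (x - a) * φ a := by
    intro y
    rw [← integral_sub_right_eq_self (fun w => heat2 r w * φ (y + w)) y]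
    simp only [add_sub_cancel, h2, mul_assoc]
    rw [integral_const_mul]
    congr 1
    simp only [← integral_mul_const, ← integral_const_mul]
    rw [integral_integral_swap]
    · congr 1; ext x; congr 1; ext a; ring
    · have : Integrable (fun z : ℝ × ℝ => φ z.1 * q (z.2 - y)) (volume.prod volume) :=
        hφi.mul_prod (hqi.comp_sub_right y)
      refine (this.bdd_mul (c := c⁻¹) (f := fun z : ℝ × ℝ => q (z.2 - z.1)) (by fun_prop)
        (Filter.Eventually.of_forall fun z => halfProf_le hc _)).congr
        (Filter.Eventually.of_forall fun z => ?_)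
      simp [Function.uncurry]; ring
  unfold heatForm
  simp only [h3, mul_assoc]
  rw [integral_const_mul]
  congr 1
  simp only [← integral_mul_const]
  rw [integral_integral_swap]
  · congr 1; ext x
    rw [integral_mul_const, mul_comm, ← integral_mul_const]
    congr 1; ext y; ring
  · have h := (integrable_comp_sub_mul hqi hψi)
    have hb : ∀ x, ‖∫ a, q (x - a) * φ a‖ ≤ M * ∫ a, |q a| := by
      intro x
      refine (norm_integral_le_integral_norm _).trans ?_
      rw [← integral_sub_left_eq_self (fun a => |q a|) volume x, ← integral_const_mul]
      refine integral_mono_of_nonneg (Filter.Eventually.of_forall fun _ => norm_nonneg _)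
        ((hqi.comp_sub_left x).abs.const_mul _) (Filter.Eventually.of_forall fun a => ?_)
      simp only [norm_mul, Real.norm_eq_abs]
      rw [mul_comm]
      exact mul_le_mul_of_nonneg_right (hφ a) (abs_nonneg _)
    have h5 : AEStronglyMeasurable (fun z : ℝ × ℝ => ∫ a, q (z.1 - a) * φ a)
      (volume.prod volume) := hU.1.comp_fst
    have := (h.bdd_mul (c := M * ∫ a, |q a|) h5 (Filter.Eventually.of_forall fun z => hb z.1)).swap
    refine this.congr (Filter.Eventually.of_forall fun z => ?_)
    simp [Function.uncurry]; ring

theorem abs_heatForm_le {r : ℝ} (hr : 0 < r) {φ ψ : ℝ → ℝ} {M : ℝ} (hφi : Integrable φ)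
    (hψi : Integrable ψ) (hφ : ∀ x, |φ x| ≤ M) (hψ : ∀ x, |ψ x| ≤ M) :
    |heatForm r φ ψ| ≤ 1 / 2 * (-heatForm r φ φ + -heatForm r ψ ψ) := by
  have hc := isd_pos hr
  have hint : ∀ φ ψ : ℝ → ℝ, Integrable φ → Integrable ψ → (∀ x, |φ x| ≤ M) →
      Integrable fun x => (∫ a, halfProf (isd r) (x - a) * φ a) *
        ∫ a, halfProf (isd r) (x - a) * ψ a := by
    intro φ ψ hφi hψi hφ
    have hqi := integrable_halfProf hc
    refine (integrable_comp_sub_mul hqi hψi).integral_prod_left.bdd_mul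
      (c := M * ∫ a, |halfProf (isd r) a|)
      (integrable_comp_sub_mul hqi hφi).integral_prod_left.1
      (Filter.Eventually.of_forall fun x => ?_)
    refine (norm_integral_le_integral_norm _).trans ?_
    rw [← integral_sub_left_eq_self (fun a => |halfProf (isd r) a|) volume x, ← integral_const_mul]
    refine integral_mono_of_nonneg (Filter.Eventually.of_forall fun _ => norm_nonneg _)
      ((hqi.comp_sub_left x).abs.const_mul _) (Filter.Eventually.of_forall fun a => ?_)
    simp only [norm_mul, Real.norm_eq_abs]
    rw [mul_comm]
    exact mul_le_mul_of_nonneg_right (hφ a) (abs_nonneg _)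
  rw [heatForm_eq hr hφi hψi hφ, heatForm_eq hr hφi hφi hφ, heatForm_eq hr hψi hψi hψ, abs_mul,
    abs_neg, abs_of_nonneg (by positivity : 0 ≤ 4 * isd r ^ 6 / Real.pi)]
  have key : |∫ x, (∫ a, halfProf (isd r) (x - a) * φ a) * ∫ a, halfProf (isd r) (x - a) * ψ a| ≤
      1 / 2 * ((∫ x, (∫ a, halfProf (isd r) (x - a) * φ a) * ∫ a, halfProf (isd r) (x - a) * φ a) +
        ∫ x, (∫ a, halfProf (isd r) (x - a) * ψ a) * ∫ a, halfProf (isd r) (x - a) * ψ a) := by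
    rw [← integral_add (hint φ φ hφi hφi hφ) (hint ψ ψ hψi hψi hψ), ← integral_const_mul]
    refine abs_integral_le_integral_abs.trans (integral_mono (hint φ ψ hφi hψi hφ).abs
      (((hint φ φ hφi hφi hφ).add (hint ψ ψ hψi hψi hψ)).const_mul _) fun x => ?_)
    simp only [abs_mul]
    rw [← abs_mul_abs_self (∫ a, halfProf (isd r) (x - a) * φ a),
      ← abs_mul_abs_self (∫ a, halfProf (isd r) (x - a) * ψ a)]
    nlinarith [sq_nonneg (|∫ a, halfProf (isd r) (x - a) * φ a| -
      |∫ a, halfProf (isd r) (x - a) * ψ a|)]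
  calc _ ≤ _ := mul_le_mul_of_nonneg_left key (by positivity)
    _ = _ := by ring

/-- The second spatial derivative of the heat kernel, truncated in time. -/
noncomputable def heatCZ (ε N : ℝ) (u : ℝ × ℝ) : ℝ :=
  (Set.Ioo ε N).indicator (fun r => heat2 r u.2) u.1

theorem measurable_isd : Measurable isd := by unfold isd; fun_prop

theorem measurable_heat2 : Measurable fun u : ℝ × ℝ => heat2 u.1 u.2 := by
  have h1 : Measurable fun u : ℝ × ℝ => isd u.1 := measurable_isd.comp measurable_fst
  exact (h1.pow_const 3).mul (continuous_prof2.measurable.comp (h1.mul measurable_snd))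

theorem heatCZ_eq (ε N : ℝ) : heatCZ ε N =
    (Prod.fst ⁻¹' Set.Ioo ε N).indicator (fun u : ℝ × ℝ => heat2 u.1 u.2) := by
  ext u
  by_cases h : u.1 ∈ Set.Ioo ε N <;> simp [heatCZ, Set.indicator]

theorem measurable_heatCZ (ε N : ℝ) : Measurable (heatCZ ε N) := by
  rw [heatCZ_eq]
  exact measurable_heat2.indicator (measurable_fst measurableSet_Ioo)

theorem integrable_heatCZ {ε : ℝ} (hε : 0 < ε) (N : ℝ) : Integrable (heatCZ ε N) := by
  refine ⟨(measurable_heatCZ ε N).aestronglyMeasurable, ?_⟩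
  have hm2 : (∫⁻ z, ‖prof2 z‖ₑ) ≠ ∞ := integrable_prof2.2.ne
  calc ∫⁻ u, ‖heatCZ ε N u‖ₑ = ∫⁻ r, ∫⁻ w, ‖heatCZ ε N (r, w)‖ₑ :=
        lintegral_prod _ (measurable_heatCZ ε N).enorm.aemeasurable
    _ ≤ ∫⁻ r, (Set.Ioo ε N).indicator
        (fun _ => ENNReal.ofReal (2 * ε)⁻¹ * ∫⁻ z, ‖prof2 z‖ₑ) r := by
        refine lintegral_mono fun r => ?_
        by_cases hr : r ∈ Set.Ioo ε N
        · simp only [heatCZ, Set.indicator_of_mem hr]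
          have h := lintegral_heat2 (hε.trans hr.1) 0
          simp only [add_zero] at h
          rw [h]
          gcongr
          exact hr.1.le
        · simp [heatCZ, Set.indicator_of_notMem hr]
    _ < ∞ := by
        rw [lintegral_indicator measurableSet_Ioo, setLIntegral_const]
        simp only [Real.volume_Ioo]
        exact ENNReal.mul_lt_top (ENNReal.mul_lt_top ENNReal.ofReal_lt_top hm2.lt_top)
          ENNReal.ofReal_lt_top

theorem measurePreserving_prodProdComm :
    MeasurePreserving (fun q : (ℝ × ℝ) × (ℝ × ℝ) => ((q.1.1, q.2.1), (q.1.2, q.2.2))) := by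
  have h1 := measurePreserving_prodAssoc (volume : Measure ℝ) (volume : Measure ℝ)
    (volume : Measure (ℝ × ℝ))
  have h2 := (measurePreserving_prodAssoc (volume : Measure ℝ) (volume : Measure ℝ)
    (volume : Measure ℝ)).symm
  have h3 := (Measure.measurePreserving_swap (μ := (volume : Measure ℝ))
    (ν := (volume : Measure ℝ))).prod (MeasurePreserving.id (volume : Measure ℝ))
  have h4 := (measurePreserving_prodAssoc (volume : Measure ℝ) (volume : Measure ℝ)
    (volume : Measure ℝ))
  have h5 := (MeasurePreserving.id (volume : Measure ℝ)).prod ((h4.comp h3).comp h2)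
  exact (h1.symm.comp h5).comp h1

theorem heatCZ_time_reduction {ε : ℝ} (hε : 0 < ε) (N κ : ℝ) {f g : ℝ × ℝ → ℝ} {M : ℝ}
    (hf : Measurable f) (hfM : ∀ z, |f z| ≤ M) (hgi : Integrable g) :
    Integrable (fun τ : ℝ × ℝ => (Set.Ioo ε N).indicator
        (fun r => heatForm r (fun y => f (τ.1 + κ * r, y)) fun y => g (τ.1, y)) τ.2) ∧
    ∫ z : ℝ × ℝ, (∫ p : ℝ × ℝ, heatCZ ε N p * f (z.1 + κ * p.1, z.2 + p.2)) * g z =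
      ∫ τ : ℝ × ℝ, (Set.Ioo ε N).indicator
        (fun r => heatForm r (fun y => f (τ.1 + κ * r, y)) fun y => g (τ.1, y)) τ.2 := by
  set J : (ℝ × ℝ) × (ℝ × ℝ) → ℝ := fun q =>
    heatCZ ε N q.2 * f (q.1.1 + κ * q.2.1, q.1.2 + q.2.2) * g q.1 with hJ
  have hJi : Integrable J (volume.prod volume) := by
    have h1 : Integrable (fun q : (ℝ × ℝ) × (ℝ × ℝ) => g q.1 * heatCZ ε N q.2)
      (volume.prod volume) := hgi.mul_prod (integrable_heatCZ hε N)
    have h2 : Measurable fun q : (ℝ × ℝ) × (ℝ × ℝ) => f (q.1.1 + κ * q.2.1, q.1.2 + q.2.2) :=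
      hf.comp (by fun_prop)
    refine (integrable_mul_of_bounded h1 h2.aestronglyMeasurable fun q => hfM _).congr
      (Filter.Eventually.of_forall fun q => ?_)
    simp only [hJ]; ring
  have hJ' : Integrable (fun q : (ℝ × ℝ) × (ℝ × ℝ) => J ((q.1.1, q.2.1), (q.1.2, q.2.2)))
      (volume.prod volume) := measurePreserving_prodProdComm.integrable_comp_of_integrable hJi
  have hsec : ∀ᵐ τ : ℝ × ℝ, ∫ q : ℝ × ℝ, J ((τ.1, q.1), (τ.2, q.2)) =
      (Set.Ioo ε N).indicator
        (fun r => heatForm r (fun y => f (τ.1 + κ * r, y)) fun y => g (τ.1, y)) τ.2 := by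
    filter_upwards [hJ'.prod_right_ae] with τ hτ
    rw [Measure.volume_eq_prod, integral_prod _ hτ]
    by_cases hr : τ.2 ∈ Set.Ioo ε N
    · simp only [hJ, heatCZ, Set.indicator_of_mem hr, integral_mul_const, heatForm]
    · simp [hJ, heatCZ, Set.indicator_of_notMem hr]
  refine ⟨hJ'.integral_prod_left.congr hsec, ?_⟩
  rw [← integral_congr_ae hsec, ← integral_prod _ hJ']
  have h := measurePreserving_prodProdComm.integral_comp'
    (f := MeasurableEquiv.ofInvolutive (fun q : (ℝ × ℝ) × (ℝ × ℝ) =>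
      ((q.1.1, q.2.1), (q.1.2, q.2.2))) (fun q => rfl) (by fun_prop)) J
  refine Eq.trans ?_ ((integral_prod J hJi).symm.trans h.symm)
  simp only [hJ, integral_mul_const]

/-- The one-dimensional heat kernel. -/
noncomputable def heat0 (r y : ℝ) : ℝ := isd r * gam (isd r * y)

theorem hasDerivAt_heat0 {r : ℝ} (hr : 0 < r) (y : ℝ) :
    HasDerivAt (fun r => heat0 r y) (heat2 r y) r := by
  have h3 := hasDerivAt_isd hr
  have h4 := (hasDerivAt_gam (isd r * y)).comp r (h3.mul_const y)
  refine (h3.mul h4).congr_deriv ?_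
  simp only [heat2, prof2, Function.comp]
  ring

theorem integral_heat0 {r : ℝ} (hr : 0 < r) : ∫ y, heat0 r y = 1 := by
  unfold heat0
  rw [integral_const_mul, Measure.integral_comp_mul_left, integral_gam,
    abs_of_pos (inv_pos.2 (isd_pos hr)), smul_eq_mul, mul_one, mul_inv_cancel₀ (isd_pos hr).ne']

theorem integrable_heat0 {r : ℝ} (hr : 0 < r) : Integrable (heat0 r) :=
  (integrable_gam.comp_mul_left' (isd_pos hr).ne').const_mul _

theorem heat0_nonneg {r : ℝ} (hr : 0 < r) (y : ℝ) : 0 ≤ heat0 r y :=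
  mul_nonneg (isd_pos hr).le (gam_nonneg _)

theorem setIntegral_heat2 {ε N : ℝ} (hε : 0 < ε) (hN : ε ≤ N) (y : ℝ) :
    ∫ r in Set.Ioo ε N, heat2 r y = heat0 N y - heat0 ε y := by
  rw [← integral_Ioc_eq_integral_Ioo, ← intervalIntegral.integral_of_le hN]
  have hpos : ∀ r ∈ Set.uIcc ε N, 0 < r := fun r hr => by
    rw [Set.uIcc_of_le hN] at hr; exact hε.trans_le hr.1
  refine intervalIntegral.integral_eq_sub_of_hasDerivAt
    (fun r hr => hasDerivAt_heat0 (hpos r hr) y) (ContinuousOn.intervalIntegrable ?_)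
  have h1 : ContinuousOn isd (Set.uIcc ε N) := continuousOn_isd.mono hpos
  exact (h1.pow 3).mul (continuous_prof2.comp_continuousOn (h1.mul continuousOn_const))

theorem abs_energy_le {ε N : ℝ} (hε : 0 < ε) (hN : ε ≤ N) {f : ℝ × ℝ → ℝ} {M : ℝ}
    (hf : Measurable f) (hfM : ∀ z, |f z| ≤ M) (hfi : Integrable f) :
    |∫ z : ℝ × ℝ, (∫ p : ℝ × ℝ, heatCZ ε N p * f (z.1 + 0 * p.1, z.2 + p.2)) * f z| ≤
      2 * ∫ z, f z ^ 2 := by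
  have hN0 := hε.trans_le hN
  have hGi : Integrable fun w => heat0 N w - heat0 ε w :=
    (integrable_heat0 hN0).sub (integrable_heat0 hε)
  have hf2 : Integrable fun z => f z ^ 2 := by
    refine (integrable_mul_of_bounded hfi hf.aestronglyMeasurable hfM).congr
      (Filter.Eventually.of_forall fun z => ?_)
    simp only [pow_two]
  have h1 : ∀ z : ℝ × ℝ, ∫ p : ℝ × ℝ, heatCZ ε N p * f (z.1 + 0 * p.1, z.2 + p.2) =
      ∫ w, (heat0 N w - heat0 ε w) * f (z.1, z.2 + w) := by
    intro z
    simp only [zero_mul, add_zero]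
    rw [Measure.volume_eq_prod, integral_prod_symm]
    · congr 1; ext w
      simp only []
      rw [integral_mul_const, ← setIntegral_heat2 hε hN w]
      congr 1
      rw [← integral_indicator measurableSet_Ioo]
      rfl
    · exact integrable_mul_of_bounded (integrable_heatCZ hε N)
        (hf.comp (by fun_prop)).aestronglyMeasurable fun q => hfM _
  simp only [h1, ← integral_mul_const]
  rw [integral_integral_swap]
  · have hin : ∀ w, |∫ z : ℝ × ℝ, (heat0 N w - heat0 ε w) * f (z.1, z.2 + w) * f z| ≤
        (heat0 N w + heat0 ε w) * ∫ z, f z ^ 2 := by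
      intro w
      simp only [mul_assoc]
      rw [integral_const_mul, abs_mul]
      refine mul_le_mul ?_ ?_ (abs_nonneg _)
        (add_nonneg (heat0_nonneg hN0 w) (heat0_nonneg hε w))
      · have := heat0_nonneg hN0 w
        have := heat0_nonneg hε w
        rw [abs_le]; constructor <;> linarith
      · have hs : Integrable fun z : ℝ × ℝ => f (z + (0, w)) ^ 2 := hf2.comp_add_right (0, w)
        have h2 : ∫ z, 1 / 2 * (f (z + (0, w)) ^ 2 + f z ^ 2) = ∫ z, f z ^ 2 := by
          rw [integral_const_mul, integral_add hs hf2,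
            integral_add_right_eq_self (fun z => f z ^ 2)]
          ring
        rw [← h2]
        refine abs_integral_le_integral_abs.trans (integral_mono_of_nonneg
          (Filter.Eventually.of_forall fun _ => abs_nonneg _) ((hs.add hf2).const_mul _)
          (Filter.Eventually.of_forall fun z => ?_))
        have e : z + (0, w) = (z.1, z.2 + w) := by ext <;> simp
        simp only [e, abs_mul, ← sq_abs (f (z.1, z.2 + w)), ← sq_abs (f z)]
        nlinarith [sq_nonneg (|f (z.1, z.2 + w)| - |f z|)]
    refine abs_integral_le_integral_abs.trans ((integral_mono_of_nonneg
      (Filter.Eventually.of_forall fun _ => abs_nonneg _)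
      (((integrable_heat0 hN0).add (integrable_heat0 hε)).mul_const _)
      (Filter.Eventually.of_forall hin)).trans_eq ?_)
    rw [integral_mul_const]
    simp only [Pi.add_apply]
    rw [integral_add (integrable_heat0 hN0) (integrable_heat0 hε), integral_heat0 hN0,
      integral_heat0 hε]
    norm_num
  · have h := hfi.mul_prod hGi
    refine (integrable_mul_of_bounded h (f := fun q : (ℝ × ℝ) × ℝ => f (q.1.1, q.1.2 + q.2))
      (hf.comp (by fun_prop)).aestronglyMeasurable fun q => hfM _).congr
      (Filter.Eventually.of_forall fun q => ?_)
    simp [Function.uncurry]; ring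

theorem abs_integral_corr_heatCZ_le {ε N : ℝ} (hε : 0 < ε) (hN : ε ≤ N) {f g : ℝ × ℝ → ℝ} {M : ℝ}
    (hf : Measurable f) (hfM : ∀ z, |f z| ≤ M) (hfi : Integrable f)
    (hg : Measurable g) (hgM : ∀ z, |g z| ≤ M) (hgi : Integrable g) :
    |∫ z, corr (heatCZ ε N) f z * g z| ≤ (∫ z, f z ^ 2) + ∫ z, g z ^ 2 := by
  have e : ∀ z, corr (heatCZ ε N) f z =
      ∫ p : ℝ × ℝ, heatCZ ε N p * f (z.1 + 1 * p.1, z.2 + p.2) := fun z => by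
    simp only [one_mul]; rfl
  simp only [e]
  obtain ⟨hi, he⟩ := heatCZ_time_reduction hε N 1 hf hfM hgi
  obtain ⟨hif, hef⟩ := heatCZ_time_reduction hε N 0 hf hfM hfi
  obtain ⟨hig, heg⟩ := heatCZ_time_reduction hε N 0 hg hgM hgi
  have hEf := abs_energy_le hε hN hf hfM hfi
  have hEg := abs_energy_le hε hN hg hgM hgi
  rw [he]
  rw [hef] at hEf
  rw [heg] at hEg
  have mp : MeasurePreserving (fun τ : ℝ × ℝ => (τ.1 + τ.2, τ.2)) := by
    have := ((Measure.measurePreserving_swap (μ := (volume : Measure ℝ))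
      (ν := (volume : Measure ℝ))).comp (measurePreserving_prod_add volume volume)).comp
        Measure.measurePreserving_swap
    simp only [Function.comp_def, Prod.swap, add_comm] at this
    exact this
  set I := Set.Ioo ε N
  set Hf : ℝ × ℝ → ℝ := fun τ => I.indicator
    (fun r => heatForm r (fun y => f (τ.1 + 0 * r, y)) fun y => f (τ.1, y)) τ.2 with hHf
  set Hg : ℝ × ℝ → ℝ := fun τ => I.indicator
    (fun r => heatForm r (fun y => g (τ.1 + 0 * r, y)) fun y => g (τ.1, y)) τ.2 with hHg
  have hifs : Integrable fun τ : ℝ × ℝ => Hf (τ.1 + τ.2, τ.2) :=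
    mp.integrable_comp_of_integrable hif
  have hshift : ∫ τ : ℝ × ℝ, Hf (τ.1 + τ.2, τ.2) = ∫ τ, Hf τ := by
    rw [Measure.volume_eq_prod, integral_prod_symm _ hifs, integral_prod_symm _ hif]
    congr 1; ext r
    exact integral_add_right_eq_self (fun t => Hf (t, r)) r
  have hsg : ∀ᵐ τ : ℝ × ℝ, Integrable fun y => g (τ.1, y) :=
    Measure.quasiMeasurePreserving_fst.ae hgi.prod_right_ae
  have hsf : ∀ᵐ τ : ℝ × ℝ, Integrable fun y => f (τ.1 + τ.2, y) :=
    (Measure.quasiMeasurePreserving_fst.comp mp.quasiMeasurePreserving).ae hfi.prod_right_ae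
  have key : ∀ᵐ τ : ℝ × ℝ, |I.indicator (fun r => heatForm r (fun y => f (τ.1 + 1 * r, y))
      fun y => g (τ.1, y)) τ.2| ≤ 1 / 2 * (-Hf (τ.1 + τ.2, τ.2) + -Hg τ) := by
    filter_upwards [hsg, hsf] with τ hτg hτf
    by_cases hr : τ.2 ∈ I
    · simp only [hHf, hHg, Set.indicator_of_mem hr, one_mul, zero_mul, add_zero]
      exact abs_heatForm_le (hε.trans hr.1) hτf hτg (fun y => hfM _) fun y => hgM _
    · simp [hHf, hHg, Set.indicator_of_notMem hr]
  calc _ ≤ ∫ τ : ℝ × ℝ, 1 / 2 * (-Hf (τ.1 + τ.2, τ.2) + -Hg τ) :=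
        abs_integral_le_integral_abs.trans (integral_mono_ae hi.abs
          ((hifs.neg.add hig.neg).const_mul _) key)
    _ = 1 / 2 * (-(∫ τ, Hf τ) + -∫ τ, Hg τ) := by
        rw [integral_const_mul, ← hshift, ← integral_neg, ← integral_neg]
        exact congrArg _ (integral_add hifs.neg hig.neg)
    _ ≤ _ := by
        have h1 := (abs_le.1 hEf).1
        have h2 := (abs_le.1 hEg).1
        linarith

theorem l2Bounded_heatCZ {ε N : ℝ} (hε : 0 < ε) (hN : ε ≤ N) : L2Bounded (heatCZ ε N) 4 := by
  have hK := measurable_heatCZ ε N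
  have hKi := integrable_heatCZ hε N
  have hcomp : ∀ f : ℝ × ℝ → ℝ, Continuous f → HasCompactSupport f →
      eLpNorm (corr (heatCZ ε N) f) (ENNReal.ofReal 2) volume ≤
        2 * eLpNorm f (ENNReal.ofReal 2) volume := by
    intro f hfc hfs
    have hfi : Integrable f := hfc.integrable_of_hasCompactSupport hfs
    obtain ⟨M, hM⟩ := hfs.exists_bound_of_continuous hfc
    have hM : ∀ z, |f z| ≤ M := hM
    set F := corr (heatCZ ε N) f with hF
    have hFm : Measurable F := measurable_corr hK hfc.measurable
    set L := ∫ w, |heatCZ ε N w|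
    have hL : 0 ≤ L := integral_nonneg fun _ => abs_nonneg _
    have hM0 : 0 ≤ M := (abs_nonneg _).trans (hM 0)
    have hFM : ∀ z, |F z| ≤ L * M := corr_bounded hKi hM
    have hFi : Integrable F := by
      have h1 : Integrable (fun q : (ℝ × ℝ) × (ℝ × ℝ) => heatCZ ε N q.2 * f (q.1 + q.2))
          (volume.prod volume) := by
        have := (hKi.mul_prod hfi)
        have mp := measurePreserving_prod_add_swap (volume : Measure (ℝ × ℝ))
          (volume : Measure (ℝ × ℝ))
        refine (mp.integrable_comp_of_integrable this).congr
          (Filter.Eventually.of_forall fun q => ?_)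
        simp [Function.comp, add_comm]
      exact h1.integral_prod_left
    have h2 : ∀ h : ℝ × ℝ → ℝ, Measurable h → (∃ B, ∀ z, |h z| ≤ B) → Integrable h →
        Integrable (fun z => h z ^ 2) := by
      rintro h hm ⟨B, hB⟩ hi
      refine (integrable_mul_of_bounded hi hm.aestronglyMeasurable hB).congr
        (Filter.Eventually.of_forall fun z => ?_)
      simp only [pow_two]
    have hf2 := h2 f hfc.measurable ⟨M, hM⟩ hfi
    have hF2 := h2 F hFm ⟨_, hFM⟩ hFi
    have hB : ∀ z, |1 / 2 * F z| ≤ M + L * M := fun z => by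
      rw [abs_mul, abs_of_pos (by norm_num : (0 : ℝ) < 1 / 2)]
      have := hFM z
      have := abs_nonneg (F z)
      linarith
    have key := abs_integral_corr_heatCZ_le hε hN hfc.measurable
      (fun z => (hM z).trans (by nlinarith [mul_nonneg hL hM0] : M ≤ M + L * M)) hfi
      (hFm.const_mul (1 / 2)) hB (hFi.const_mul _)
    have e1 : ∫ z, F z * (1 / 2 * F z) = 1 / 2 * ∫ z, F z ^ 2 := by
      rw [← integral_const_mul]; congr 1; ext z; ring
    have e2 : ∫ z, (1 / 2 * F z) ^ 2 = 1 / 4 * ∫ z, F z ^ 2 := by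
      rw [← integral_const_mul]; congr 1; ext z; ring
    have hF0 : 0 ≤ 1 / 2 * ∫ z, F z ^ 2 :=
      mul_nonneg (by norm_num) (integral_nonneg fun z => sq_nonneg _)
    rw [← hF, e1, e2, abs_of_nonneg hF0] at key
    have key2 : ∫ z, F z ^ 2 ≤ 4 * ∫ z, f z ^ 2 := by linarith
    rw [eLpNorm_ofReal_eq (by norm_num), eLpNorm_ofReal_eq (by norm_num)]
    have e3 : ∀ h : ℝ × ℝ → ℝ, Integrable (fun z => h z ^ 2) →
        ∫⁻ z, ‖h z‖ₑ ^ (2 : ℝ) = ENNReal.ofReal (∫ z, h z ^ 2) := by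
      intro h hi
      rw [ofReal_integral_eq_lintegral_ofReal hi (Filter.Eventually.of_forall fun z => sq_nonneg _)]
      congr 1; ext z
      rw [← sq_abs, ENNReal.ofReal_pow (abs_nonneg _), ← Real.norm_eq_abs, ofReal_norm]
      norm_num
    rw [e3 F hF2, e3 f hf2]
    calc _ ≤ (ENNReal.ofReal (4 * ∫ z, f z ^ 2)) ^ (1 / (2 : ℝ)) :=
          ENNReal.rpow_le_rpow (ENNReal.ofReal_le_ofReal key2) (by norm_num)
      _ = _ := by
        rw [ENNReal.ofReal_mul (by norm_num), ENNReal.mul_rpow_of_nonneg _ _ (by norm_num)]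
        congr 1
        rw [ENNReal.ofReal_rpow_of_pos (by norm_num), show (4 : ℝ) = 2 ^ (2 : ℝ) by norm_num,
          ← Real.rpow_mul (by norm_num)]
        norm_num
  intro g hg M hM
  have h := eLpNorm_corr_le_of_dense (p := 2) (by norm_num) hK hKi
    (C := 2) (by norm_num) hcomp hg hM
  rw [eLpNorm_ofReal_eq (by norm_num), eLpNorm_ofReal_eq (by norm_num)] at h
  have h3 := ENNReal.rpow_le_rpow h (by norm_num : (0 : ℝ) ≤ 2)
  rw [ENNReal.mul_rpow_of_nonneg _ _ (by norm_num), ← ENNReal.rpow_mul, ← ENNReal.rpow_mul] at h3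
  norm_num at h3
  exact h3

theorem lintegral_Ioi_ofReal_rpow {a c : ℝ} (ha : a < -1) (hc : 0 < c) :
    ∫⁻ r in Set.Ioi c, ENNReal.ofReal (r ^ a) = ENNReal.ofReal (-c ^ (a + 1) / (a + 1)) := by
  rw [← integral_Ioi_rpow_of_lt ha hc]
  refine (ofReal_integral_eq_lintegral_ofReal (integrableOn_Ioi_rpow_of_lt ha hc) ?_).symm
  filter_upwards [ae_restrict_mem measurableSet_Ioi] with r hr
  exact Real.rpow_nonneg (hc.trans hr).le _

theorem heatCZ_section_le (ε N : ℝ) (hε : 0 < ε) {r l : ℝ} (hl : 0 < l) (hr : 3 * l ^ 2 ≤ r)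
    (b : ℝ) : ∫⁻ y, ‖heatCZ ε N (r, y + b)‖ₑ ≤
      ENNReal.ofReal (l ^ 2)⁻¹ * ∫⁻ z, ‖prof2 z‖ₑ := by
  by_cases h : r ∈ Set.Ioo ε N
  · simp only [heatCZ, Set.indicator_of_mem h]
    rw [lintegral_heat2 (hε.trans h.1)]
    gcongr
    nlinarith [sq_nonneg l]
  · simp [heatCZ, Set.indicator_of_notMem h]

theorem heatCZ_section_tail_le (ε N : ℝ) (hε : 0 < ε) (r : ℝ) {l : ℝ} (hl : 0 < l) (b : ℝ) :
    ∫⁻ y in {y | l ≤ |y + b|}, ‖heatCZ ε N (r, y + b)‖ₑ ≤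
      ENNReal.ofReal (l ^ 2)⁻¹ * ∫⁻ z, ‖z ^ 2 * prof2 z‖ₑ := by
  by_cases h : r ∈ Set.Ioo ε N
  · simp only [heatCZ, Set.indicator_of_mem h]
    exact setLIntegral_heat2_tail_le (hε.trans h.1) hl b
  · simp [heatCZ, Set.indicator_of_notMem h]

theorem measurable_heatCZ_section (ε N r b : ℝ) : Measurable fun y => ‖heatCZ ε N (r, y + b)‖ₑ :=
  ((measurable_heatCZ ε N).comp (by fun_prop)).enorm

theorem heatCZ_section_diff_le {ε N : ℝ} (hε : 0 < ε) {l s a : ℝ} (hl : 0 < l)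
    (hs : |s| ≤ l ^ 2) (ha : |a| ≤ l) (r : ℝ) :
    ∫⁻ y, {u : ℝ × ℝ | ¬ (|u.1| ≤ 4 * l ^ 2 ∧ |u.2| ≤ 2 * l)}.indicator
        (fun u => ‖heatCZ ε N (u + (s, a)) - heatCZ ε N u‖ₑ) (r, y) ≤
      (Set.Icc (-(4 * l ^ 2)) (4 * l ^ 2)).indicator
          (fun _ => 2 * (ENNReal.ofReal (l ^ 2)⁻¹ * ∫⁻ z, ‖z ^ 2 * prof2 z‖ₑ)) r +
        (Set.Ioi (4 * l ^ 2)).indicator (fun r =>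
          ENNReal.ofReal (l ^ 2) * ENNReal.ofReal (r ^ (-2 : ℝ)) * (∫⁻ z, ‖prof4 z‖ₑ) +
            ENNReal.ofReal l * ENNReal.ofReal (r ^ (-(3 / 2) : ℝ)) * ∫⁻ z, ‖prof3 z‖ₑ) r +
        ((Set.Icc (ε - l ^ 2) (ε + l ^ 2)).indicator
            (fun _ => ENNReal.ofReal (l ^ 2)⁻¹ * ∫⁻ z, ‖prof2 z‖ₑ) r +
          (Set.Icc (N - l ^ 2) (N + l ^ 2)).indicator
            (fun _ => ENNReal.ofReal (l ^ 2)⁻¹ * ∫⁻ z, ‖prof2 z‖ₑ) r) := by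
  have hs' := abs_le.1 hs
  have hl2 : 0 < l ^ 2 := by positivity
  by_cases h4 : |r| ≤ 4 * l ^ 2
  · have hr : r ∈ Set.Icc (-(4 * l ^ 2)) (4 * l ^ 2) := abs_le.1 h4
    rw [Set.indicator_of_mem hr, add_assoc]
    refine le_trans ?_ le_self_add
    have hset : ∀ b, MeasurableSet {y : ℝ | l ≤ |y + b|} := fun b =>
      measurableSet_le measurable_const (by fun_prop)
    calc _ ≤ ∫⁻ y, ({y | l ≤ |y + a|}.indicator (fun y => ‖heatCZ ε N (r + s, y + a)‖ₑ) y +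
          {y | l ≤ |y + 0|}.indicator (fun y => ‖heatCZ ε N (r, y + 0)‖ₑ) y) := by
          refine lintegral_mono fun y => ?_
          by_cases hy : 2 * l < |y|
          · have h1 : l ≤ |y + a| := by
              have := abs_sub_abs_le_abs_sub y (-a)
              rw [abs_neg, sub_neg_eq_add] at this
              linarith
            have h2 : l ≤ |y + 0| := by rw [add_zero]; linarith
            rw [Set.indicator_of_mem (by simp [h4, hy]), 
              Set.indicator_of_mem (show y ∈ {y | l ≤ |y + a|} from h1),
              Set.indicator_of_mem (show y ∈ {y | l ≤ |y + 0|} from h2)]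
            simpa using enorm_sub_le (a := heatCZ ε N (r + s, y + a)) (b := heatCZ ε N (r, y))
          · rw [Set.indicator_of_notMem (by simp [h4, le_of_not_gt hy])]
            exact zero_le
      _ ≤ _ := by
          rw [lintegral_add_left ((measurable_heatCZ_section ε N (r + s) a).indicator (hset a)),
            lintegral_indicator (hset a), lintegral_indicator (hset 0), two_mul]
          exact add_le_add (heatCZ_section_tail_le ε N hε _ hl a)
            (heatCZ_section_tail_le ε N hε _ hl 0)
  · refine (lintegral_mono fun y => Set.indicator_le_self _ _ _).trans ?_
    simp only [Prod.mk_add_mk]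
    rcases lt_or_ge r 0 with hneg | hpos
    · have hr : r < -(4 * l ^ 2) := by rw [abs_of_neg hneg] at h4; linarith
      have h1 : r ∉ Set.Ioo ε N := fun h => by linarith [h.1]
      have h2 : r + s ∉ Set.Ioo ε N := fun h => by linarith [h.1, hs'.2]
      simp [heatCZ, Set.indicator_of_notMem h1, Set.indicator_of_notMem h2]
    · have hr : 4 * l ^ 2 < r := by rw [abs_of_nonneg hpos] at h4; linarith
      have hone : ∀ q : ℝ, |r - q| ≤ l ^ 2 → r ∈ Set.Icc (q - l ^ 2) (q + l ^ 2) := fun q hq => by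
        have := abs_le.1 hq; constructor <;> linarith
      have hfin : r ∈ Set.Icc (ε - l ^ 2) (ε + l ^ 2) ∨ r ∈ Set.Icc (N - l ^ 2) (N + l ^ 2) →
          ENNReal.ofReal (l ^ 2)⁻¹ * (∫⁻ z, ‖prof2 z‖ₑ) ≤
          (Set.Icc (ε - l ^ 2) (ε + l ^ 2)).indicator
            (fun _ => ENNReal.ofReal (l ^ 2)⁻¹ * ∫⁻ z, ‖prof2 z‖ₑ) r +
          (Set.Icc (N - l ^ 2) (N + l ^ 2)).indicator
            (fun _ => ENNReal.ofReal (l ^ 2)⁻¹ * ∫⁻ z, ‖prof2 z‖ₑ) r := by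
        rintro (h | h)
        · rw [Set.indicator_of_mem h]; exact le_self_add
        · rw [Set.indicator_of_mem h]; exact le_add_self
      by_cases h1 : r ∈ Set.Ioo ε N <;> by_cases h2 : r + s ∈ Set.Ioo ε N
      · rw [Set.indicator_of_mem (show r ∈ Set.Ioi (4 * l ^ 2) from hr)]
        refine le_trans ?_ (le_self_add (b := _))
        refine le_trans ?_ le_add_self
        simp only [heatCZ, Set.indicator_of_mem h1, Set.indicator_of_mem h2]
        have hr0 : 0 < r := hε.trans h1.1
        refine (lintegral_heat2_path_le hr0 (by linarith)).trans ?_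
        rw [← ENNReal.ofReal_mul hl2.le, ← ENNReal.ofReal_mul hl.le]
        have e : (r ^ 2)⁻¹ = r ^ (-2 : ℝ) := by
          rw [Real.rpow_neg hr0.le]; norm_num
        rw [e]
        have := Real.rpow_nonneg hr0.le (-2)
        have := Real.rpow_nonneg hr0.le (-(3 / 2))
        gcongr
      · refine le_trans ?_ le_add_self
        refine le_trans ?_ (hfin ?_)
        · have h5 := heatCZ_section_le ε N hε hl (by linarith : 3 * l ^ 2 ≤ r) 0
          simp only [add_zero] at h5
          refine le_trans (le_of_eq ?_) h5
          simp [heatCZ, Set.indicator_of_notMem h2]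
        · rw [Set.mem_Ioo, not_and_or, not_lt, not_lt] at h2
          rcases h2 with h2 | h2
          · exact Or.inl ⟨by linarith [h1.1], by linarith [hs'.1]⟩
          · exact Or.inr ⟨by linarith [hs'.2], by linarith [h1.2]⟩
      · refine le_trans ?_ le_add_self
        refine le_trans ?_ (hfin ?_)
        · have h5 := heatCZ_section_le ε N hε hl (by linarith [hs'.1] : 3 * l ^ 2 ≤ r + s) a
          refine le_trans (le_of_eq ?_) h5
          simp [heatCZ, Set.indicator_of_notMem h1]
        · rw [Set.mem_Ioo, not_and_or, not_lt, not_lt] at h1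
          rcases h1 with h1 | h1
          · exact Or.inl ⟨by linarith [h2.1, hs'.2], by linarith⟩
          · exact Or.inr ⟨by linarith, by linarith [h2.2, hs'.1]⟩
      · simp [heatCZ, Set.indicator_of_notMem h1, Set.indicator_of_notMem h2]

theorem exists_parabolicHormander_heatCZ :
    ∃ B : NNReal, ∀ ε N : ℝ, 0 < ε → ParabolicHormander (heatCZ ε N) B := by
  have m2 : (∫⁻ z, ‖prof2 z‖ₑ) ≠ ∞ := integrable_prof2.2.ne
  have m3 : (∫⁻ z, ‖prof3 z‖ₑ) ≠ ∞ := integrable_prof3.2.ne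
  have m4 : (∫⁻ z, ‖prof4 z‖ₑ) ≠ ∞ := integrable_prof4.2.ne
  have t2 : (∫⁻ z, ‖z ^ 2 * prof2 z‖ₑ) ≠ ∞ := integrable_sq_mul_prof2.2.ne
  have hfin : 16 * (∫⁻ z, ‖z ^ 2 * prof2 z‖ₑ) + ((∫⁻ z, ‖prof4 z‖ₑ) + (∫⁻ z, ‖prof3 z‖ₑ)) +
      (2 * (∫⁻ z, ‖prof2 z‖ₑ) + 2 * ∫⁻ z, ‖prof2 z‖ₑ) ≠ ∞ := by finiteness
  refine ⟨ENNReal.toNNReal (16 * (∫⁻ z, ‖z ^ 2 * prof2 z‖ₑ) +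
    ((∫⁻ z, ‖prof4 z‖ₑ) + (∫⁻ z, ‖prof3 z‖ₑ)) + (2 * (∫⁻ z, ‖prof2 z‖ₑ) + 2 * ∫⁻ z, ‖prof2 z‖ₑ)),
    fun ε N hε l hl s a hs ha => ?_⟩
  rw [ENNReal.coe_toNNReal hfin]
  have hl2 : 0 < l ^ 2 := by positivity
  have hS : MeasurableSet {u : ℝ × ℝ | ¬ (|u.1| ≤ 4 * l ^ 2 ∧ |u.2| ≤ 2 * l)} :=
    ((measurableSet_le (f := fun u : ℝ × ℝ => |u.1|) (by fun_prop) measurable_const).inter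
      (measurableSet_le (f := fun u : ℝ × ℝ => |u.2|) (by fun_prop) measurable_const)).compl
  have hKm := measurable_heatCZ ε N
  have hm : Measurable fun u : ℝ × ℝ => ‖heatCZ ε N (u + (s, a)) - heatCZ ε N u‖ₑ :=
    ((hKm.comp (by fun_prop)).sub hKm).enorm
  rw [← lintegral_indicator hS, Measure.volume_eq_prod,
    lintegral_prod _ (hm.indicator hS).aemeasurable]
  refine (lintegral_mono fun r => heatCZ_section_diff_le hε hl hs ha r).trans ?_
  have hpm : ∀ c : ℝ, Measurable fun r : ℝ => ENNReal.ofReal (r ^ c) := fun c => by fun_prop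
  have hq : ENNReal.ofReal (l ^ 2) * ENNReal.ofReal (l ^ 2)⁻¹ = 1 := by
    rw [← ENNReal.ofReal_mul hl2.le, mul_inv_cancel₀ hl2.ne', ENNReal.ofReal_one]
  have hv : ∀ (k : ℝ) (x y : ℝ) (m : ℝ≥0∞), 0 ≤ k → y - x = k * l ^ 2 →
      ∫⁻ r, (Set.Icc x y).indicator (fun _ => ENNReal.ofReal (l ^ 2)⁻¹ * m) r =
        ENNReal.ofReal k * m := by
    intro k x y m hk hxy
    rw [lintegral_indicator measurableSet_Icc, setLIntegral_const, Real.volume_Icc, hxy,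
      ENNReal.ofReal_mul hk]
    calc _ = (ENNReal.ofReal (l ^ 2) * ENNReal.ofReal (l ^ 2)⁻¹) * (ENNReal.ofReal k * m) := by ring
      _ = _ := by rw [hq, one_mul]
  rw [lintegral_add_right, lintegral_add_right, lintegral_add_left]
  · refine add_le_add (add_le_add ?_ ?_) (add_le_add ?_ ?_)
    · have := hv 8 (-(4 * l ^ 2)) (4 * l ^ 2) (2 * ∫⁻ z, ‖z ^ 2 * prof2 z‖ₑ) (by norm_num) (by ring)
      have e : ∀ x : ℝ≥0∞, 2 * (ENNReal.ofReal (l ^ 2)⁻¹ * x) =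
        ENNReal.ofReal (l ^ 2)⁻¹ * (2 * x) := fun x => by ring
      simp only [e]
      rw [this, ← mul_assoc]
      refine le_of_eq ?_
      congr 1
      rw [← ENNReal.ofReal_ofNat 2, ← ENNReal.ofReal_mul (by norm_num)]
      norm_num
    · rw [lintegral_indicator measurableSet_Ioi, lintegral_add_left (by fun_prop),
        lintegral_mul_const' _ _ m4, lintegral_mul_const' _ _ m3,
        lintegral_const_mul' _ _ (by finiteness), lintegral_const_mul' _ _ (by finiteness),
        lintegral_Ioi_ofReal_rpow (by norm_num) (by positivity),
        lintegral_Ioi_ofReal_rpow (by norm_num) (by positivity), ← ENNReal.ofReal_mul hl2.le,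
        ← ENNReal.ofReal_mul hl.le]
      have e1 : l ^ 2 * (-(4 * l ^ 2) ^ ((-2 : ℝ) + 1) / (-2 + 1)) = 1 / 4 := by
        rw [show (-2 : ℝ) + 1 = -1 by norm_num, Real.rpow_neg_one]
        field_simp
      have e2 : l * (-(4 * l ^ 2) ^ ((-(3 / 2) : ℝ) + 1) / (-(3 / 2) + 1)) = 1 := by
        rw [show (-(3 / 2) : ℝ) + 1 = -(1 / 2) by norm_num, Real.rpow_neg (by positivity),
          ← Real.sqrt_eq_rpow, show 4 * l ^ 2 = (2 * l) ^ 2 by ring, Real.sqrt_sq (by positivity)]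
        field_simp
      rw [e1, e2]
      gcongr
      · refine (mul_le_mul_left (b := _) (ENNReal.ofReal_le_one.2 (by norm_num)) _).trans_eq
          (one_mul _)
      · simp
    · exact (hv 2 _ _ _ (by norm_num) (by ring)).trans_le (by simp)
    · exact (hv 2 _ _ _ (by norm_num) (by ring)).trans_le (by simp)
  · exact measurable_const.indicator measurableSet_Icc
  · exact Measurable.indicator (by fun_prop) measurableSet_Ioi
  · exact (measurable_const.indicator measurableSet_Icc).add
      (measurable_const.indicator measurableSet_Icc)

/-- Uniform `L^p` bounds for the truncated heat singular integral. -/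
theorem exists_eLpNorm_corr_heatCZ_le {p : ℝ} (hp : 1 < p) :
    ∃ C : NNReal, ∀ ε N : ℝ, 0 < ε → ε ≤ N → ∀ f : ℝ × ℝ → ℝ, Measurable f → ∀ M : ℝ,
      (∀ z, |f z| ≤ M) → eLpNorm (corr (heatCZ ε N) f) (ENNReal.ofReal p) volume ≤
        C * eLpNorm f (ENNReal.ofReal p) volume := by
  obtain ⟨B, hB⟩ := exists_parabolicHormander_heatCZ
  obtain ⟨C, hC⟩ := exists_eLpNorm_corr_le hp (max B 4)
  refine ⟨C, fun ε N hε hN f hf M hM => hC _ (measurable_heatCZ ε N) (integrable_heatCZ hε N)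
    (fun g hg M hM => (l2Bounded_heatCZ hε hN g hg M hM).trans ?_)
    (fun l hl s a hs ha => (hB ε N hε l hl s a hs ha).trans ?_) f hf M hM⟩
  · gcongr
    exact_mod_cast le_max_right _ _
  · exact_mod_cast le_max_left _ _

/-- Disintegration of Lebesgue measure on `ℝ × ℝᵈ` along sheared copies of the lines in
direction `e`, weighted by a unit slab transversal to `e`. -/
theorem lintegral_eq_slab {d : ℕ} {e : Fin d → ℝ} {ell : (Fin d → ℝ) →L[ℝ] ℝ} (he : ell e = 1)
    {β : ℝ → Fin d → ℝ} (hβ : Measurable β) {H : ℝ × (Fin d → ℝ) → ℝ≥0∞} (hH : Measurable H) :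
    ∫⁻ q, H q = ∫⁻ x : Fin d → ℝ, (ell ⁻¹' Set.Icc 0 1).indicator 1 x *
      ∫⁻ z : ℝ × ℝ, H (z.1, x + z.2 • e + β z.1) := by
  set ρ : (Fin d → ℝ) → ℝ≥0∞ := (ell ⁻¹' Set.Icc 0 1).indicator 1 with hρ
  have hρm : Measurable ρ := measurable_one.indicator (ell.measurable measurableSet_Icc)
  have hslice : ∀ F : (Fin d → ℝ) → ℝ≥0∞, Measurable F →
      ∫⁻ x, F x = ∫⁻ x, ∫⁻ y : ℝ, ρ x * F (x + y • e) := by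
    intro F hF
    rw [lintegral_lintegral_swap]
    · have h1 : ∀ y : ℝ, ∫⁻ x, ρ x * F (x + y • e) = ∫⁻ x, ρ (x - y • e) * F x := fun y => by
        rw [← lintegral_sub_right_eq_self (fun x => ρ x * F (x + y • e)) (y • e)]
        simp
      simp only [h1]
      rw [lintegral_lintegral_swap]
      · refine lintegral_congr fun x => ?_
        have hm : Measurable fun y : ℝ => ρ (x - y • e) := hρm.comp (by fun_prop)
        rw [lintegral_mul_const _ hm]
        have h2 : ∀ y : ℝ, ρ (x - y • e) = (Set.Icc (ell x - 1) (ell x)).indicator 1 y := by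
          intro y
          simp only [hρ, Set.indicator, Set.mem_preimage, map_sub, map_smul, he, smul_eq_mul,
            mul_one, Set.mem_Icc, Pi.one_apply]
          congr 1
          apply propext; constructor <;> rintro ⟨h, h'⟩ <;> constructor <;> linarith
        simp only [h2]
        rw [lintegral_indicator_one measurableSet_Icc]
        simp
      · exact ((hρm.comp (by fun_prop)).mul (hF.comp (by fun_prop))).aemeasurable
    · exact ((hρm.comp (by fun_prop)).mul (hF.comp (by fun_prop))).aemeasurable
  have h3 : ∀ t, ∫⁻ x, H (t, x) = ∫⁻ x, ∫⁻ y : ℝ, ρ x * H (t, x + y • e + β t) := by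
    intro t
    rw [← lintegral_add_right_eq_self (fun x => H (t, x)) (β t)]
    exact hslice (fun x => H (t, x + β t)) (hH.comp (by fun_prop))
  rw [Measure.volume_eq_prod, lintegral_prod _ hH.aemeasurable]
  simp only [h3]
  rw [lintegral_lintegral_swap]
  · refine lintegral_congr fun x => ?_
    have hx : Measurable fun z : ℝ × ℝ => H (z.1, x + z.2 • e + β z.1) := hH.comp (by fun_prop)
    rw [← lintegral_const_mul _ hx, Measure.volume_eq_prod,
      lintegral_prod (fun z : ℝ × ℝ => ρ x * H (z.1, x + z.2 • e + β z.1))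
        (hx.const_mul _).aemeasurable]
  · have : Measurable fun q : (ℝ × (Fin d → ℝ)) × ℝ =>
        ρ q.1.2 * H (q.1.1, q.1.2 + q.2 • e + β q.1.1) :=
      (hρm.comp (by fun_prop)).mul (hH.comp (by fun_prop))
    exact this.lintegral_prod_right'.aemeasurable

/-- The correlation operator along the direction `e` and the path `β`. -/
noncomputable def pathCorr {d : ℕ} (K : ℝ × ℝ → ℝ) (e : Fin d → ℝ) (β : ℝ → Fin d → ℝ)
    (f : ℝ × (Fin d → ℝ) → ℝ) (q : ℝ × (Fin d → ℝ)) : ℝ :=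
  ∫ w : ℝ × ℝ, K w * f (q.1 + w.1, q.2 + w.2 • e + (β (q.1 + w.1) - β q.1))

theorem measurable_pathCorr {d : ℕ} {K : ℝ × ℝ → ℝ} (hK : Measurable K) {e : Fin d → ℝ}
    {β : ℝ → Fin d → ℝ} (hβ : Measurable β) {f : ℝ × (Fin d → ℝ) → ℝ} (hf : Measurable f) :
    Measurable (pathCorr K e β f) := by
  have h : Measurable fun q : (ℝ × (Fin d → ℝ)) × (ℝ × ℝ) => K q.2 *
      f (q.1.1 + q.2.1, q.1.2 + q.2.2 • e + (β (q.1.1 + q.2.1) - β q.1.1)) :=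
    (hK.comp measurable_snd).mul (hf.comp (by fun_prop))
  exact (StronglyMeasurable.integral_prod_right' h.stronglyMeasurable).measurable

theorem eLpNorm_pathCorr_le {d : ℕ} {p : ℝ} (hp : 1 < p) {K : ℝ × ℝ → ℝ} (hK : Measurable K)
    {C : ℝ≥0∞} (hC : ∀ f : ℝ × ℝ → ℝ, Measurable f → ∀ M : ℝ, (∀ z, |f z| ≤ M) →
      eLpNorm (corr K f) (ENNReal.ofReal p) volume ≤ C * eLpNorm f (ENNReal.ofReal p) volume)
    {e : Fin d → ℝ} (he : e ≠ 0) {β : ℝ → Fin d → ℝ} (hβ : Measurable β)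
    {f : ℝ × (Fin d → ℝ) → ℝ} (hf : Measurable f) {M : ℝ} (hM : ∀ z, |f z| ≤ M) :
    eLpNorm (pathCorr K e β f) (ENNReal.ofReal p) volume ≤
      C * eLpNorm f (ENNReal.ofReal p) volume := by
  have hp0 : 0 < p := by linarith
  obtain ⟨ell, hell⟩ : ∃ ell : (Fin d → ℝ) →L[ℝ] ℝ, ell e = 1 := by
    obtain ⟨i, hi⟩ := Function.ne_iff.1 he
    refine ⟨(e i)⁻¹ • ContinuousLinearMap.proj i, ?_⟩
    simp [inv_mul_cancel₀ hi]
  have hTm := measurable_pathCorr hK (e := e) hβ hf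
  have hC' : ∀ F : ℝ × ℝ → ℝ, Measurable F → (∀ z, |F z| ≤ M) →
      ∫⁻ z, ‖corr K F z‖ₑ ^ p ≤ C ^ p * ∫⁻ z, ‖F z‖ₑ ^ p := by
    intro F hF hFM
    have h := ENNReal.rpow_le_rpow (hC F hF M hFM) hp0.le
    rw [eLpNorm_ofReal_eq hp, eLpNorm_ofReal_eq hp, ENNReal.mul_rpow_of_nonneg _ _ hp0.le,
      ← ENNReal.rpow_mul, ← ENNReal.rpow_mul, one_div_mul_cancel hp0.ne'] at h
    simpa using h
  have key : ∫⁻ q, ‖pathCorr K e β f q‖ₑ ^ p ≤ C ^ p * ∫⁻ q, ‖f q‖ₑ ^ p := by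
    rw [lintegral_eq_slab hell hβ (hTm.enorm.pow_const p),
      lintegral_eq_slab hell hβ (hf.enorm.pow_const p)]
    have hm : Measurable fun x : Fin d → ℝ => (ell ⁻¹' Set.Icc 0 1).indicator
        (1 : (Fin d → ℝ) → ℝ≥0∞) x * ∫⁻ z : ℝ × ℝ, ‖f (z.1, x + z.2 • e + β z.1)‖ₑ ^ p := by
      refine (measurable_one.indicator (ell.measurable measurableSet_Icc)).mul ?_
      have : Measurable fun q : (Fin d → ℝ) × (ℝ × ℝ) =>
          ‖f (q.2.1, q.1 + q.2.2 • e + β q.2.1)‖ₑ ^ p :=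
        (hf.comp (by fun_prop)).enorm.pow_const p
      exact this.lintegral_prod_right'
    rw [← lintegral_const_mul _ hm]
    refine lintegral_mono fun x => ?_
    rw [mul_left_comm]
    refine mul_le_mul_right ?_ _
    refine le_trans (le_of_eq ?_) (hC' (fun z => f (z.1, x + z.2 • e + β z.1))
      (hf.comp (by fun_prop)) fun z => hM _)
    refine lintegral_congr fun z => ?_
    congr 2
    unfold pathCorr corr
    congr 1; ext w
    simp only [Prod.fst_add, Prod.snd_add]
    congr 3
    module
  rw [eLpNorm_ofReal_eq hp, eLpNorm_ofReal_eq hp]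
  refine (ENNReal.rpow_le_rpow key (by positivity)).trans (le_of_eq ?_)
  rw [ENNReal.mul_rpow_of_nonneg _ _ (by positivity), ← ENNReal.rpow_mul,
    mul_one_div_cancel hp0.ne', ENNReal.rpow_one]

section

/-- The standard Gaussian measure on `ℝ`. -/
noncomputable abbrev gaussStd : Measure ℝ := ProbabilityTheory.gaussianReal 0 1

theorem integral_gaussStd (F : ℝ → ℝ) : ∫ z, F z ∂gaussStd = ∫ z, gam z * F z := by
  rw [ProbabilityTheory.integral_gaussianReal_eq_integral_smul one_ne_zero]
  congr 1; ext z
  simp [ProbabilityTheory.gaussianPDFReal, gam]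

theorem integrable_gaussStd {F : ℝ → ℝ} (hF : Integrable fun z => gam z * F z) :
    Integrable F gaussStd := by
  rw [gaussStd, ProbabilityTheory.gaussianReal_of_var_ne_zero _ one_ne_zero]
  rw [integrable_withDensity_iff_integrable_smul' (by fun_prop)
    (Filter.Eventually.of_forall fun _ => ProbabilityTheory.gaussianPDF_lt_top)]
  refine hF.congr (Filter.Eventually.of_forall fun z => ?_)
  simp [ProbabilityTheory.gaussianPDF, ProbabilityTheory.gaussianPDFReal, gam,
    ENNReal.toReal_ofReal (Real.exp_nonneg _)]

theorem integrable_pow_gaussStd (n : ℕ) : Integrable (fun z : ℝ => z ^ n) gaussStd :=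
  integrable_gaussStd ((integrable_pow_mul_gam n).congr
    (Filter.Eventually.of_forall fun _ => mul_comm _ _))

theorem integral_id_gaussStd : ∫ z : ℝ, z ∂gaussStd = 0 :=
  ProbabilityTheory.integral_id_gaussianReal

theorem integral_sq_gaussStd : ∫ z : ℝ, z ^ 2 ∂gaussStd = 1 := by
  rw [integral_gaussStd, ← integral_sq_mul_gam]
  simp only [mul_comm]

theorem integral_gaussStd_sqrt_add {a b : ℝ} (ha : 0 ≤ a) (hb : 0 ≤ b) {F : ℝ → ℝ}
    (hF : Continuous F) {M : ℝ} (hM : ∀ z, |F z| ≤ M) :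
    ∫ z, F (Real.sqrt (a + b) * z) ∂gaussStd =
      ∫ z, ∫ z', F (Real.sqrt a * z + Real.sqrt b * z') ∂gaussStd ∂gaussStd := by
  have hmap : ∀ {c : ℝ} (hc : 0 ≤ c), gaussStd.map (Real.sqrt c * ·) =
      ProbabilityTheory.gaussianReal 0 c.toNNReal := by
    intro c hc
    rw [ProbabilityTheory.gaussianReal_map_const_mul]
    congr 1
    · simp
    · rw [mul_one]
      ext
      simp [Real.sq_sqrt hc, Real.coe_toNNReal _ hc]
  have hm : ∀ c : ℝ, AEMeasurable (Real.sqrt c * ·) gaussStd := fun c => by fun_prop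
  have hint : ∀ {μ : Measure ℝ} [IsProbabilityMeasure μ], Integrable F μ := fun {μ} _ =>
    Integrable.of_bound hF.aestronglyMeasurable M (Filter.Eventually.of_forall hM)
  have h1 : ∫ z, F (Real.sqrt (a + b) * z) ∂gaussStd =
      ∫ z, F z ∂(ProbabilityTheory.gaussianReal 0 (a + b).toNNReal) := by
    rw [← hmap (add_nonneg ha hb), integral_map (hm _) hF.aestronglyMeasurable]
  have h2 : ProbabilityTheory.gaussianReal 0 (a + b).toNNReal =
      Measure.conv (ProbabilityTheory.gaussianReal 0 a.toNNReal)
        (ProbabilityTheory.gaussianReal 0 b.toNNReal) := by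
    rw [ProbabilityTheory.gaussianReal_conv_gaussianReal, add_zero,
      Real.toNNReal_add ha hb]
  rw [h1, h2, integral_conv hint, ← hmap ha, integral_map (hm _)]
  · congr 1; ext z
    rw [← hmap hb, integral_map (hm _) (by fun_prop)]
  · have : StronglyMeasurable (Function.uncurry fun x y : ℝ => F (x + y)) :=
      (hF.comp continuous_add).stronglyMeasurable
    exact this.integral_prod_right.aestronglyMeasurable

variable {d : ℕ}

/-- The heat semigroup in direction `e`. -/
noncomputable def gavg (e : Fin d → ℝ) (a : ℝ) (f : (Fin d → ℝ) → ℝ) (x : Fin d → ℝ) : ℝ :=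
  ∫ z, f (x + (Real.sqrt (2 * a) * z) • e) ∂gaussStd

theorem integrable_of_bounded_gaussStd {F : ℝ → ℝ} (hF : Measurable F) {M : ℝ}
    (hM : ∀ z, |F z| ≤ M) : Integrable F gaussStd :=
  Integrable.of_bound hF.aestronglyMeasurable M (Filter.Eventually.of_forall hM)

theorem abs_gavg_le {e : Fin d → ℝ} {a : ℝ} {f : (Fin d → ℝ) → ℝ} {M : ℝ}
    (hM : ∀ z, |f z| ≤ M) (x : Fin d → ℝ) : |gavg e a f x| ≤ M := by
  have h := norm_integral_le_of_norm_le_const (μ := gaussStd)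
    (f := fun z => f (x + (Real.sqrt (2 * a) * z) • e)) (C := M)
    (Filter.Eventually.of_forall fun z => hM _)
  simpa [gavg] using h

theorem gavg_sub {e : Fin d → ℝ} {a : ℝ} {f g : (Fin d → ℝ) → ℝ} (hf : Continuous f)
    (hg : Continuous g) {M N : ℝ} (hM : ∀ z, |f z| ≤ M) (hN : ∀ z, |g z| ≤ N) (x : Fin d → ℝ) :
    gavg e a (fun y => f y - g y) x = gavg e a f x - gavg e a g x :=
  integral_sub (integrable_of_bounded_gaussStd (by fun_prop) fun z => hM _)
    (integrable_of_bounded_gaussStd (by fun_prop) fun z => hN _)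

theorem gavg_add_time {e : Fin d → ℝ} {a b : ℝ} (ha : 0 ≤ a) (hb : 0 ≤ b)
    {f : (Fin d → ℝ) → ℝ} (hf : Continuous f) {M : ℝ} (hM : ∀ z, |f z| ≤ M) (x : Fin d → ℝ) :
    gavg e (a + b) f x = gavg e a (gavg e b f) x := by
  have h := integral_gaussStd_sqrt_add (a := 2 * a) (b := 2 * b) (by positivity) (by positivity)
    (F := fun s => f (x + s • e)) (by fun_prop) (M := M) fun z => hM _
  unfold gavg
  rw [mul_add, h]
  congr 1; ext z; congr 1; ext z'
  congr 1; module

theorem continuous_gavg {e : Fin d → ℝ} {a : ℝ} {f : (Fin d → ℝ) → ℝ} (hf : Continuous f)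
    {M : ℝ} (hM : ∀ z, |f z| ≤ M) : Continuous (gavg e a f) := by
  refine continuous_of_dominated (bound := fun _ => M) (fun x => ?_) (fun x => ?_)
    (integrable_const M) ?_
  · exact Continuous.aestronglyMeasurable (by fun_prop)
  · exact Filter.Eventually.of_forall fun z => hM _
  · exact Filter.Eventually.of_forall fun z => by fun_prop

theorem abs_gavg_sub_le {e : Fin d → ℝ} {a : ℝ} {f : (Fin d → ℝ) → ℝ}
    (hf : Continuous f) {M : ℝ} (hM : ∀ z, |f z| ≤ M) {L c D : ℝ}
    {x : Fin d → ℝ} (hL : ∀ v, |f (x + v) - c| ≤ D + L * ‖v‖) :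
    |gavg e a f x - c| ≤ D + L * (Real.sqrt (2 * a) * ‖e‖ * ∫ z : ℝ, |z| ∂gaussStd) := by
  have hi : Integrable (fun z : ℝ => |z|) gaussStd := by
    simpa using (integrable_pow_gaussStd 1).abs
  have h1 : gavg e a f x - c = ∫ z, (f (x + (Real.sqrt (2 * a) * z) • e) - c) ∂gaussStd := by
    rw [integral_sub (integrable_of_bounded_gaussStd (by fun_prop) fun z => hM _)
      (integrable_const c)]
    simp [gavg]
  have h2 : ∫ z, (D + L * (Real.sqrt (2 * a) * ‖e‖ * |z|)) ∂gaussStd =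
      D + L * (Real.sqrt (2 * a) * ‖e‖ * ∫ z : ℝ, |z| ∂gaussStd) := by
    rw [integral_add (integrable_const _) ((hi.const_mul _).const_mul _), integral_const_mul,
      integral_const_mul]
    simp
  have hI : Integrable (fun z : ℝ => D + L * (Real.sqrt (2 * a) * ‖e‖ * |z|)) gaussStd :=
    (integrable_const D).add ((hi.const_mul _).const_mul _)
  rw [h1, ← h2, ← Real.norm_eq_abs]
  refine norm_integral_le_of_norm_le hI (Filter.Eventually.of_forall fun z => ?_)
  refine (hL _).trans (le_of_eq ?_)
  rw [norm_smul, norm_mul, Real.norm_eq_abs, Real.norm_eq_abs, abs_of_nonneg (Real.sqrt_nonneg _)]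
  ring

end

theorem integral_heat2_mul {r : ℝ} (hr : 0 < r) {ψ ψ1 ψ2 : ℝ → ℝ}
    (h1 : ∀ y, HasDerivAt ψ (ψ1 y) y) (h2 : ∀ y, HasDerivAt ψ1 (ψ2 y) y) (hc : Continuous ψ2)
    {M : ℝ} (hM0 : ∀ y, |ψ y| ≤ M) (hM1 : ∀ y, |ψ1 y| ≤ M) (hM2 : ∀ y, |ψ2 y| ≤ M) :
    ∫ y, heat2 r y * ψ y = ∫ z, ψ2 (Real.sqrt (2 * r) * z) ∂gaussStd := by
  set a := isd r with ha
  have ha0 : 0 < a := isd_pos hr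
  set k1 : ℝ → ℝ := fun y => a ^ 2 * (-(a * y) * gam (a * y)) with hk1
  have hlin : ∀ y : ℝ, HasDerivAt (fun y : ℝ => a * y) a y := fun y => by
    simpa using (hasDerivAt_id y).const_mul a
  have hgam : ∀ y, HasDerivAt (fun y => gam (a * y)) (-(a * y) * gam (a * y) * a) y := fun y =>
    (hasDerivAt_gam (a * y)).comp y (hlin y)
  have hd0 : ∀ y, HasDerivAt (heat0 r) (k1 y) y := fun y => by
    refine ((hgam y).const_mul a).congr_deriv ?_
    simp only [hk1]; ring
  have hd1 : ∀ y, HasDerivAt k1 (heat2 r y) y := fun y => by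
    refine (((hlin y).fun_neg.mul (hgam y)).const_mul (a ^ 2)).congr_deriv ?_
    simp only [heat2, prof2, ← ha]; ring
  have hi0 : Integrable (heat0 r) := integrable_heat0 hr
  have hi1 : Integrable k1 := by
    have h := ((integrable_pow_mul_gam 1).comp_mul_left' ha0.ne').const_mul (-a ^ 2)
    refine h.congr (Filter.Eventually.of_forall fun y => ?_)
    simp only [hk1]; ring
  have hi2 : Integrable (heat2 r) := (integrable_prof2.comp_mul_left' ha0.ne').const_mul _
  have hmul : ∀ {K F : ℝ → ℝ}, Integrable K → Continuous F → (∀ y, |F y| ≤ M) →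
      Integrable (fun y => K y * F y) := fun hK hF hb =>
    hK.mul_bdd hF.aestronglyMeasurable (Filter.Eventually.of_forall hb)
  have hc0 : Continuous ψ := continuous_iff_continuousAt.2 fun y => (h1 y).continuousAt
  have hc1 : Continuous ψ1 := continuous_iff_continuousAt.2 fun y => (h2 y).continuousAt
  have e1 := integral_mul_deriv_eq_deriv_mul_of_integrable (u := ψ) (v := k1) (u' := ψ1)
    (v' := heat2 r) (fun y _ => h1 y) (fun y _ => hd1 y)
    ((hmul hi2 hc0 hM0).congr (Filter.Eventually.of_forall fun y => mul_comm _ _))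
    ((hmul hi1 hc1 hM1).congr (Filter.Eventually.of_forall fun y => mul_comm _ _))
    ((hmul hi1 hc0 hM0).congr (Filter.Eventually.of_forall fun y => mul_comm _ _))
  have e2 := integral_mul_deriv_eq_deriv_mul_of_integrable (u := ψ1) (v := heat0 r) (u' := ψ2)
    (v' := k1) (fun y _ => h2 y) (fun y _ => hd0 y)
    ((hmul hi1 hc1 hM1).congr (Filter.Eventually.of_forall fun y => mul_comm _ _))
    ((hmul hi0 hc hM2).congr (Filter.Eventually.of_forall fun y => mul_comm _ _))
    ((hmul hi0 hc1 hM1).congr (Filter.Eventually.of_forall fun y => mul_comm _ _))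
  have e3 := Measure.integral_comp_mul_left
    (fun y => gam y * ψ2 (Real.sqrt (2 * r) * y)) a
  have hsa : Real.sqrt (2 * r) * a = 1 := by
    simp only [ha, isd]; exact mul_inv_cancel₀ (by positivity)
  have e4 : ∀ y, heat2 r y * ψ y = ψ y * heat2 r y := fun y => mul_comm _ _
  simp only [e4]
  rw [e1, e2, neg_neg, integral_gaussStd]
  have e5 : ∀ y, ψ2 y * heat0 r y = a * (gam (a * y) * ψ2 (Real.sqrt (2 * r) * (a * y))) := by
    intro y
    rw [← mul_assoc (Real.sqrt (2 * r)), hsa, one_mul, heat0]; ring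
  simp only [e5]
  rw [integral_const_mul, e3, smul_eq_mul, abs_of_pos (inv_pos.2 ha0), ← mul_assoc,
    mul_inv_cancel₀ ha0.ne', one_mul]

section

theorem exists_abs_le_of_hasCompactSupport {E : Type*} [NormedAddCommGroup E] {u : E → ℝ}
  (hu : Continuous u)
    (hc : HasCompactSupport u) : ∃ M, 0 ≤ M ∧ ∀ x, |u x| ≤ M := by
  obtain ⟨M, hM⟩ := hc.exists_bound_of_continuous hu
  exact ⟨M, (norm_nonneg _).trans (hM 0), hM⟩

section Calculus
variable {E : Type*} [NormedAddCommGroup E] [NormedSpace ℝ E]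

/-- The derivative of `u` in the direction `q`. -/
noncomputable def dd (q : E) (u : E → ℝ) (x : E) : ℝ := fderiv ℝ u x q

theorem contDiff_dd (q : E) {u : E → ℝ} (hu : ContDiff ℝ (⊤ : ℕ∞) u) :
    ContDiff ℝ (⊤ : ℕ∞) (dd q u) :=
  (hu.fderiv_right (m := (⊤ : ℕ∞)) (by simp)).clm_apply contDiff_const

theorem hasCompactSupport_dd (q : E) {u : E → ℝ} (hu : HasCompactSupport u) :
    HasCompactSupport (dd q u) := hu.fderiv_apply (𝕜 := ℝ) q

theorem dd_dd {u : E → ℝ} (hu : ContDiff ℝ (⊤ : ℕ∞) u) (q q' x : E) :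
    dd q (dd q' u) x = fderiv ℝ (fderiv ℝ u) x q q' := by
  have h : DifferentiableAt ℝ (fderiv ℝ u) x :=
    (hu.fderiv_right (m := (⊤ : ℕ∞)) (by simp)).differentiable (by simp) x
  unfold dd
  rw [fderiv_clm_apply h (differentiableAt_const q')]
  simp

theorem dd_comm {u : E → ℝ} (hu : ContDiff ℝ (⊤ : ℕ∞) u) (q q' : E) :
    dd q (dd q' u) = dd q' (dd q u) := by
  ext x
  rw [dd_dd hu, dd_dd hu]
  exact (hu.contDiffAt (x := x)).isSymmSndFDerivAt (by
    rw [minSmoothness_of_isRCLikeNormedField]; exact ENat.LEInfty.out) q q'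

theorem hasDerivAt_dd_line {u : E → ℝ} (hu : ContDiff ℝ (⊤ : ℕ∞) u) (x q : E) (s : ℝ) :
    HasDerivAt (fun s : ℝ => u (x + s • q)) (dd q u (x + s • q)) s := by
  have h1 : HasDerivAt (fun s : ℝ => x + s • q) q s := by
    simpa using ((hasDerivAt_id s).smul_const q).const_add x
  exact (hu.differentiable (by simp) (x + s • q)).hasFDerivAt.comp_hasDerivAt s h1

theorem exists_lipschitz_of_hasCompactSupport {F : Type*} [NormedAddCommGroup F] [NormedSpace ℝ F]
    {u : E → F} (hu : ContDiff ℝ (⊤ : ℕ∞) u) (hc : HasCompactSupport u) :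
    ∃ L, 0 ≤ L ∧ ∀ x y, ‖u x - u y‖ ≤ L * ‖x - y‖ := by
  obtain ⟨C, hC⟩ := ContDiff.lipschitzWith_of_hasCompactSupport hc hu (by simp)
  exact ⟨C, C.2, fun x y => hC.norm_sub_le x y⟩

theorem exists_taylor_bound {u : E → ℝ} (hu : ContDiff ℝ (⊤ : ℕ∞) u)
    (hc : HasCompactSupport u) : ∃ M, 0 ≤ M ∧ ∀ p q,
      |u (p + q) - u p - fderiv ℝ u p q - 1 / 2 * fderiv ℝ (fderiv ℝ u) p q q| ≤
        M * ‖q‖ ^ 3 := by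
  have hU : ContDiff ℝ (⊤ : ℕ∞) (fderiv ℝ u) := hu.fderiv_right (by simp)
  have hV : ContDiff ℝ (⊤ : ℕ∞) (fderiv ℝ (fderiv ℝ u)) := hU.fderiv_right (by simp)
  obtain ⟨M, hM0, hM⟩ := exists_lipschitz_of_hasCompactSupport hV
    ((hc.fderiv (𝕜 := ℝ)).fderiv (𝕜 := ℝ))
  have h1 : ∀ p q, ‖fderiv ℝ u (p + q) - fderiv ℝ u p - fderiv ℝ (fderiv ℝ u) p q‖ ≤
      M * ‖q‖ ^ 2 := by
    intro p q
    have h := (convex_closedBall p ‖q‖).norm_image_sub_le_of_norm_fderiv_le' (𝕜 := ℝ)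
      (f := fderiv ℝ u) (φ := fderiv ℝ (fderiv ℝ u) p) (C := M * ‖q‖) (x := p) (y := p + q)
      (fun x _ => hU.differentiable (by simp) x)
      (fun x hx => (hM x p).trans (mul_le_mul_of_nonneg_left
        (by simpa [dist_eq_norm] using hx) hM0))
      (by simp) (by simp)
    rw [add_sub_cancel_left] at h
    rwa [pow_two, ← mul_assoc]
  refine ⟨M, hM0, fun p q => ?_⟩
  set φ : ℝ → ℝ := fun s => u (p + s • q) - s * fderiv ℝ u p q -
    s ^ 2 / 2 * fderiv ℝ (fderiv ℝ u) p q q with hφ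
  have hd : ∀ s, HasDerivAt φ ((fderiv ℝ u (p + s • q) - fderiv ℝ u p -
      fderiv ℝ (fderiv ℝ u) p (s • q)) q) s := by
    intro s
    have h2 := ((hasDerivAt_dd_line hu p q s).fun_sub
      ((hasDerivAt_id s).mul_const (fderiv ℝ u p q))).fun_sub
      (((hasDerivAt_pow 2 s).div_const 2).mul_const (fderiv ℝ (fderiv ℝ u) p q q))
    refine h2.congr_deriv ?_
    simp [dd]
  have hb := norm_image_sub_le_of_norm_deriv_le_segment_01' (f := φ) (C := M * ‖q‖ ^ 3)
    (fun s _ => (hd s).hasDerivWithinAt) (fun s hs => by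
      refine (ContinuousLinearMap.le_opNorm _ _).trans ?_
      have h3 := h1 p (s • q)
      rw [norm_smul, Real.norm_eq_abs, abs_of_nonneg hs.1] at h3
      have h4 : (s * ‖q‖) ^ 2 ≤ ‖q‖ ^ 2 := by
        refine pow_le_pow_left₀ (mul_nonneg hs.1 (norm_nonneg _)) ?_ 2
        exact mul_le_of_le_one_left (norm_nonneg _) hs.2.le
      calc _ ≤ M * ‖q‖ ^ 2 * ‖q‖ := by gcongr; exact h3.trans (by gcongr)
        _ = M * ‖q‖ ^ 3 := by ring)
  simp only [hφ] at hb
  refine le_trans (le_of_eq ?_) hb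
  rw [Real.norm_eq_abs]
  congr 1
  simp; ring

end Calculus

end

section

theorem integrable_add_mul_abs_pow_gaussStd (α β : ℝ) (n : ℕ) :
    Integrable (fun z : ℝ => (α + β * |z|) ^ n) gaussStd := by
  have h : ∀ k : ℕ, Integrable (fun z : ℝ => |z| ^ k) gaussStd := fun k => by
    simpa [abs_pow] using (integrable_pow_gaussStd k).abs
  simp only [add_pow, mul_pow]
  refine integrable_finsetSum _ fun k _ => ?_
  exact (((h (n - k)).const_mul _).const_mul _).mul_const _

theorem abs_gauss_taylor_le {E : Type*} [NormedAddCommGroup E] [NormedSpace ℝ E] {u : E → ℝ}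
    (hu : Continuous u) {B M : ℝ} (hB : ∀ x, |u x| ≤ B) {U : E →L[ℝ] ℝ} {V : E →L[ℝ] E →L[ℝ] ℝ}
    {p a b : E} (hM0 : 0 ≤ M)
    (hM : ∀ q, |u (p + q) - u p - U q - 1 / 2 * V q q| ≤ M * ‖q‖ ^ 3) :
    |∫ z, u (p + (a + z • b)) ∂gaussStd - (u p + U a + 1 / 2 * V a a + 1 / 2 * V b b)| ≤
      M * ∫ z, (‖a‖ + ‖b‖ * |z|) ^ 3 ∂gaussStd := by
  have hi1 : Integrable (fun z : ℝ => z) gaussStd := by simpa using integrable_pow_gaussStd 1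
  set c0 := u p + U a + 1 / 2 * V a a with hc0
  set c1 := U b + 1 / 2 * (V a b + V b a) with hc1
  set c2 := 1 / 2 * V b b with hc2
  have hiu : Integrable (fun z : ℝ => u (p + (a + z • b))) gaussStd :=
    Integrable.of_bound (Continuous.aestronglyMeasurable (by fun_prop)) B
      (Filter.Eventually.of_forall fun z => hB _)
  have hiP : Integrable (fun z : ℝ => c1 * z + c2 * z ^ 2) gaussStd :=
    (hi1.const_mul c1).add ((integrable_pow_gaussStd 2).const_mul c2)
  have hiP' : Integrable (fun z : ℝ => c0 + (c1 * z + c2 * z ^ 2)) gaussStd :=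
    (integrable_const c0).add hiP
  have hP : ∫ z : ℝ, (c0 + (c1 * z + c2 * z ^ 2)) ∂gaussStd = c0 + c2 := by
    rw [integral_add (integrable_const c0) hiP, integral_add (hi1.const_mul c1)
      ((integrable_pow_gaussStd 2).const_mul c2), integral_const_mul, integral_const_mul,
      integral_id_gaussStd, integral_sq_gaussStd]
    simp
  rw [← hP, ← integral_sub hiu hiP', ← integral_const_mul, ← Real.norm_eq_abs]
  refine norm_integral_le_of_norm_le
    ((integrable_add_mul_abs_pow_gaussStd ‖a‖ ‖b‖ 3).const_mul M)
    (Filter.Eventually.of_forall fun z => ?_)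
  have h := hM (a + z • b)
  have hq : ‖a + z • b‖ ≤ ‖a‖ + ‖b‖ * |z| := by
    refine (norm_add_le _ _).trans ?_
    rw [norm_smul, Real.norm_eq_abs, mul_comm]
  calc _ = |u (p + (a + z • b)) - u p - U (a + z • b) - 1 / 2 * V (a + z • b) (a + z • b)| := by
        rw [Real.norm_eq_abs]
        congr 1
        simp only [hc0, hc1, hc2, map_add, map_smul, add_apply,
          smul_apply, smul_eq_mul]
        ring
    _ ≤ M * ‖a + z • b‖ ^ 3 := h
    _ ≤ _ := by gcongr

variable {d : ℕ}

/-- The increment of the random walk: `plus or minus `√(2 d h) σ_m``. -/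
noncomputable def jump (h : ℝ) (σ : Fin d → Fin d → ℝ) (j : Fin d × Bool) : Fin d → ℝ :=
  ((if j.2 then 1 else -1) * Real.sqrt (2 * d * h)) • σ j.1

theorem norm_jump_le {h S : ℝ} {σ : Fin d → Fin d → ℝ} (hσ : ∀ m, ‖σ m‖ ≤ S)
    (j : Fin d × Bool) : ‖jump h σ j‖ ≤ Real.sqrt (2 * d) * S * Real.sqrt h := by
  unfold jump
  rw [norm_smul, norm_mul, Real.sqrt_mul (by positivity), Real.norm_eq_abs (Real.sqrt _ * _),
    abs_of_nonneg (by positivity)]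
  have : ‖(if j.2 then (1 : ℝ) else -1)‖ = 1 := by split_ifs <;> simp
  rw [this, one_mul, mul_right_comm]
  gcongr
  exact hσ _

theorem exists_one_step_bound (hd : 1 ≤ d) {u : ℝ × (Fin d → ℝ) → ℝ}
    (hu : ContDiff ℝ (⊤ : ℕ∞) u) (hc : HasCompactSupport u) (e : Fin d → ℝ) {S : ℝ} (hS : 0 ≤ S) :
    ∃ C, 0 ≤ C ∧ ∀ h, 0 < h → h ≤ 1 → ∀ σ : Fin d → Fin d → ℝ, (∀ m, ‖σ m‖ ≤ S) → ∀ τ x,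
      |(2 * d : ℝ)⁻¹ * ∑ j, gavg e h (fun y => u (τ + h, y)) (x + jump h σ j) - u (τ, x) -
        h * (dd (1, 0) u (τ, x) + dd (0, e) (dd (0, e) u) (τ, x) +
          ∑ m, dd (0, σ m) (dd (0, σ m) u) (τ, x))| ≤ C * (h * Real.sqrt h) := by
  obtain ⟨M, hM0, hM⟩ := exists_taylor_bound hu hc
  obtain ⟨B, hB0, hB⟩ := exists_abs_le_of_hasCompactSupport hu.continuous hc
  obtain ⟨B', hB0', hB'⟩ := exists_abs_le_of_hasCompactSupport
    (contDiff_dd (1, 0) (contDiff_dd (1, 0) hu)).continuous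
    (hasCompactSupport_dd (1, 0) (hasCompactSupport_dd ((1, 0) : ℝ × (Fin d → ℝ)) hc))
  have hd0 : (0 : ℝ) < 2 * d := by positivity
  set α := 1 + Real.sqrt (2 * d) * S with hα
  set β := Real.sqrt 2 * ‖e‖ with hβ
  set K := ∫ z : ℝ, (α + β * |z|) ^ 3 ∂gaussStd with hK
  have hK0 : 0 ≤ K := integral_nonneg fun z => by positivity
  refine ⟨M * K + B', by positivity, fun h h0 h1 σ hσ τ x => ?_⟩
  have hs : h ≤ Real.sqrt h := Real.le_sqrt_of_sq_le (by nlinarith)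
  have hsq : Real.sqrt h ^ 2 = h := Real.sq_sqrt h0.le
  set p : ℝ × (Fin d → ℝ) := (τ, x) with hp
  set U := fderiv ℝ u p
  set V := fderiv ℝ (fderiv ℝ u) p
  set b : ℝ × (Fin d → ℝ) := (0, Real.sqrt (2 * h) • e) with hb
  set a : Fin d × Bool → ℝ × (Fin d → ℝ) := fun j => (h, jump h σ j) with ha
  have hna : ∀ j, ‖a j‖ ≤ α * Real.sqrt h := fun j => by
    refine (norm_prod_le_iff.2 ⟨?_, ?_⟩)
    · rw [Real.norm_eq_abs, abs_of_pos h0]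
      refine hs.trans ?_
      rw [hα, add_mul, one_mul]
      exact le_add_of_nonneg_right (by positivity)
    · refine (norm_jump_le hσ j).trans ?_
      rw [hα, add_mul, one_mul]
      exact le_add_of_nonneg_left (by positivity)
  have hnb : ‖b‖ ≤ β * Real.sqrt h := by
    refine (norm_prod_le_iff.2 ⟨?_, ?_⟩)
    · simpa [hb] using (by positivity : 0 ≤ β * Real.sqrt h)
    rw [norm_smul, Real.norm_eq_abs, abs_of_nonneg (by positivity), Real.sqrt_mul (by norm_num)]
    exact le_of_eq (by rw [hβ]; ring)
  have hj : ∀ j, |gavg e h (fun y => u (τ + h, y)) (x + jump h σ j) -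
      (u p + U (a j) + 1 / 2 * V (a j) (a j) + 1 / 2 * V b b)| ≤
        M * K * (h * Real.sqrt h) := by
    intro j
    have h2 := abs_gauss_taylor_le hu.continuous hB (a := a j) (b := b) hM0 (hM p)
    have e1 : ∫ z, u (p + (a j + z • b)) ∂gaussStd =
        gavg e h (fun y => u (τ + h, y)) (x + jump h σ j) := by
      unfold gavg
      congr 1; ext z
      congr 1
      simp only [hp, ha, hb, Prod.smul_mk, Prod.mk_add_mk, smul_zero, add_zero, Prod.mk.injEq,
        true_and]
      module
    rw [e1] at h2
    refine h2.trans ?_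
    rw [mul_assoc]
    refine mul_le_mul_of_nonneg_left ?_ hM0
    have h3 : K * (h * Real.sqrt h) =
        ∫ z : ℝ, (α + β * |z|) ^ 3 * (h * Real.sqrt h) ∂gaussStd := by
      rw [integral_mul_const]
    rw [h3]
    refine integral_mono (integrable_add_mul_abs_pow_gaussStd _ _ 3)
      ((integrable_add_mul_abs_pow_gaussStd _ _ 3).mul_const _) fun z => ?_
    calc (‖a j‖ + ‖b‖ * |z|) ^ 3 ≤ (α * Real.sqrt h + β * Real.sqrt h * |z|) ^ 3 := by
          gcongr
          exact hna j
      _ = (α + β * |z|) ^ 3 * (Real.sqrt h ^ 2 * Real.sqrt h) := by ring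
      _ = _ := by rw [hsq]
  have hsum : (2 * d : ℝ)⁻¹ * ∑ j, (u p + U (a j) + 1 / 2 * V (a j) (a j) + 1 / 2 * V b b) =
      u p + h * (U (1, 0) + V (0, e) (0, e) + ∑ m, V (0, σ m) (0, σ m)) +
        h ^ 2 / 2 * V (1, 0) (1, 0) := by
    have hVb : V b b = 2 * h * V (0, e) (0, e) := by
      have : b = Real.sqrt (2 * h) • ((0, e) : ℝ × (Fin d → ℝ)) := by simp [hb]
      rw [this]
      simp only [map_smul, smul_apply, smul_eq_mul]
      rw [← mul_assoc, Real.mul_self_sqrt (by positivity)]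
    set c := Real.sqrt (2 * d * h) with hcdef
    have hc2 : c * c = 2 * d * h := Real.mul_self_sqrt (by positivity)
    have haj : ∀ j, a j = h • ((1, 0) : ℝ × (Fin d → ℝ)) +
        ((if j.2 then 1 else -1) * c) • ((0, σ j.1) : ℝ × (Fin d → ℝ)) := by
      rintro ⟨m, _ | _⟩ <;> simp [ha, jump, hcdef]
    rw [Fintype.sum_prod_type]
    have hm : ∀ m : Fin d, ∑ s : Bool, (u p + U (a (m, s)) + 1 / 2 * V (a (m, s)) (a (m, s)) +
        1 / 2 * V b b) = 2 * (u p + h * U (1, 0) + h * V (0, e) (0, e) +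
          h ^ 2 / 2 * V (1, 0) (1, 0)) + 2 * d * h * V (0, σ m) (0, σ m) := by
      intro m
      simp only [Fintype.sum_bool, haj, hVb, map_add, map_smul, add_apply,
          smul_apply, smul_eq_mul, if_true, Bool.false_eq_true, if_false]
      linear_combination V (0, σ m) (0, σ m) * hc2
    simp only [hm]
    rw [Finset.sum_add_distrib, Finset.sum_const, ← Finset.mul_sum, Finset.card_univ,
      Fintype.card_fin, nsmul_eq_mul]
    field_simp
    ring
  simp only [dd_dd hu]
  have hdiff : (2 * d : ℝ)⁻¹ * ∑ j, gavg e h (fun y => u (τ + h, y)) (x + jump h σ j) - u p -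
        h * (dd (1, 0) u p + V (0, e) (0, e) + ∑ m, V (0, σ m) (0, σ m)) =
      (2 * d : ℝ)⁻¹ * ∑ j, (gavg e h (fun y => u (τ + h, y)) (x + jump h σ j) -
        (u p + U (a j) + 1 / 2 * V (a j) (a j) + 1 / 2 * V b b)) +
          h ^ 2 / 2 * V (1, 0) (1, 0) := by
    rw [Finset.sum_sub_distrib, mul_sub, hsum]
    simp only [dd]
    ring
  rw [hdiff]
  have hV1 : |V (1, 0) (1, 0)| ≤ B' := by
    have := hB' p
    rwa [dd_dd hu] at this
  have t1 : |(2 * d : ℝ)⁻¹ * ∑ j, (gavg e h (fun y => u (τ + h, y)) (x + jump h σ j) -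
        (u p + U (a j) + 1 / 2 * V (a j) (a j) + 1 / 2 * V b b))| ≤ M * K * (h * Real.sqrt h) := by
    rw [abs_mul, abs_of_pos (inv_pos.2 hd0), inv_mul_le_iff₀ hd0]
    refine (Finset.abs_sum_le_sum_abs _ _).trans ((Finset.sum_le_sum fun j _ => hj j).trans ?_)
    rw [Finset.sum_const, Finset.card_univ, Fintype.card_prod, Fintype.card_fin,
      Fintype.card_bool, nsmul_eq_mul]
    push_cast
    exact le_of_eq (by ring)
  have t2 : |h ^ 2 / 2 * V (1, 0) (1, 0)| ≤ B' * (h * Real.sqrt h) := by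
    rw [abs_mul, abs_of_nonneg (by positivity), mul_comm]
    refine mul_le_mul hV1 ?_ (by positivity) hB0'
    nlinarith
  refine (abs_add_le _ _).trans ?_
  rw [add_mul]
  exact add_le_add t1 t2

end

section

theorem sum_sum_update {ι J : Type*} [Fintype ι] [DecidableEq ι] [Fintype J]
    (φ : (ι → J) → ℝ) (k : ι) :
    ∑ ω, ∑ j, φ (Function.update ω k j) = Fintype.card J * ∑ ω, φ ω := by
  let f : (ι → J) × J → (ι → J) × J := fun q => (Function.update q.1 k q.2, q.1 k)
  have hf : Function.Involutive f := fun q => by simp [f]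
  calc ∑ ω, ∑ j, φ (Function.update ω k j) = ∑ q : (ι → J) × J, φ (f q).1 := by
        rw [Fintype.sum_prod_type]
    _ = ∑ q : (ι → J) × J, φ q.1 := Equiv.sum_comp hf.toPerm fun q => φ q.1
    _ = _ := by
        rw [Fintype.sum_prod_type, Finset.mul_sum]
        simp

variable {d n : ℕ}

/-- The random walk with step `1 / n` and increments `jump`. -/
noncomputable def walk (σ : Fin d → ℝ → Fin d → ℝ) (ω : Fin n → Fin d × Bool) (s : ℝ) :
    Fin d → ℝ :=
  ∑ i : Fin n, if ((i : ℝ) + 1) / n ≤ s then jump (n : ℝ)⁻¹ (fun m => σ m (i / n)) (ω i) else 0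

theorem measurable_walk (σ : Fin d → ℝ → Fin d → ℝ) (ω : Fin n → Fin d × Bool) :
    Measurable (walk σ ω) := by
  unfold walk
  refine Finset.measurable_sum _ fun i _ => ?_
  exact Measurable.ite measurableSet_Ici measurable_const measurable_const

theorem walk_cell (σ : Fin d → ℝ → Fin d → ℝ) (ω : Fin n → Fin d × Bool) {k : ℕ} {s : ℝ}
    (h1 : (k : ℝ) / n ≤ s) (h2 : s < ((k : ℝ) + 1) / n) : walk σ ω s = walk σ ω (k / n) := by
  unfold walk
  refine Finset.sum_congr rfl fun i _ => ?_
  have hn : (0 : ℝ) < n := by exact_mod_cast i.pos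
  congr 1
  refine propext ⟨fun h => ?_, fun h => h.trans h1⟩
  have h3 := (div_lt_div_iff_of_pos_right hn).1 (h.trans_lt h2)
  have h4 : (i : ℕ) + 1 ≤ k := by
    have : (i : ℕ) + 1 < k + 1 := by exact_mod_cast h3
    omega
  gcongr
  exact_mod_cast h4

theorem walk_succ (σ : Fin d → ℝ → Fin d → ℝ) (ω : Fin n → Fin d × Bool) (k : Fin n) :
    walk σ ω (((k : ℝ) + 1) / n) =
      walk σ ω ((k : ℝ) / n) + jump (n : ℝ)⁻¹ (fun m => σ m (k / n)) (ω k) := by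
  have hn : (0 : ℝ) < n := by exact_mod_cast k.pos
  have h : ∀ i : Fin n, (if ((i : ℝ) + 1) / n ≤ ((k : ℝ) + 1) / n then
      jump (n : ℝ)⁻¹ (fun m => σ m (i / n)) (ω i) else 0) =
      (if ((i : ℝ) + 1) / n ≤ (k : ℝ) / n then
        jump (n : ℝ)⁻¹ (fun m => σ m (i / n)) (ω i) else 0) +
      (if i = k then jump (n : ℝ)⁻¹ (fun m => σ m (i / n)) (ω i) else 0) := by
    intro i
    have e1 : ((i : ℝ) + 1 ≤ (k : ℝ) + 1) ↔ (i : ℕ) ≤ k := by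
      rw [add_le_add_iff_right]; exact Nat.cast_le
    have e2 : ((i : ℝ) + 1 ≤ (k : ℝ)) ↔ (i : ℕ) + 1 ≤ k := by exact_mod_cast Iff.rfl
    simp only [div_le_div_iff_of_pos_right hn, e1, e2, Fin.ext_iff]
    split_ifs <;> first | omega | simp
  unfold walk
  simp only [h]
  rw [Finset.sum_add_distrib]
  simp

theorem walk_update (σ : Fin d → ℝ → Fin d → ℝ) (ω : Fin n → Fin d × Bool) (k : Fin n)
    (j : Fin d × Bool) {s : ℝ} (hs : s < ((k : ℝ) + 1) / n) :
    walk σ (Function.update ω k j) s = walk σ ω s := by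
  unfold walk
  refine Finset.sum_congr rfl fun i _ => ?_
  by_cases hik : i = k
  · subst hik
    rw [if_neg hs.not_ge, if_neg hs.not_ge]
  · rw [Function.update_of_ne hik]

/-- Expected value of `F` at time `s` along the walk, started from `x` at time `t`, with an
additional Brownian motion in direction `e`. -/
noncomputable def walkAvg (n : ℕ) (σ : Fin d → ℝ → Fin d → ℝ) (e : Fin d → ℝ) (t : ℝ)
    (x : Fin d → ℝ) (s : ℝ) (F : (Fin d → ℝ) → ℝ) : ℝ :=
  (Fintype.card (Fin n → Fin d × Bool) : ℝ)⁻¹ * ∑ ω : Fin n → Fin d × Bool,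
    gavg e (s - t) F (x + (walk σ ω s - walk σ ω t))

theorem abs_avg_le {ι : Type*} [Fintype ι] {f : ι → ℝ} {M : ℝ} (hM0 : 0 ≤ M)
    (hM : ∀ i, |f i| ≤ M) : |(Fintype.card ι : ℝ)⁻¹ * ∑ i, f i| ≤ M := by
  rw [abs_mul, abs_of_nonneg (by positivity)]
  rcases (Fintype.card ι).eq_zero_or_pos with h | h
  · simp [h, hM0]
  have h' : (0 : ℝ) < Fintype.card ι := by exact_mod_cast h
  rw [inv_mul_le_iff₀ h']
  refine (Finset.abs_sum_le_sum_abs _ _).trans ((Finset.sum_le_sum fun i _ => hM i).trans ?_)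
  simp

variable {σ : Fin d → ℝ → Fin d → ℝ} {e : Fin d → ℝ} {t : ℝ} {x : Fin d → ℝ}

theorem abs_walkAvg_le {s : ℝ} {F : (Fin d → ℝ) → ℝ} {M : ℝ}
    (hM : ∀ y, |F y| ≤ M) : |walkAvg n σ e t x s F| ≤ M :=
  abs_avg_le ((abs_nonneg _).trans (hM 0)) fun _ => abs_gavg_le hM _

theorem walkAvg_sub {s : ℝ} {F G : (Fin d → ℝ) → ℝ} (hF : Continuous F) (hG : Continuous G)
    {M N : ℝ} (hM : ∀ y, |F y| ≤ M) (hN : ∀ y, |G y| ≤ N) :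
    walkAvg n σ e t x s (fun y => F y - G y) =
      walkAvg n σ e t x s F - walkAvg n σ e t x s G := by
  simp only [walkAvg, gavg_sub hF hG hM hN, Finset.sum_sub_distrib, mul_sub]

theorem walkAvg_cell {k : ℕ} {s : ℝ} (h1 : (k : ℝ) / n ≤ s) (h2 : s < ((k : ℝ) + 1) / n)
    (ht : t ≤ k / n) {F : (Fin d → ℝ) → ℝ} (hF : Continuous F) {M : ℝ} (hM : ∀ y, |F y| ≤ M) :
    walkAvg n σ e t x s F = walkAvg n σ e t x (k / n) (gavg e (s - k / n) F) := by
  unfold walkAvg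
  congr 1
  refine Finset.sum_congr rfl fun ω _ => ?_
  rw [walk_cell σ ω h1 h2, ← gavg_add_time (by linarith) (by linarith) hF hM]
  congr 1; ring

theorem gavg_avg {ι : Type*} [Fintype ι] {a c : ℝ} {f : ι → (Fin d → ℝ) → ℝ}
    (hf : ∀ i, Continuous (f i)) {M : ℝ} (hM : ∀ i y, |f i y| ≤ M) (y : Fin d → ℝ) :
    gavg e a (fun y => c * ∑ i, f i y) y = c * ∑ i, gavg e a (f i) y := by
  unfold gavg
  rw [integral_const_mul, integral_finsetSum]
  exact fun i _ => integrable_of_bounded_gaussStd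
    (F := fun z => f i (y + (Real.sqrt (2 * a) * z) • e))
    (Continuous.measurable (by have := hf i; fun_prop)) fun z => hM i _

theorem gavg_translate {a : ℝ} (f : (Fin d → ℝ) → ℝ) (y z : Fin d → ℝ) :
    gavg e a (fun y => f (y + z)) y = gavg e a f (y + z) := by
  unfold gavg
  congr 1; ext r
  exact congrArg f (by abel)

theorem walkAvg_succ (hd : 1 ≤ d) (k : Fin n) (ht : t ≤ (k : ℝ) / n) {F : (Fin d → ℝ) → ℝ}
    (hF : Continuous F) {M : ℝ} (hM : ∀ y, |F y| ≤ M) :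
    walkAvg n σ e t x (((k : ℝ) + 1) / n) F = walkAvg n σ e t x ((k : ℝ) / n) (fun y =>
      (2 * d : ℝ)⁻¹ * ∑ j, gavg e (n : ℝ)⁻¹ F (y + jump (n : ℝ)⁻¹ (fun m => σ m (k / n)) j)) := by
  have hn : (0 : ℝ) < n := by exact_mod_cast k.pos
  have hd0 : (0 : ℝ) < d := by exact_mod_cast hd
  set h := (n : ℝ)⁻¹ with hh
  have hk1 : ((k : ℝ) + 1) / n = k / n + h := by rw [hh]; ring
  have hkt : t < ((k : ℝ) + 1) / n := by rw [hk1]; have := inv_pos.2 hn; linarith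
  have hkk : (k : ℝ) / n < ((k : ℝ) + 1) / n := by rw [hk1]; have := inv_pos.2 hn; linarith
  set z := jump h (fun m => σ m (k / n)) with hz
  set X : (Fin n → Fin d × Bool) → Fin d → ℝ := fun ω => x + (walk σ ω (k / n) - walk σ ω t)
    with hX
  have hXu : ∀ ω j, X (Function.update ω k j) = X ω := fun ω j => by
    simp only [hX, walk_update σ ω k j hkt, walk_update σ ω k j hkk]
  set f := gavg e h F with hf
  have hfc : Continuous f := continuous_gavg hF hM
  have hfM : ∀ y, |f y| ≤ M := abs_gavg_le hM
  have hl : ∀ ω, gavg e (((k : ℝ) + 1) / n - t) F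
      (x + (walk σ ω (((k : ℝ) + 1) / n) - walk σ ω t)) =
      gavg e ((k : ℝ) / n - t) f (X ω + z (ω k)) := by
    intro ω
    rw [hk1, add_sub_right_comm, gavg_add_time (by linarith) (by positivity) hF hM, ← hk1,
      walk_succ]
    congr 1
    simp only [hX, hz]; abel
  have hr : ∀ ω, gavg e ((k : ℝ) / n - t) (fun y => (2 * d : ℝ)⁻¹ * ∑ j, f (y + z j)) (X ω) =
      (2 * d : ℝ)⁻¹ * ∑ j, gavg e ((k : ℝ) / n - t) f (X ω + z j) := by
    intro ω
    rw [gavg_avg (f := fun j y => f (y + z j)) (fun j => by fun_prop) (fun j y => hfM _)]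
    simp only [gavg_translate]
  unfold walkAvg
  congr 1
  simp only [hl]
  refine Eq.trans ?_ (Finset.sum_congr rfl fun ω _ => (hr ω).symm)
  rw [← Finset.mul_sum]
  have hs := sum_sum_update (fun ω : Fin n → Fin d × Bool =>
    gavg e ((k : ℝ) / n - t) f (X ω + z (ω k))) k
  simp only [hXu, Function.update_self, Fintype.card_prod, Fintype.card_fin, Fintype.card_bool]
    at hs
  rw [hs]
  push_cast
  field_simp

end

section

variable {d n : ℕ} {σ : Fin d → ℝ → Fin d → ℝ} {e : Fin d → ℝ} {t : ℝ} {x : Fin d → ℝ}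

theorem measurable_walkAvg {G : ℝ × (Fin d → ℝ) → ℝ} (hG : Measurable G) :
    Measurable fun s => walkAvg n σ e t x s fun y => G (s, y) := by
  unfold walkAvg gavg
  refine (Finset.measurable_sum _ fun ω _ => ?_).const_mul _
  have hw := measurable_walk σ ω
  have h : Measurable fun q : ℝ × ℝ =>
      G (q.1, x + (walk σ ω q.1 - walk σ ω t) + (Real.sqrt (2 * (q.1 - t)) * q.2) • e) := by
    refine hG.comp ?_
    fun_prop
  exact (StronglyMeasurable.integral_prod_right' h.stronglyMeasurable).measurable

theorem intervalIntegrable_walkAvg {G : ℝ × (Fin d → ℝ) → ℝ} (hG : Measurable G) {M : ℝ}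
    (hM : ∀ q, |G q| ≤ M) (a b : ℝ) :
    IntervalIntegrable (fun s => walkAvg n σ e t x s fun y => G (s, y)) volume a b := by
  rw [intervalIntegrable_iff]
  exact Measure.integrableOn_of_bounded (M := M) (by simp)
    (measurable_walkAvg hG).aestronglyMeasurable
    (Filter.Eventually.of_forall fun s => abs_walkAvg_le fun y => hM _)

theorem exists_cell_bound (hd : 1 ≤ d) {u G : ℝ × (Fin d → ℝ) → ℝ}
    (hu : ContDiff ℝ (⊤ : ℕ∞) u) (huc : HasCompactSupport u)
    (hG : ContDiff ℝ (⊤ : ℕ∞) G) (hGc : HasCompactSupport G) (e : Fin d → ℝ) {S : ℝ} (hS : 0 ≤ S)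
    (hσ : ∀ m t, ‖σ m t‖ ≤ S)
    (heq : ∀ t x, G (t, x) = dd (1, 0) u (t, x) + dd (0, e) (dd (0, e) u) (t, x) +
      ∑ m, dd (0, σ m t) (dd (0, σ m t) u) (t, x)) :
    ∃ C, 0 ≤ C ∧ ∀ (n : ℕ) (k : Fin n) (t : ℝ) (x : Fin d → ℝ), t ≤ (k : ℝ) / n →
      |walkAvg n σ e t x (((k : ℝ) + 1) / n) (fun y => u (((k : ℝ) + 1) / n, y)) -
        walkAvg n σ e t x ((k : ℝ) / n) (fun y => u ((k : ℝ) / n, y)) -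
        ∫ s in ((k : ℝ) / n)..(((k : ℝ) + 1) / n), walkAvg n σ e t x s fun y => G (s, y)| ≤
      C * ((n : ℝ)⁻¹ * Real.sqrt (n : ℝ)⁻¹) := by
  obtain ⟨C1, hC10, hC1⟩ := exists_one_step_bound hd hu huc e hS
  obtain ⟨B, hB0, hB⟩ := exists_abs_le_of_hasCompactSupport hu.continuous huc
  obtain ⟨B', hB'0, hB'⟩ := exists_abs_le_of_hasCompactSupport hG.continuous hGc
  obtain ⟨L, hL0, hL⟩ := exists_lipschitz_of_hasCompactSupport hG hGc
  have huC := hu.continuous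
  have hGC := hG.continuous
  set m1 := ∫ z : ℝ, |z| ∂gaussStd with hm1
  have hm10 : 0 ≤ m1 := integral_nonneg fun z => abs_nonneg z
  refine ⟨C1 + (L + L * (Real.sqrt 2 * ‖e‖ * m1)), by positivity, fun n k t x ht => ?_⟩
  have hn : (0 : ℝ) < n := by exact_mod_cast k.pos
  have hn1 : (1 : ℝ) ≤ n := by exact_mod_cast k.pos
  set h := (n : ℝ)⁻¹ with hh
  have h0 : 0 < h := inv_pos.2 hn
  have h1 : h ≤ 1 := inv_le_one_of_one_le₀ hn1
  have hs : h ≤ Real.sqrt h := Real.le_sqrt_of_sq_le (by nlinarith)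
  set a := (k : ℝ) / n with ha
  have hb : ((k : ℝ) + 1) / n = a + h := by rw [ha, hh]; ring
  have hstep := walkAvg_succ (σ := σ) (e := e) (x := x) hd k ht
    (F := fun y => u (((k : ℝ) + 1) / n, y)) (by fun_prop) (fun y => hB _)
  rw [hb] at hstep ⊢
  set F : (Fin d → ℝ) → ℝ := fun y => (2 * d : ℝ)⁻¹ * ∑ j, gavg e h (fun y => u (a + h, y))
    (y + jump h (fun m => σ m a) j) with hF
  have hFc : Continuous F := by
    refine continuous_const.mul (continuous_finsetSum _ fun j _ => ?_)
    exact (continuous_gavg (f := fun y => u (a + h, y)) (by fun_prop) (fun y => hB _)).comp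
      (by fun_prop)
  have hFd : ∀ y, |F y - u (a, y) - h * G (a, y)| ≤ C1 * (h * Real.sqrt h) := fun y => by
    rw [heq]
    exact hC1 h h0 h1 _ (fun m => hσ m a) a y
  have hFM : ∀ y, |F y| ≤ C1 * (h * Real.sqrt h) + B + h * B' := fun y => by
    have e1 : F y = (F y - u (a, y) - h * G (a, y)) + u (a, y) + h * G (a, y) := by ring
    rw [e1]
    refine (abs_add_le _ _).trans (add_le_add ((abs_add_le _ _).trans
      (add_le_add (hFd y) (hB _))) ?_)
    rw [abs_mul, abs_of_pos h0]
    exact mul_le_mul_of_nonneg_left (hB' _) h0.le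
  set Ga : (Fin d → ℝ) → ℝ := fun y => G (a, y) with hGa
  have hmean : walkAvg n σ e t x a F - walkAvg n σ e t x a (fun y => u (a, y)) -
      h * walkAvg n σ e t x a Ga = walkAvg n σ e t x a
        (fun y => F y - u (a, y) - h * G (a, y)) := by
    rw [walkAvg_sub (F := fun y => F y - u (a, y)) (G := fun y => h * G (a, y))
      (M := (C1 * (h * Real.sqrt h) + B + h * B') + B) (N := h * B') (by fun_prop)
      (by fun_prop)
      (fun y => (abs_sub _ _).trans (add_le_add (hFM y) (hB _)))
      (fun y => by rw [abs_mul, abs_of_pos h0]; exact mul_le_mul_of_nonneg_left (hB' _) h0.le),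
      walkAvg_sub (F := F) (G := fun y => u (a, y)) hFc (by fun_prop) hFM (fun y => hB _)]
    congr 1
    simp only [walkAvg, gavg, hGa, integral_const_mul]
    rw [← Finset.mul_sum]
    ring
  have hA : ∀ s, a ≤ s → s < a + h → |walkAvg n σ e t x s (fun y => G (s, y)) -
      walkAvg n σ e t x a Ga| ≤ (L + L * (Real.sqrt 2 * ‖e‖ * m1)) * Real.sqrt h := by
    intro s hs1 hs2
    rw [walkAvg_cell hs1 (by rw [hb]; exact hs2) ht (F := fun y => G (s, y)) (by fun_prop)
      (fun y => hB' _), ← walkAvg_sub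
        (continuous_gavg (f := fun y => G (s, y)) (by fun_prop) (fun y => hB' _))
        (by fun_prop) (abs_gavg_le fun y => hB' _) (fun y => hB' _)]
    refine abs_walkAvg_le fun y => ?_
    have hlip : ∀ v, |G (s, y + v) - G (a, y)| ≤ L * h + L * ‖v‖ := fun v => by
      refine (hL _ _).trans ?_
      rw [← mul_add]
      refine mul_le_mul_of_nonneg_left ?_ hL0
      refine norm_prod_le_iff.2 ⟨?_, ?_⟩
      · simp only [Prod.mk_sub_mk, Real.norm_eq_abs]
        rw [abs_of_nonneg (by linarith)]
        have := norm_nonneg v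
        linarith
      · simp only [Prod.mk_sub_mk, add_sub_cancel_left]
        linarith
    refine (abs_gavg_sub_le (f := fun y => G (s, y)) (by fun_prop) (fun y => hB' _) hlip).trans ?_
    have hq : Real.sqrt (2 * (s - a)) ≤ Real.sqrt 2 * Real.sqrt h := by
      rw [← Real.sqrt_mul (by norm_num)]
      exact Real.sqrt_le_sqrt (by linarith)
    calc L * h + L * (Real.sqrt (2 * (s - a)) * ‖e‖ * m1)
        ≤ L * Real.sqrt h + L * (Real.sqrt 2 * Real.sqrt h * ‖e‖ * m1) := by gcongr
      _ = _ := by ring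
  have hint : |(∫ s in a..(a + h), walkAvg n σ e t x s fun y => G (s, y)) -
      h * walkAvg n σ e t x a Ga| ≤
        (L + L * (Real.sqrt 2 * ‖e‖ * m1)) * (h * Real.sqrt h) := by
    have e1 : (∫ s in a..(a + h), walkAvg n σ e t x s fun y => G (s, y)) -
      h * walkAvg n σ e t x a Ga = ∫ s in a..(a + h), ((walkAvg n σ e t x s fun y => G (s, y)) -
        walkAvg n σ e t x a Ga) := by
      rw [intervalIntegral.integral_sub (intervalIntegrable_walkAvg hGC.measurable hB' _ _)
        intervalIntegrable_const]
      simp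
    rw [e1]
    have e2 := intervalIntegral.norm_integral_le_of_norm_le_const_ae (a := a) (b := a + h)
      (f := fun s => (walkAvg n σ e t x s fun y => G (s, y)) - walkAvg n σ e t x a Ga)
      (C := (L + L * (Real.sqrt 2 * ‖e‖ * m1)) * Real.sqrt h) (by
        have hae : ∀ᵐ s : ℝ, s ≠ a + h := by simp [ae_iff]
        filter_upwards [hae] with s hsn hs
        rw [Set.uIoc_of_le (by linarith)] at hs
        exact hA s hs.1.le (lt_of_le_of_ne hs.2 hsn))
    rw [add_sub_cancel_left, abs_of_pos h0] at e2
    refine e2.trans (le_of_eq (by ring))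
  rw [hstep]
  have hm' : |walkAvg n σ e t x a F - walkAvg n σ e t x a (fun y => u (a, y)) -
      h * walkAvg n σ e t x a Ga| ≤ C1 * (h * Real.sqrt h) := by
    rw [hmean]; exact abs_walkAvg_le hFd
  rw [add_mul, abs_le]
  rw [abs_le] at hm' hint
  constructor <;> linarith [hm'.1, hm'.2, hint.1, hint.2]

end

section

variable {d : ℕ}

theorem exists_initial_bound (hd : 1 ≤ d) {u : ℝ × (Fin d → ℝ) → ℝ}
    (hu : ContDiff ℝ (⊤ : ℕ∞) u) (huc : HasCompactSupport u) (e : Fin d → ℝ) {S : ℝ} (hS : 0 ≤ S)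
    {σ : Fin d → ℝ → Fin d → ℝ} (hσ : ∀ m t, ‖σ m t‖ ≤ S) :
    ∃ C, 0 ≤ C ∧ ∀ (n : ℕ) (k : Fin n) (t : ℝ) (x : Fin d → ℝ), (k : ℝ) / n ≤ t →
      t < ((k : ℝ) + 1) / n →
      |walkAvg n σ e t x (((k : ℝ) + 1) / n) (fun y => u (((k : ℝ) + 1) / n, y)) - u (t, x)| ≤
        C * Real.sqrt (n : ℝ)⁻¹ := by
  obtain ⟨B, hB0, hB⟩ := exists_abs_le_of_hasCompactSupport hu.continuous huc
  obtain ⟨L, hL0, hL⟩ := exists_lipschitz_of_hasCompactSupport hu huc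
  have huC := hu.continuous
  set m1 := ∫ z : ℝ, |z| ∂gaussStd with hm1
  have hm10 : 0 ≤ m1 := integral_nonneg fun z => abs_nonneg z
  refine ⟨L * (1 + Real.sqrt (2 * d) * S) + L * (Real.sqrt 2 * ‖e‖ * m1), by positivity,
    fun n k t x h1 h2 => ?_⟩
  have hn1 : (1 : ℝ) ≤ n := by exact_mod_cast k.pos
  have hb : ((k : ℝ) + 1) / n = k / n + (n : ℝ)⁻¹ := by ring
  have hw := fun ω => walk_cell σ ω h1 h2
  have hw' := fun ω => walk_succ σ ω k
  set h := (n : ℝ)⁻¹ with hh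
  have h0 : 0 < h := inv_pos.2 (by linarith)
  have hs : h ≤ Real.sqrt h :=
    Real.le_sqrt_of_sq_le (by nlinarith [inv_le_one_of_one_le₀ hn1])
  set b := ((k : ℝ) + 1) / n with hbdef
  have hl : ∀ ω : Fin n → Fin d × Bool, |gavg e (b - t) (fun y => u (b, y))
      (x + (walk σ ω b - walk σ ω t)) - u (t, x)| ≤
      (L * (1 + Real.sqrt (2 * d) * S) + L * (Real.sqrt 2 * ‖e‖ * m1)) * Real.sqrt h := by
    intro ω
    rw [hw, hw', add_sub_cancel_left]
    set J := jump h (fun m => σ m (k / n)) (ω k) with hJ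
    have hJn : ‖J‖ ≤ Real.sqrt (2 * d) * S * Real.sqrt h := norm_jump_le (fun m => hσ m _) _
    have hlip : ∀ v, |u (b, x + J + v) - u (t, x)| ≤
        L * (h + Real.sqrt (2 * d) * S * Real.sqrt h) + L * ‖v‖ := fun v => by
      refine (hL _ _).trans ?_
      rw [← mul_add]
      refine mul_le_mul_of_nonneg_left ?_ hL0
      have hv := norm_nonneg v
      have hJ0 := norm_nonneg J
      refine norm_prod_le_iff.2 ⟨?_, ?_⟩
      · simp only [Prod.mk_sub_mk, Real.norm_eq_abs]
        rw [abs_of_nonneg (by linarith)]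
        linarith
      · simp only [Prod.mk_sub_mk, add_assoc, add_sub_cancel_left]
        linarith [norm_add_le J v]
    refine (abs_gavg_sub_le (f := fun y => u (b, y)) (by fun_prop) (fun y => hB _) hlip).trans ?_
    have hq : Real.sqrt (2 * (b - t)) ≤ Real.sqrt 2 * Real.sqrt h := by
      rw [← Real.sqrt_mul (by norm_num)]
      exact Real.sqrt_le_sqrt (by linarith)
    calc L * (h + Real.sqrt (2 * d) * S * Real.sqrt h) + L * (Real.sqrt (2 * (b - t)) * ‖e‖ * m1)
        ≤ L * (Real.sqrt h + Real.sqrt (2 * d) * S * Real.sqrt h) +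
          L * (Real.sqrt 2 * Real.sqrt h * ‖e‖ * m1) := by gcongr
      _ = _ := by ring
  have : Nonempty (Fin n → Fin d × Bool) := ⟨fun _ => (⟨0, hd⟩, true)⟩
  have hc : (0 : ℝ) < Fintype.card (Fin n → Fin d × Bool) := by exact_mod_cast Fintype.card_pos
  have e1 : walkAvg n σ e t x b (fun y => u (b, y)) - u (t, x) =
      (Fintype.card (Fin n → Fin d × Bool) : ℝ)⁻¹ * ∑ ω : Fin n → Fin d × Bool,
        (gavg e (b - t) (fun y => u (b, y)) (x + (walk σ ω b - walk σ ω t)) - u (t, x)) := by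
    unfold walkAvg
    rw [Finset.sum_sub_distrib, mul_sub]
    rw [Finset.sum_const, nsmul_eq_mul, Finset.card_univ, inv_mul_cancel_left₀ hc.ne']
  rw [e1]
  exact abs_avg_le (by positivity) hl

theorem exists_walk_bound (hd : 1 ≤ d) {u G : ℝ × (Fin d → ℝ) → ℝ}
    (hu : ContDiff ℝ (⊤ : ℕ∞) u) (huc : HasCompactSupport u)
    (hG : ContDiff ℝ (⊤ : ℕ∞) G) (hGc : HasCompactSupport G) (e : Fin d → ℝ) {S : ℝ} (hS : 0 ≤ S)
    {σ : Fin d → ℝ → Fin d → ℝ} (hσ : ∀ m t, ‖σ m t‖ ≤ S)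
    (heq : ∀ t x, G (t, x) = dd (1, 0) u (t, x) + dd (0, e) (dd (0, e) u) (t, x) +
      ∑ m, dd (0, σ m t) (dd (0, σ m t) u) (t, x))
    (hu1 : ∀ x, u (1, x) = 0) :
    ∃ C, 0 ≤ C ∧ ∀ (n : ℕ) (t : ℝ) (x : Fin d → ℝ), 0 < n → 0 ≤ t → t < 1 →
      |(∫ s in t..1, walkAvg n σ e t x s fun y => G (s, y)) + u (t, x)| ≤
        C * Real.sqrt (n : ℝ)⁻¹ := by
  obtain ⟨C1, hC10, hC1⟩ := exists_cell_bound hd hu huc hG hGc e hS hσ heq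
  obtain ⟨C2, hC20, hC2⟩ := exists_initial_bound hd hu huc e hS hσ
  obtain ⟨B, hB0, hB⟩ := exists_abs_le_of_hasCompactSupport hG.continuous hGc
  refine ⟨C1 + C2 + B, by positivity, fun n t x hn0 ht0 ht1 => ?_⟩
  have hn : (0 : ℝ) < n := by exact_mod_cast hn0
  have hn1 : (1 : ℝ) ≤ n := by exact_mod_cast hn0
  have h0 : 0 < (n : ℝ)⁻¹ := inv_pos.2 (by linarith)
  have hs : (n : ℝ)⁻¹ ≤ Real.sqrt (n : ℝ)⁻¹ :=
    Real.le_sqrt_of_sq_le (by nlinarith [inv_le_one_of_one_le₀ hn1])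
  set k0 := ⌊t * n⌋₊ with hk0
  have hk1 : (k0 : ℝ) / n ≤ t := (div_le_iff₀ hn).2 (Nat.floor_le (by positivity))
  have hk2 : t < ((k0 : ℝ) + 1) / n := (lt_div_iff₀ hn).2 (Nat.lt_floor_add_one _)
  have hk3 : k0 < n := by
    have : (k0 : ℝ) < n := by
      have := (div_le_iff₀ hn).1 hk1
      nlinarith
    exact_mod_cast this
  have hint := fun a b => intervalIntegrable_walkAvg (n := n) (σ := σ) (e := e) (t := t) (x := x)
    hG.continuous.measurable hB a b
  set W : ℝ → ℝ := fun s => walkAvg n σ e t x s fun y => G (s, y) with hW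
  set Φ : ℝ → ℝ := fun s => walkAvg n σ e t x s fun y => u (s, y) with hΦ
  have hinit : |Φ (((k0 : ℝ) + 1) / n) - u (t, x)| ≤ C2 * Real.sqrt (n : ℝ)⁻¹ :=
    hC2 n ⟨k0, hk3⟩ t x hk1 hk2
  have hind : ∀ k : ℕ, k0 + 1 ≤ k → k ≤ n →
      |Φ ((k : ℝ) / n) - Φ (((k0 : ℝ) + 1) / n) - ∫ s in (((k0 : ℝ) + 1) / n)..((k : ℝ) / n), W s| ≤
        C1 * ((n : ℝ)⁻¹ * Real.sqrt (n : ℝ)⁻¹) * k := by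
    intro k hk
    induction k, hk using Nat.le_induction with
    | base =>
      intro _
      push_cast
      simp only [sub_self, intervalIntegral.integral_same, abs_zero]
      positivity
    | succ k hk ih =>
      intro hkn
      have ih' := ih (by omega)
      have hc := hC1 n ⟨k, by omega⟩ t x (by
        refine hk2.le.trans ?_
        gcongr
        exact_mod_cast hk)
      have hadd := intervalIntegral.integral_add_adjacent_intervals
        (hint (((k0 : ℝ) + 1) / n) ((k : ℝ) / n)) (hint ((k : ℝ) / n) (((k : ℝ) + 1) / n))
      push_cast
      simp only at hc
      rw [← hadd, mul_add, mul_one]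
      change |Φ (((k : ℝ) + 1) / n) - Φ ((k : ℝ) / n) -
        ∫ s in ((k : ℝ) / n)..(((k : ℝ) + 1) / n), W s| ≤ _ at hc
      change |Φ (((k : ℝ) + 1) / n) - Φ (((k0 : ℝ) + 1) / n) -
        ((∫ s in (((k0 : ℝ) + 1) / n)..((k : ℝ) / n), W s) +
          ∫ s in ((k : ℝ) / n)..(((k : ℝ) + 1) / n), W s)| ≤ _
      rw [abs_le] at *
      constructor <;> linarith [ih'.1, ih'.2, hc.1, hc.2]
  have hfin := hind n hk3 le_rfl
  have hΦ1 : Φ 1 = 0 := by simp [hΦ, walkAvg, gavg, hu1]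
  rw [div_self hn.ne', hΦ1] at hfin
  have hcalc : C1 * ((n : ℝ)⁻¹ * Real.sqrt (n : ℝ)⁻¹) * n = C1 * Real.sqrt (n : ℝ)⁻¹ := by
    field_simp
  rw [hcalc] at hfin
  have hfirst : |∫ s in t..(((k0 : ℝ) + 1) / n), W s| ≤ B * Real.sqrt (n : ℝ)⁻¹ := by
    have := intervalIntegral.norm_integral_le_of_norm_le_const (a := t) (b := ((k0 : ℝ) + 1) / n)
      (f := W) (C := B) fun s _ => abs_walkAvg_le fun y => hB _
    rw [Real.norm_eq_abs] at this
    refine this.trans (mul_le_mul_of_nonneg_left ?_ hB0)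
    rw [abs_of_nonneg (by linarith)]
    have : ((k0 : ℝ) + 1) / n = k0 / n + (n : ℝ)⁻¹ := by ring
    linarith
  rw [← intervalIntegral.integral_add_adjacent_intervals
    (hint t (((k0 : ℝ) + 1) / n)) (hint (((k0 : ℝ) + 1) / n) 1)]
  rw [add_mul, add_mul]
  change |(∫ s in t..(((k0 : ℝ) + 1) / n), W s) + (∫ s in (((k0 : ℝ) + 1) / n)..1, W s) +
    u (t, x)| ≤ _
  rw [abs_le] at *
  constructor <;> linarith [hfin.1, hfin.2, hinit.1, hinit.2, hfirst.1, hfirst.2]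

end

section

variable {d : ℕ}

theorem intervalIntegrable_gavg_path {G : ℝ × (Fin d → ℝ) → ℝ} (hG : Measurable G) {M : ℝ}
    (hM : ∀ q, |G q| ≤ M) (e : Fin d → ℝ) {β : ℝ → Fin d → ℝ} (hβ : Measurable β) (t : ℝ)
    (x : Fin d → ℝ) (a b : ℝ) :
    IntervalIntegrable (fun s => gavg e (s - t) (fun y => G (s, y)) (x + (β s - β t)))
      volume a b := by
  have h : Measurable fun q : ℝ × ℝ =>
      G (q.1, x + (β q.1 - β t) + (Real.sqrt (2 * (q.1 - t)) * q.2) • e) := by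
    refine hG.comp ?_
    fun_prop
  rw [intervalIntegrable_iff]
  exact Measure.integrableOn_of_bounded (M := M) (by simp)
    (StronglyMeasurable.integral_prod_right' h.stronglyMeasurable).aestronglyMeasurable
    (Filter.Eventually.of_forall fun s => abs_gavg_le (f := fun y => G (s, y)) (fun y => hM _) _)

theorem pathCorr_heatCZ_eq {g : ℝ × (Fin d → ℝ) → ℝ} (hg : ContDiff ℝ (⊤ : ℕ∞) g)
    (hgc : HasCompactSupport g) (e : Fin d → ℝ) {β : ℝ → Fin d → ℝ} (hβ : Measurable β)
    {ε N : ℝ} (hε : 0 < ε) (hN : ε ≤ N) (t : ℝ) (x : Fin d → ℝ) :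
    pathCorr (heatCZ ε N) e β g (t, x) = ∫ s in (t + ε)..(t + N),
      gavg e (s - t) (fun y => dd (0, e) (dd (0, e) g) (s, y)) (x + (β s - β t)) := by
  obtain ⟨M0, -, hM0⟩ := exists_abs_le_of_hasCompactSupport hg.continuous hgc
  have hg1 := contDiff_dd ((0 : ℝ), e) hg
  have hg2 := contDiff_dd ((0 : ℝ), e) hg1
  have hgc1 := hasCompactSupport_dd ((0 : ℝ), e) hgc
  have hgc2 := hasCompactSupport_dd ((0 : ℝ), e) hgc1
  obtain ⟨M1, -, hM1⟩ := exists_abs_le_of_hasCompactSupport hg1.continuous hgc1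
  obtain ⟨M2, -, hM2⟩ := exists_abs_le_of_hasCompactSupport hg2.continuous hgc2
  set M := max M0 (max M1 M2)
  have hgm := hg.continuous.measurable
  have hint : Integrable (fun w : ℝ × ℝ => heatCZ ε N w *
      g (t + w.1, x + w.2 • e + (β (t + w.1) - β t))) (volume.prod volume) := by
    rw [← Measure.volume_eq_prod]
    refine (integrable_heatCZ hε N).mul_bdd (c := M0) (Measurable.aestronglyMeasurable ?_)
      (Filter.Eventually.of_forall fun w => hM0 _)
    exact hgm.comp (by fun_prop)
  have hinner : ∀ r, ∫ y, heatCZ ε N (r, y) * g (t + r, x + y • e + (β (t + r) - β t)) =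
      (Set.Ioo ε N).indicator (fun r => gavg e (t + r - t)
        (fun y => dd (0, e) (dd (0, e) g) (t + r, y)) (x + (β (t + r) - β t))) r := by
    intro r
    by_cases hr : r ∈ Set.Ioo ε N
    · simp only [heatCZ, Set.indicator_of_mem hr]
      set p : ℝ × (Fin d → ℝ) := (t + r, x + (β (t + r) - β t)) with hp
      have hline : ∀ y : ℝ, (t + r, x + y • e + (β (t + r) - β t)) = p + y • ((0 : ℝ), e) :=
        fun y => by
          simp only [hp, Prod.smul_mk, smul_zero, Prod.mk_add_mk, add_zero, Prod.mk.injEq,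
            true_and]
          abel
      simp only [hline]
      rw [integral_heat2_mul (hε.trans hr.1) (M := M) (hasDerivAt_dd_line hg p _)
        (hasDerivAt_dd_line hg1 p _) (by have := hg2.continuous; fun_prop)
        (fun y => (hM0 _).trans (le_max_left _ _))
        (fun y => (hM1 _).trans ((le_max_left _ _).trans (le_max_right _ _)))
        (fun y => (hM2 _).trans ((le_max_right _ _).trans (le_max_right _ _)))]
      unfold gavg
      simp [hp]
    · simp [heatCZ, Set.indicator_of_notMem hr]
  unfold pathCorr
  rw [Measure.volume_eq_prod, integral_prod _ hint]
  simp only [hinner]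
  rw [integral_indicator measurableSet_Ioo, ← integral_Ioc_eq_integral_Ioo,
    ← intervalIntegral.integral_of_le hN, ← intervalIntegral.integral_comp_add_left
      (fun s => gavg e (s - t) (fun y => dd (0, e) (dd (0, e) g) (s, y)) (x + (β s - β t)))]

theorem avg_pathCorr_heatCZ_eq {n : ℕ} {g : ℝ × (Fin d → ℝ) → ℝ} (hg : ContDiff ℝ (⊤ : ℕ∞) g)
    (hgc : HasCompactSupport g) (e : Fin d → ℝ) (σ : Fin d → ℝ → Fin d → ℝ)
    {ε N : ℝ} (hε : 0 < ε) (hN : ε ≤ N) (t : ℝ) (x : Fin d → ℝ) :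
    (Fintype.card (Fin n → Fin d × Bool) : ℝ)⁻¹ * ∑ ω : Fin n → Fin d × Bool,
      pathCorr (heatCZ ε N) e (walk σ ω) g (t, x) = ∫ s in (t + ε)..(t + N),
        walkAvg n σ e t x s fun y => dd (0, e) (dd (0, e) g) (s, y) := by
  have hg2 := contDiff_dd ((0 : ℝ), e) (contDiff_dd ((0 : ℝ), e) hg)
  obtain ⟨M, -, hM⟩ := exists_abs_le_of_hasCompactSupport hg2.continuous
    (hasCompactSupport_dd ((0 : ℝ), e) (hasCompactSupport_dd ((0 : ℝ), e) hgc))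
  unfold walkAvg
  rw [intervalIntegral.integral_const_mul, intervalIntegral.integral_finsetSum]
  · congr 1
    exact Finset.sum_congr rfl fun ω _ =>
      pathCorr_heatCZ_eq hg hgc e (measurable_walk σ ω) hε hN t x
  · exact fun ω _ => intervalIntegrable_gavg_path hg2.continuous.measurable hM e
      (measurable_walk σ ω) t x _ _

theorem dd_slice_eq_zero (e : Fin d → ℝ) {f : ℝ × (Fin d → ℝ) → ℝ} (hf : ContDiff ℝ (⊤ : ℕ∞) f)
    {s : ℝ} (h0 : ∀ y, f (s, y) = 0) (y : Fin d → ℝ) : dd (0, e) f (s, y) = 0 := by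
  have h := hasDerivAt_dd_line hf (s, y) ((0 : ℝ), e) 0
  have hz : (fun r : ℝ => f ((s, y) + r • ((0 : ℝ), e))) = fun _ => 0 := by
    ext r; simp [h0]
  rw [hz] at h
  simpa using h.unique (hasDerivAt_const _ _)

/-- Averaging the singular integrals along the random walks recovers the second derivative of
the solution of the parabolic equation. -/
theorem tendsto_avg_pathCorr (hd : 1 ≤ d) {u g : ℝ × (Fin d → ℝ) → ℝ}
    (hu : ContDiff ℝ (⊤ : ℕ∞) u) (huc : HasCompactSupport u)
    (hg : ContDiff ℝ (⊤ : ℕ∞) g) (hgc : HasCompactSupport g) (e : Fin d → ℝ) {S : ℝ} (hS : 0 ≤ S)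
    {σ : Fin d → ℝ → Fin d → ℝ} (hσ : ∀ m t, ‖σ m t‖ ≤ S)
    (heq : ∀ t x, dd (0, e) (dd (0, e) g) (t, x) =
      dd (1, 0) u (t, x) + dd (0, e) (dd (0, e) u) (t, x) +
      ∑ m, dd (0, σ m t) (dd (0, σ m t) u) (t, x))
    (hu1 : ∀ x, u (1, x) = 0) (hg1 : ∀ t, 1 ≤ t → ∀ x, g (t, x) = 0)
    {t : ℝ} (ht0 : 0 ≤ t) (ht1 : t < 1) (x : Fin d → ℝ) :
    Filter.Tendsto (fun n : ℕ => (Fintype.card (Fin n → Fin d × Bool) : ℝ)⁻¹ *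
      ∑ ω : Fin n → Fin d × Bool, pathCorr (heatCZ (n : ℝ)⁻¹ 2) e (walk σ ω) g (t, x))
      Filter.atTop (nhds (-u (t, x))) := by
  have hg2 := contDiff_dd ((0 : ℝ), e) (contDiff_dd ((0 : ℝ), e) hg)
  have hgc2 := hasCompactSupport_dd ((0 : ℝ), e) (hasCompactSupport_dd ((0 : ℝ), e) hgc)
  obtain ⟨M, hM0, hM⟩ := exists_abs_le_of_hasCompactSupport hg2.continuous hgc2
  obtain ⟨C, hC0, hC⟩ := exists_walk_bound hd hu huc hg2 hgc2 e hS hσ heq hu1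
  have hG1 : ∀ s, 1 ≤ s → ∀ y, dd (0, e) (dd (0, e) g) (s, y) = 0 := by
    intro s hs
    have hg1s := dd_slice_eq_zero e hg (hg1 s hs)
    exact dd_slice_eq_zero e (contDiff_dd _ hg) hg1s
  have hsq : Filter.Tendsto (fun n : ℕ => (C + M) * Real.sqrt (n : ℝ)⁻¹) Filter.atTop
      (nhds 0) := by
    have h := (Real.continuous_sqrt.tendsto 0).comp (tendsto_inv_atTop_nhds_zero_nat (𝕜 := ℝ))
    simpa using h.const_mul (C + M)
  rw [tendsto_iff_norm_sub_tendsto_zero]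
  refine squeeze_zero' (Filter.Eventually.of_forall fun n => norm_nonneg _) ?_ hsq
  filter_upwards [Filter.eventually_gt_atTop 0] with n hn0
  have hn1 : (1 : ℝ) ≤ n := by exact_mod_cast hn0
  have h0 : 0 < (n : ℝ)⁻¹ := inv_pos.2 (by linarith)
  have h1 : (n : ℝ)⁻¹ ≤ 1 := inv_le_one_of_one_le₀ hn1
  have hs : (n : ℝ)⁻¹ ≤ Real.sqrt (n : ℝ)⁻¹ := Real.le_sqrt_of_sq_le (by nlinarith)
  rw [avg_pathCorr_heatCZ_eq hg hgc e σ h0 (by linarith)]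
  set W : ℝ → ℝ := fun s => walkAvg n σ e t x s fun y => dd (0, e) (dd (0, e) g) (s, y) with hW
  have hint := fun a b => intervalIntegrable_walkAvg (n := n) (σ := σ) (e := e) (t := t) (x := x)
    hg2.continuous.measurable hM a b
  have hW1 : ∀ s, 1 ≤ s → W s = 0 := fun s hs => by
    simp [hW, walkAvg, gavg, hG1 s hs]
  have htail : ∫ s in (1 : ℝ)..(t + 2), W s = 0 := by
    rw [intervalIntegral.integral_congr (g := fun _ => (0 : ℝ)) fun s hs => hW1 s ?_]
    · simp
    · rw [Set.uIcc_of_le (by linarith)] at hs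
      exact hs.1
  have hfirst : |∫ s in t..(t + (n : ℝ)⁻¹), W s| ≤ M * Real.sqrt (n : ℝ)⁻¹ := by
    have := intervalIntegral.norm_integral_le_of_norm_le_const (a := t) (b := t + (n : ℝ)⁻¹)
      (f := W) (C := M) fun s _ => abs_walkAvg_le fun y => hM _
    rw [Real.norm_eq_abs, add_sub_cancel_left, abs_of_pos h0] at this
    exact this.trans (mul_le_mul_of_nonneg_left hs hM0)
  have hadd1 := intervalIntegral.integral_add_adjacent_intervals
    (hint t (t + (n : ℝ)⁻¹)) (hint (t + (n : ℝ)⁻¹) (t + 2))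
  have hadd2 := intervalIntegral.integral_add_adjacent_intervals (hint t 1) (hint 1 (t + 2))
  have hmain := hC n t x hn0 ht0 ht1
  rw [Real.norm_eq_abs, add_mul]
  rw [abs_le] at *
  simp only [hW] at hadd1 hadd2 htail hfirst ⊢
  constructor <;> linarith [hmain.1, hmain.2, hfirst.1, hfirst.2]

end

section

variable {d : ℕ}

theorem eLpNorm_avg_le {α ι : Type*} [MeasurableSpace α] {μ : Measure α} [Fintype ι]
    {p B : ℝ≥0∞} (hp : 1 ≤ p) {f : ι → α → ℝ} (hf : ∀ i, AEStronglyMeasurable (f i) μ)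
    (hB : ∀ i, eLpNorm (f i) p μ ≤ B) :
    eLpNorm (fun x => (Fintype.card ι : ℝ)⁻¹ * ∑ i, f i x) p μ ≤ B := by
  have h1 : (fun x => (Fintype.card ι : ℝ)⁻¹ * ∑ i, f i x) =
      (Fintype.card ι : ℝ)⁻¹ • ∑ i, f i := by
    ext x; simp
  rw [h1, eLpNorm_const_smul]
  rcases isEmpty_or_nonempty ι with h | h
  · simp
  have h2 : eLpNorm (∑ i, f i) p μ ≤ Fintype.card ι * B := by
    refine (eLpNorm_sum_le (fun i _ => hf i) hp).trans
      ((Finset.sum_le_sum fun i _ => hB i).trans ?_)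
    simp
  have hc : (Fintype.card ι : ℝ≥0∞) ≠ 0 := by exact_mod_cast Fintype.card_ne_zero
  calc _ ≤ ‖(Fintype.card ι : ℝ)⁻¹‖ₑ * (Fintype.card ι * B) := by gcongr
    _ = B := by
      rw [← mul_assoc, enorm_inv (by exact_mod_cast Fintype.card_ne_zero), Real.enorm_natCast,
        ENNReal.inv_mul_cancel hc (by simp), one_mul]

theorem parabolic_eq_dd {v g : ℝ × (Fin d → ℝ) → ℝ}
    (hv : ContDiff ℝ (⊤ : ℕ∞) v) (hg : ContDiff ℝ (⊤ : ℕ∞) g) (e a : Fin d → ℝ)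
    {σ : Fin d → ℝ → Fin d → ℝ}
    (heq : ∀ t x, g (t, x) = dd (1, 0) v (t, x) + dd (0, a) (dd (0, a) v) (t, x) +
      ∑ m, dd (0, σ m t) (dd (0, σ m t) v) (t, x)) (t : ℝ) (x : Fin d → ℝ) :
    dd (0, e) g (t, x) = dd (1, 0) (dd (0, e) v) (t, x) +
      dd (0, a) (dd (0, a) (dd (0, e) v)) (t, x) +
      ∑ m, dd (0, σ m t) (dd (0, σ m t) (dd (0, e) v)) (t, x) := by
  have hl := hasDerivAt_dd_line hg (t, x) ((0 : ℝ), e) 0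
  have h1 := hasDerivAt_dd_line (contDiff_dd ((1 : ℝ), (0 : Fin d → ℝ)) hv) (t, x) ((0 : ℝ), e) 0
  have h2 := fun a : Fin d → ℝ => hasDerivAt_dd_line
    (contDiff_dd ((0 : ℝ), a) (contDiff_dd ((0 : ℝ), a) hv)) (t, x) ((0 : ℝ), e) 0
  have h3 := (h1.fun_add (h2 a)).fun_add
    (HasDerivAt.fun_sum (u := Finset.univ) fun m _ => h2 (σ m t))
  have hfun : (fun s : ℝ => g ((t, x) + s • ((0 : ℝ), e))) = fun s : ℝ =>
      dd (1, 0) v ((t, x) + s • ((0 : ℝ), e)) +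
      dd (0, a) (dd (0, a) v) ((t, x) + s • ((0 : ℝ), e)) +
      ∑ m, dd (0, σ m t) (dd (0, σ m t) v) ((t, x) + s • ((0 : ℝ), e)) := by
    ext s
    have := heq t (x + s • e)
    simpa using this
  rw [hfun] at hl
  have h := hl.unique h3
  simp only [zero_smul, add_zero] at h
  have hcomm : ∀ a : Fin d → ℝ, dd ((0 : ℝ), e) (dd (0, a) (dd (0, a) v)) =
      dd (0, a) (dd (0, a) (dd (0, e) v)) := fun a => by
    rw [dd_comm (contDiff_dd _ hv), dd_comm hv]
  rw [h, dd_comm hv]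
  simp only [hcomm]

/-- `L^p` bound for the second derivative in direction `e` of solutions of parabolic equations
whose (time dependent) second order part dominates `∂ₑ²`. -/
theorem exists_eLpNorm_dd_dd_le {p : ℝ} (hp : 1 < p) : ∃ C : NNReal, ∀ (d : ℕ), 1 ≤ d →
    ∀ (v g : ℝ × (Fin d → ℝ) → ℝ), ContDiff ℝ (⊤ : ℕ∞) v → HasCompactSupport v →
    ContDiff ℝ (⊤ : ℕ∞) g → HasCompactSupport g → ∀ (e : Fin d → ℝ), e ≠ 0 →
    ∀ (S : ℝ) (σ : Fin d → ℝ → Fin d → ℝ), (∀ m t, ‖σ m t‖ ≤ S) →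
    (∀ t x, g (t, x) = dd (1, 0) v (t, x) + dd (0, e) (dd (0, e) v) (t, x) +
      ∑ m, dd (0, σ m t) (dd (0, σ m t) v) (t, x)) →
    (∀ t ∉ Set.Ioo (0 : ℝ) 1, ∀ x, v (t, x) = 0) →
    (∀ t ∉ Set.Ioo (0 : ℝ) 1, ∀ x, g (t, x) = 0) →
    eLpNorm (dd (0, e) (dd (0, e) v)) (ENNReal.ofReal p) volume ≤
      C * eLpNorm g (ENNReal.ofReal p) volume := by
  obtain ⟨C, hC⟩ := exists_eLpNorm_corr_heatCZ_le hp
  refine ⟨C, fun d hd v g hv hvc hg hgc e he S σ hσ heq hv0 hg0 => ?_⟩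
  obtain ⟨M, hM0, hM⟩ := exists_abs_le_of_hasCompactSupport hg.continuous hgc
  have hS : 0 ≤ S := (norm_nonneg _).trans (hσ ⟨0, hd⟩ 0)
  have hv1 := contDiff_dd ((0 : ℝ), e) hv
  have hv2 := contDiff_dd ((0 : ℝ), e) hv1
  set u := dd (0, e) (dd (0, e) v) with hu
  have hu0 : ∀ t ∉ Set.Ioo (0 : ℝ) 1, ∀ x, u (t, x) = 0 := fun t ht =>
    dd_slice_eq_zero e hv1 (dd_slice_eq_zero e hv (hv0 t ht))
  have heq2 := parabolic_eq_dd hv1 (contDiff_dd ((0 : ℝ), e) hg) e e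
    (parabolic_eq_dd hv hg e e heq)
  set F : ℕ → ℝ × (Fin d → ℝ) → ℝ := fun n q =>
    (Fintype.card (Fin (n + 1) → Fin d × Bool) : ℝ)⁻¹ * ∑ ω : Fin (n + 1) → Fin d × Bool,
      pathCorr (heatCZ ((n + 1 : ℕ) : ℝ)⁻¹ 2) e (walk σ ω) g q with hF
  have hpm : ∀ n (ω : Fin (n + 1) → Fin d × Bool),
      Measurable (pathCorr (heatCZ ((n + 1 : ℕ) : ℝ)⁻¹ 2) e (walk σ ω) g) := fun n ω =>
    measurable_pathCorr (measurable_heatCZ _ _) (measurable_walk σ ω) hg.continuous.measurable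
  have hFm : ∀ n, Measurable (F n) := fun n =>
    (Finset.measurable_sum _ fun ω _ => hpm n ω).const_mul _
  have hFC : ∀ n, eLpNorm (F n) (ENNReal.ofReal p) volume ≤
      C * eLpNorm g (ENNReal.ofReal p) volume := by
    intro n
    have hn : (1 : ℝ) ≤ ((n + 1 : ℕ) : ℝ) := by push_cast; linarith [n.cast_nonneg (α := ℝ)]
    refine eLpNorm_avg_le (by rw [← ENNReal.ofReal_one]; exact ENNReal.ofReal_le_ofReal hp.le)
      (fun ω => (hpm n ω).aestronglyMeasurable) fun ω => ?_
    refine eLpNorm_pathCorr_le hp (measurable_heatCZ _ _) (fun f hf B hB => ?_) he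
      (measurable_walk σ ω) hg.continuous.measurable hM
    exact hC _ _ (by positivity) ((inv_le_one_of_one_le₀ hn).trans (by norm_num)) f hf B hB
  set A : Set (ℝ × (Fin d → ℝ)) := Set.Ico (0 : ℝ) 1 ×ˢ Set.univ with hA
  have hAm : MeasurableSet A := measurableSet_Ico.prod MeasurableSet.univ
  have hlim : ∀ q, Filter.Tendsto (fun n => A.indicator (F n) q) Filter.atTop
      (nhds (-u q)) := by
    rintro ⟨t, x⟩
    by_cases ht : t ∈ Set.Ico (0 : ℝ) 1
    · have hq : (t, x) ∈ A := ⟨ht, trivial⟩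
      simp only [Set.indicator_of_mem hq]
      exact (tendsto_avg_pathCorr hd hv2 (hasCompactSupport_dd _ (hasCompactSupport_dd _ hvc))
        hg hgc e hS hσ heq2 (hu0 1 (by simp))
        (fun s hs => hg0 s (by simp [hs])) ht.1 ht.2 x).comp (Filter.tendsto_add_atTop_nat 1)
    · have hq : (t, x) ∉ A := fun h => ht h.1
      simp only [Set.indicator_of_notMem hq]
      rw [hu0 t (fun h => ht ⟨h.1.le, h.2⟩)]
      simp
  have hfat := Lp.eLpNorm_lim_le_liminf_eLpNorm (p := ENNReal.ofReal p) (μ := volume)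
    (fun n => ((hFm n).indicator hAm).aestronglyMeasurable) (fun q => -u q)
    (Filter.Eventually.of_forall hlim)
  have hneg : eLpNorm (fun q => -u q) (ENNReal.ofReal p) volume =
      eLpNorm u (ENNReal.ofReal p) volume := eLpNorm_neg u _ _
  rw [hneg] at hfat
  refine hfat.trans (Filter.liminf_le_of_le (by isBoundedDefault) fun b hb => ?_)
  obtain ⟨n, hn⟩ := hb.exists
  exact hn.trans ((eLpNorm_indicator_le _).trans (hFC n))

end

section

theorem dd_slice {E : Type*} [NormedAddCommGroup E] [NormedSpace ℝ E] {φ : E → ℝ}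
    {u : ℝ × E → ℝ} (hu : ContDiff ℝ (⊤ : ℕ∞) u) {t c : ℝ} {T : E →L[ℝ] E}
    (hφ : ContDiff ℝ (⊤ : ℕ∞) φ) (h : ∀ x, u (t, x) = c * φ (T x)) (a x : E) :
    dd (0, a) u (t, x) = c * dd (T a) φ (T x) := by
  have h1 := hasDerivAt_dd_line hu (t, x) ((0 : ℝ), a) 0
  have h2 := (hasDerivAt_dd_line hφ (T x) (T a) 0).const_mul c
  have hf : (fun s : ℝ => u ((t, x) + s • ((0 : ℝ), a))) = fun s => c * φ (T x + s • T a) := by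
    ext s
    rw [← map_smul, ← map_add, ← h]
    simp
  rw [hf] at h1
  simpa using h1.unique h2

section LinearFlow
variable {E : Type*} [NormedAddCommGroup E] [NormedSpace ℝ E] [FiniteDimensional ℝ E]

/-- The flow of the linear vector field `L`. -/
noncomputable def linFlow (L : E →L[ℝ] E) (t : ℝ) : E →L[ℝ] E := NormedSpace.exp (t • L)

theorem contDiff_linFlow (L : E →L[ℝ] E) : ContDiff ℝ (⊤ : ℕ∞) (linFlow L) := by
  refine ContDiff.comp (g := NormedSpace.exp) ?_ (by fun_prop)
  exact contDiff_iff_contDiffAt.2 fun x => (NormedSpace.exp_analytic (𝕂 := ℝ) x).contDiffAt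

theorem hasDerivAt_linFlow (L : E →L[ℝ] E) (t : ℝ) :
    HasDerivAt (linFlow L) (L * linFlow L t) t := hasDerivAt_exp_smul_const' L t

theorem linFlow_neg_mul (L : E →L[ℝ] E) (t : ℝ) : linFlow L (-t) * linFlow L t = 1 := by
  let _ : NormedAlgebra ℚ (E →L[ℝ] E) := NormedAlgebra.restrictScalars ℚ ℝ (E →L[ℝ] E)
  unfold linFlow
  rw [← NormedSpace.exp_add_of_commute, ← add_smul]
  · simp
  · exact ((Commute.refl L).smul_left _).smul_right _

theorem linFlow_neg_apply (L : E →L[ℝ] E) (t : ℝ) (x : E) :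
    linFlow L (-t) (linFlow L t x) = x := by
  rw [← mul_apply_eq_comp, linFlow_neg_mul]; rfl

theorem linFlow_apply_neg (L : E →L[ℝ] E) (t : ℝ) (x : E) :
    linFlow L t (linFlow L (-t) x) = x := by
  simpa using linFlow_neg_apply L (-t) x

theorem exists_norm_linFlow_le (L : E →L[ℝ] E) :
    ∃ K, 1 ≤ K ∧ ∀ t ∈ Set.Icc (-1 : ℝ) 1, ‖linFlow L t‖ ≤ K := by
  obtain ⟨K, hK⟩ := (isCompact_Icc (a := (-1 : ℝ)) (b := 1)).exists_bound_of_continuousOn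
    (contDiff_linFlow L).continuous.continuousOn
  exact ⟨max K 1, le_max_right _ _, fun t ht => (hK t ht).trans (le_max_left _ _)⟩

/-- The function `φ` transported along the flow of `L`, with a time cutoff `η`. -/
noncomputable def flowLift (L : E →L[ℝ] E) (η : ℝ → ℝ) (φ : E → ℝ) (q : ℝ × E) : ℝ :=
  η q.1 * φ (linFlow L q.1 q.2)

variable {L : E →L[ℝ] E} {η : ℝ → ℝ} {φ : E → ℝ}

theorem contDiff_flowLift (hη : ContDiff ℝ (⊤ : ℕ∞) η) (hφ : ContDiff ℝ (⊤ : ℕ∞) φ) :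
    ContDiff ℝ (⊤ : ℕ∞) (flowLift L η φ) :=
  (hη.comp contDiff_fst).mul
    (hφ.comp (((contDiff_linFlow L).comp contDiff_fst).clm_apply contDiff_snd))

theorem hasCompactSupport_flowLift (hη : ∀ t ∉ Set.Ioo (0 : ℝ) 1, η t = 0)
    (hφ : HasCompactSupport φ) : HasCompactSupport (flowLift L η φ) := by
  obtain ⟨K, hK1, hK⟩ := exists_norm_linFlow_le L
  obtain ⟨R, hR⟩ := hφ.isCompact.isBounded.subset_closedBall 0
  refine HasCompactSupport.intro (K := Set.Icc (0 : ℝ) 1 ×ˢ Metric.closedBall 0 (K * R))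
    (isCompact_Icc.prod (isCompact_closedBall _ _)) fun q hq => ?_
  by_contra h
  obtain ⟨h1, h2⟩ := mul_ne_zero_iff.1 h
  have ht : q.1 ∈ Set.Ioo (0 : ℝ) 1 := by
    by_contra hn; exact h1 (hη _ hn)
  refine hq ⟨Set.Ioo_subset_Icc_self ht, ?_⟩
  have h3 := hR (subset_tsupport φ h2)
  rw [mem_closedBall_zero_iff] at h3 ⊢
  calc ‖q.2‖ = ‖linFlow L (-q.1) (linFlow L q.1 q.2)‖ := by rw [linFlow_neg_apply]
    _ ≤ ‖linFlow L (-q.1)‖ * ‖linFlow L q.1 q.2‖ := ContinuousLinearMap.le_opNorm _ _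
    _ ≤ K * R := by
      gcongr
      exact hK _ ⟨by linarith [ht.2], by linarith [ht.1]⟩

theorem dd_dd_flowLift (hη : ContDiff ℝ (⊤ : ℕ∞) η) (hφ : ContDiff ℝ (⊤ : ℕ∞) φ) (a b : E)
    (t : ℝ) (x : E) : dd (0, a) (dd (0, b) (flowLift L η φ)) (t, x) =
      η t * dd (linFlow L t a) (dd (linFlow L t b) φ) (linFlow L t x) :=
  dd_slice (contDiff_dd _ (contDiff_flowLift hη hφ)) (contDiff_dd _ hφ)
    (dd_slice (contDiff_flowLift hη hφ) hφ (fun _ => rfl) b) a x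

theorem dd_time_flowLift (hη : ContDiff ℝ (⊤ : ℕ∞) η) (hφ : ContDiff ℝ (⊤ : ℕ∞) φ)
    (t : ℝ) (x : E) : dd (1, 0) (flowLift L η φ) (t, x) =
      deriv η t * φ (linFlow L t x) +
        η t * dd (L (linFlow L t x)) φ (linFlow L t x) := by
  have h1 := hasDerivAt_dd_line (contDiff_flowLift (L := L) hη hφ) (t, x) ((1 : ℝ), (0 : E)) 0
  have hη' : HasDerivAt η (deriv η t) t := (hη.differentiable (by simp) t).hasDerivAt
  have hE : HasDerivAt (fun s => linFlow L s x) (L (linFlow L t x)) t := by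
    simpa using (hasDerivAt_linFlow L t).clm_apply (hasDerivAt_const t x)
  have hφ' : HasDerivAt (fun s => φ (linFlow L s x)) (dd (L (linFlow L t x)) φ (linFlow L t x)) t :=
    (hφ.differentiable (by simp) _).hasFDerivAt.comp_hasDerivAt t hE
  have h2 := (hη'.mul hφ').scomp_of_eq (0 : ℝ) (h := fun s => t + s)
    ((hasDerivAt_id (0 : ℝ)).const_add t) (by simp)
  have hf : (fun s : ℝ => flowLift L η φ ((t, x) + s • ((1 : ℝ), (0 : E)))) =
      (η * fun s => φ (linFlow L s x)) ∘ fun s => t + s := by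
    ext s; simp [flowLift]
  rw [hf] at h1
  simpa using h1.unique h2

end LinearFlow

end

section

section
open scoped MatrixOrder

theorem exists_eq_sum_mul_of_posSemidef {d : ℕ} {M : Matrix (Fin d) (Fin d) ℝ}
    (hM : M.PosSemidef) : ∃ ρ : Fin d → Fin d → ℝ, ∀ i j, M i j = ∑ m, ρ m i * ρ m j := by
  obtain ⟨B, h1, h2⟩ : ∃ B : Matrix (Fin d) (Fin d) ℝ, B * B = M ∧ B.IsHermitian :=
    ⟨CFC.sqrt M, CFC.sqrt_mul_sqrt_self M hM.nonneg,
      (Matrix.nonneg_iff_posSemidef.1 (CFC.sqrt_nonneg M)).isHermitian⟩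
  refine ⟨B, fun i j => ?_⟩
  conv_lhs => rw [← h1, Matrix.mul_apply]
  refine Finset.sum_congr rfl fun m _ => ?_
  rw [← h2.apply m i]
  simp

end

variable {d : ℕ}

theorem exists_sum_squares_decomposition {Q : Matrix (Fin d) (Fin d) ℝ} (hQ : Q.IsSymm) {lam : ℝ}
    (hlam : ∀ ξ : Fin d → ℝ, lam * ∑ k, ξ k ^ 2 ≤ ∑ i, ∑ j, Q i j * ξ i * ξ j) {f : Fin d → ℝ}
    (hf : ∑ k, f k ^ 2 ≤ lam) :
    ∃ ρ : Fin d → Fin d → ℝ, (∀ i j, Q i j = f i * f j + ∑ m, ρ m i * ρ m j) ∧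
      ∀ m, ‖ρ m‖ ≤ ∑ k, Real.sqrt (Q k k) := by
  have hpsd : (Q - Matrix.vecMulVec f f).PosSemidef := by
    refine Matrix.PosSemidef.of_dotProduct_mulVec_nonneg ?_ fun ξ => ?_
    · ext i j
      simp [Matrix.vecMulVec_apply, mul_comm, hQ.apply]
    · have h1 : star ξ ⬝ᵥ (Q - Matrix.vecMulVec f f).mulVec ξ =
          (∑ i, ∑ j, Q i j * ξ i * ξ j) - (∑ i, f i * ξ i) ^ 2 := by
        rw [pow_two, Finset.sum_mul_sum, ← Finset.sum_sub_distrib]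
        simp only [dotProduct, Matrix.mulVec, Matrix.sub_apply, Matrix.vecMulVec_apply,
          Finset.mul_sum, ← Finset.sum_sub_distrib, star_trivial]
        exact Finset.sum_congr rfl fun i _ => Finset.sum_congr rfl fun j _ => by ring
      rw [h1, sub_nonneg]
      refine (Finset.sum_mul_sq_le_sq_mul_sq _ _ _).trans (le_trans ?_ (hlam ξ))
      exact mul_le_mul_of_nonneg_right hf (Finset.sum_nonneg fun k _ => sq_nonneg _)
  obtain ⟨ρ, hρ⟩ := exists_eq_sum_mul_of_posSemidef hpsd
  have hρ' : ∀ i j, Q i j = f i * f j + ∑ m, ρ m i * ρ m j := fun i j => by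
    rw [← hρ]; simp [Matrix.vecMulVec_apply]
  refine ⟨ρ, hρ', fun m => ?_⟩
  refine (pi_norm_le_iff_of_nonneg (Finset.sum_nonneg fun k _ => Real.sqrt_nonneg _)).2 fun k => ?_
  refine le_trans ?_ (Finset.single_le_sum (f := fun k => Real.sqrt (Q k k))
    (fun k _ => Real.sqrt_nonneg _) (Finset.mem_univ k))
  rw [Real.norm_eq_abs]
  refine Real.abs_le_sqrt ?_
  have h2 := Finset.single_le_sum (f := fun m => ρ m k * ρ m k)
    (fun m _ => mul_self_nonneg _) (Finset.mem_univ m)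
  rw [hρ' k k, pow_two]
  have := mul_self_nonneg (f k)
  linarith

theorem dd_dd_sum_smul {E ι : Type*} [NormedAddCommGroup E] [NormedSpace ℝ E] [Fintype ι]
    {φ : E → ℝ} (hφ : ContDiff ℝ (⊤ : ℕ∞) φ) (a b : ι → ℝ) (V : ι → E) (x : E) :
    dd (∑ i, a i • V i) (dd (∑ i, b i • V i) φ) x =
      ∑ i, ∑ j, a i * b j * dd (V i) (dd (V j) φ) x := by
  simp only [dd_dd hφ, map_sum, map_smul, sum_apply, smul_apply, smul_eq_mul, Finset.mul_sum]
  rw [Finset.sum_comm]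
  exact Finset.sum_congr rfl fun i _ => Finset.sum_congr rfl fun j _ => by ring

theorem sum_smul_single (a : Fin d → ℝ) : ∑ i, a i • (Pi.single i 1 : Fin d → ℝ) = a := by
  ext k; simp [Finset.sum_apply, Pi.single_apply]

theorem dd_dd_eq_sum {φ : (Fin d → ℝ) → ℝ} (hφ : ContDiff ℝ (⊤ : ℕ∞) φ) (a b x : Fin d → ℝ) :
    dd a (dd b φ) x = ∑ i, ∑ j, a i * b j * dd (Pi.single i 1) (dd (Pi.single j 1) φ) x := by
  rw [← dd_dd_sum_smul hφ, sum_smul_single, sum_smul_single]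

theorem dd_eq_sum {φ : (Fin d → ℝ) → ℝ} (a x : Fin d → ℝ) :
    dd a φ x = ∑ i, a i * dd (Pi.single i 1) φ x := by
  unfold dd
  conv_lhs => rw [← sum_smul_single a]
  simp only [map_sum, map_smul, smul_eq_mul]

theorem sum_mul_dd_dd_eq {φ : (Fin d → ℝ) → ℝ} (hφ : ContDiff ℝ (⊤ : ℕ∞) φ)
    {Q : Matrix (Fin d) (Fin d) ℝ} {f : Fin d → ℝ} {ρ : Fin d → Fin d → ℝ}
    (hρ : ∀ i j, Q i j = f i * f j + ∑ m, ρ m i * ρ m j) (x : Fin d → ℝ) :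
    ∑ i, ∑ j, Q i j * dd (Pi.single i 1) (dd (Pi.single j 1) φ) x =
      dd f (dd f φ) x + ∑ m, dd (ρ m) (dd (ρ m) φ) x := by
  simp only [hρ, dd_dd_eq_sum hφ f f, dd_dd_eq_sum hφ (ρ _) (ρ _), add_mul, Finset.sum_mul,
    Finset.sum_add_distrib]
  congr 1
  calc _ = ∑ i, ∑ m, ∑ j, ρ m i * ρ m j * dd (Pi.single i 1) (dd (Pi.single j 1) φ) x :=
        Finset.sum_congr rfl fun i _ => Finset.sum_comm
    _ = _ := Finset.sum_comm

end

section

section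
variable {E : Type*} [NormedAddCommGroup E] [NormedSpace ℝ E] [FiniteDimensional ℝ E]

theorem det_linFlow_ne_zero (L : E →L[ℝ] E) (t : ℝ) : (linFlow L t).det ≠ 0 := by
  have h := congrArg ContinuousLinearMap.det (linFlow_neg_mul L t)
  have h2 : (linFlow L (-t) * linFlow L t).det = (linFlow L (-t)).det * (linFlow L t).det :=
    LinearMap.det_comp _ _
  have h3 : (1 : E →L[ℝ] E).det = 1 := LinearMap.det_id
  rw [h2, h3] at h
  exact right_ne_zero_of_mul_eq_one h

variable [MeasurableSpace E] [BorelSpace E] {μ : Measure E} [μ.IsAddHaarMeasure]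

theorem lintegral_comp_linFlow (L : E →L[ℝ] E) (t : ℝ) {f : E → ℝ≥0∞} (hf : Measurable f) :
    ∫⁻ x, f (linFlow L t x) ∂μ = ENNReal.ofReal |(linFlow L t).det⁻¹| * ∫⁻ x, f x ∂μ := by
  have h := Measure.map_linearMap_addHaar_eq_smul_addHaar μ (f := (linFlow L t : E →ₗ[ℝ] E))
    (det_linFlow_ne_zero L t)
  have h2 : ∫⁻ x, f (linFlow L t x) ∂μ = ∫⁻ x, f x ∂(μ.map (linFlow L t : E →ₗ[ℝ] E)) :=
    (lintegral_map hf (linFlow L t).continuous.measurable).symm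
  rw [h2, h, lintegral_smul_measure]
  rfl

theorem exists_eLpNorm_flowLift_eq {p : ℝ} (hp : 1 < p) (L : E →L[ℝ] E) {η : ℝ → ℝ}
    (hη : Continuous η) (hηc : HasCompactSupport η) : ∃ κ : ℝ≥0∞, κ ≠ ∞ ∧
      ((∃ t, η t ≠ 0) → κ ≠ 0) ∧ ∀ φ : E → ℝ, Measurable φ →
        eLpNorm (flowLift L η φ) (ENNReal.ofReal p) (volume.prod μ) =
          κ * eLpNorm φ (ENNReal.ofReal p) μ := by
  have hp0 : 0 < p := by linarith
  set D : ℝ → ℝ := fun t => |η t| ^ p * |(linFlow L t).det⁻¹| with hD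
  have hdet : Continuous fun t => (linFlow L t).det :=
    ContinuousLinearMap.continuous_det.comp (contDiff_linFlow L).continuous
  have hDc : Continuous D :=
    (hη.abs.rpow_const fun _ => Or.inr hp0.le).mul
      (hdet.inv₀ fun t => det_linFlow_ne_zero L t).abs
  have hDs : HasCompactSupport D := hηc.mono' fun t ht => subset_tsupport η (by
    intro h0
    exact ht (by simp [hD, h0, Real.zero_rpow hp0.ne']))
  have hD0 : 0 ≤ D := fun t => by simp only [hD, Pi.zero_apply]; positivity
  have hDi : Integrable D := hDc.integrable_of_hasCompactSupport hDs
  have hκ : ∫⁻ t, ENNReal.ofReal (D t) = ENNReal.ofReal (∫ t, D t) :=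
    (ofReal_integral_eq_lintegral_ofReal hDi (Filter.Eventually.of_forall hD0)).symm
  refine ⟨(∫⁻ t, ENNReal.ofReal (D t)) ^ (1 / p), ?_, ?_, fun φ hφ => ?_⟩
  · rw [hκ]
    exact ENNReal.rpow_ne_top_of_nonneg (by positivity) ofReal_ne_top
  · rintro ⟨t, ht⟩
    have hDt : D t ≠ 0 := by
      have := det_linFlow_ne_zero L t
      simp only [hD]; positivity
    have := hDc.integral_pos_of_hasCompactSupport_nonneg_nonzero (μ := volume) hDs hD0 hDt
    rw [hκ]
    exact (ENNReal.rpow_pos (ENNReal.ofReal_pos.2 this) ofReal_ne_top).ne'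
  · rw [eLpNorm_ofReal_eq hp,
    eLpNorm_ofReal_eq hp, ← ENNReal.mul_rpow_of_nonneg _ _ (by positivity)]
    congr 1
    have hm : Measurable (flowLift L η φ) := by
      have hE : Continuous fun q : ℝ × E => linFlow L q.1 q.2 :=
        ((contDiff_linFlow L).continuous.comp continuous_fst).clm_apply continuous_snd
      exact (hη.measurable.comp measurable_fst).mul (hφ.comp hE.measurable)
    rw [lintegral_prod _ (by fun_prop), ← lintegral_mul_const _ (by fun_prop)]
    refine lintegral_congr fun t => ?_
    have h1 : ∀ x, ‖flowLift L η φ (t, x)‖ₑ ^ p = ‖η t‖ₑ ^ p * ‖φ (linFlow L t x)‖ₑ ^ p :=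
      fun x => by
        rw [flowLift, enorm_mul, ENNReal.mul_rpow_of_nonneg _ _ hp0.le]
    simp only [h1]
    have hφt : Measurable fun x => ‖φ (linFlow L t x)‖ₑ ^ p :=
      (hφ.comp (linFlow L t).continuous.measurable).enorm.pow_const _
    rw [lintegral_const_mul _ hφt, lintegral_comp_linFlow (f := fun x => ‖φ x‖ₑ ^ p) L t
      (by fun_prop), ← mul_assoc]
    congr 1
    rw [hD, ENNReal.ofReal_mul (by positivity),
      ← ENNReal.ofReal_rpow_of_nonneg (abs_nonneg _) hp0.le,
      Real.enorm_eq_ofReal_abs]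
end

end

section

variable {d : ℕ}

theorem dd_eq_zero_of_notMem_tsupport {E : Type*} [NormedAddCommGroup E] [NormedSpace ℝ E]
    {φ : E → ℝ} {x : E} (hx : x ∉ tsupport φ) (a : E) : dd a φ x = 0 := by
  rw [dd, image_eq_zero_of_notMem_tsupport fun h => hx (tsupport_fderiv_subset ℝ h)]
  rfl

theorem tsupport_dd_subset {E : Type*} [NormedAddCommGroup E] [NormedSpace ℝ E]
    (φ : E → ℝ) (a : E) : tsupport (dd a φ) ⊆ tsupport φ :=
  closure_minimal (fun x hx => by
    by_contra h; exact hx (dd_eq_zero_of_notMem_tsupport h a)) (isClosed_tsupport φ)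

/-- The Ornstein–Uhlenbeck operator with diffusion matrix `Q` and drift `L`. -/
noncomputable def ouOp (Q : Matrix (Fin d) (Fin d) ℝ) (L : (Fin d → ℝ) →L[ℝ] (Fin d → ℝ))
    (w : (Fin d → ℝ) → ℝ) (x : Fin d → ℝ) : ℝ :=
  (∑ i, ∑ j, Q i j * dd (Pi.single i 1) (dd (Pi.single j 1) w) x) + dd (L x) w x

variable {Q : Matrix (Fin d) (Fin d) ℝ} {L : (Fin d → ℝ) →L[ℝ] (Fin d → ℝ)}
  {w : (Fin d → ℝ) → ℝ}

theorem contDiff_ouOp (hw : ContDiff ℝ (⊤ : ℕ∞) w) : ContDiff ℝ (⊤ : ℕ∞) (ouOp Q L w) := by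
  refine ContDiff.add (ContDiff.sum fun i _ => ContDiff.sum fun j _ =>
    contDiff_const.mul (contDiff_dd _ (contDiff_dd _ hw))) ?_
  exact (hw.fderiv_right (m := (⊤ : ℕ∞)) (by simp)).clm_apply L.contDiff

theorem hasCompactSupport_ouOp (hw : HasCompactSupport w) : HasCompactSupport (ouOp Q L w) := by
  refine HasCompactSupport.intro hw.isCompact fun x hx => ?_
  have h : ∀ a b, dd a (dd b w) x = 0 := fun a b =>
    dd_eq_zero_of_notMem_tsupport (fun h => hx (tsupport_dd_subset w b h)) a
  simp [ouOp, h, dd_eq_zero_of_notMem_tsupport hx]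

theorem exists_eLpNorm_dd_dd_flowLift_le {p : ℝ} (hp : 1 < p) (hd : 1 ≤ d)
    (L : (Fin d → ℝ) →L[ℝ] (Fin d → ℝ)) {η : ℝ → ℝ} (hη : ContDiff ℝ (⊤ : ℕ∞) η)
    (hη0 : ∀ t ∉ Set.Ioo (0 : ℝ) 1, η t = 0) (hη1 : ∀ t ∉ Set.Ioo (0 : ℝ) 1, deriv η t = 0) :
    ∃ C : ℝ, 0 < C ∧ ∀ lam : ℝ, 0 < lam → ∀ Q : Matrix (Fin d) (Fin d) ℝ, Q.IsSymm →
      (∀ ξ : Fin d → ℝ, lam * ∑ k, ξ k ^ 2 ≤ ∑ i, ∑ j, Q i j * ξ i * ξ j) →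
      ∀ w : (Fin d → ℝ) → ℝ, ContDiff ℝ (⊤ : ℕ∞) w → HasCompactSupport w →
      ∀ q : Fin d → ℝ, q ≠ 0 → ‖q‖ ≤ 2 →
      eLpNorm (dd (0, q) (dd (0, q) (flowLift L η w))) (ENNReal.ofReal p) volume ≤
        ENNReal.ofReal (C / lam) * eLpNorm (flowLift L η (ouOp Q L w) + flowLift L (deriv η) w)
          (ENNReal.ofReal p) volume := by
  obtain ⟨C0, hC0⟩ := exists_eLpNorm_dd_dd_le hp
  obtain ⟨K, hK1, hK⟩ := exists_norm_linFlow_le L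
  have hd1 : (1 : ℝ) ≤ d := by exact_mod_cast hd
  set c : ℝ := (2 * K * d)⁻¹ with hc
  have hc0 : 0 < c := by positivity
  refine ⟨(C0 + 1) / c ^ 2, by positivity, fun lam hlam Q hQ hQlam w hw hwc q hq0 hq2 => ?_⟩
  set v := flowLift L η w with hv
  set g := flowLift L η (ouOp Q L w) + flowLift L (deriv η) w with hg
  have hdη : ContDiff ℝ (⊤ : ℕ∞) (deriv η) := (contDiff_infty_iff_deriv.1 hη).2
  have hvs : ContDiff ℝ (⊤ : ℕ∞) v := contDiff_flowLift hη hw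
  have hgs : ContDiff ℝ (⊤ : ℕ∞) g :=
    (contDiff_flowLift hη (contDiff_ouOp hw)).add (contDiff_flowLift hdη hw)
  have hvc : HasCompactSupport v := hasCompactSupport_flowLift hη0 hwc
  have hgc : HasCompactSupport g :=
    (hasCompactSupport_flowLift hη0 (hasCompactSupport_ouOp hwc)).add
      (hasCompactSupport_flowLift hη1 hwc)
  set e : Fin d → ℝ := (c * Real.sqrt lam) • q with he
  have he0 : e ≠ 0 := smul_ne_zero (by positivity) hq0
  have hf : ∀ t ∈ Set.Ioo (0 : ℝ) 1, ∑ k, linFlow L t e k ^ 2 ≤ lam := by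
    intro t ht
    have h1 : ‖linFlow L t e‖ ≤ K * (c * Real.sqrt lam * 2) := by
      refine (ContinuousLinearMap.le_opNorm _ _).trans ?_
      gcongr
      · exact hK t ⟨by linarith [ht.1], ht.2.le⟩
      · rw [he, norm_smul, Real.norm_of_nonneg (by positivity)]
        gcongr
    have h2 : K * (c * Real.sqrt lam * 2) = Real.sqrt lam / d := by
      rw [hc]; field_simp
    calc ∑ k, linFlow L t e k ^ 2 ≤ ∑ k : Fin d, (Real.sqrt lam / d) ^ 2 := by
          refine Finset.sum_le_sum fun k _ => ?_
          rw [← sq_abs]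
          have h3 := (norm_le_pi_norm (linFlow L t e) k).trans (h1.trans h2.le)
          rw [Real.norm_eq_abs] at h3
          gcongr
      _ = lam / d := by
          simp only [Finset.sum_const, Finset.card_univ, Fintype.card_fin, nsmul_eq_mul, div_pow,
            Real.sq_sqrt hlam.le]
          field_simp
      _ ≤ lam := div_le_self hlam.le hd1
  set S := ∑ k, Real.sqrt (Q k k) with hS
  have hS0 : 0 ≤ S := Finset.sum_nonneg fun k _ => Real.sqrt_nonneg _
  have hρ : ∀ t, ∃ σ : Fin d → Fin d → ℝ, (∀ m, ‖σ m‖ ≤ K * S) ∧ (t ∈ Set.Ioo (0 : ℝ) 1 →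
      ∀ i j, Q i j = linFlow L t e i * linFlow L t e j +
        ∑ m, linFlow L t (σ m) i * linFlow L t (σ m) j) := by
    intro t
    by_cases ht : t ∈ Set.Ioo (0 : ℝ) 1
    · obtain ⟨ρ, h1, h2⟩ := exists_sum_squares_decomposition hQ hQlam (hf t ht)
      refine ⟨fun m => linFlow L (-t) (ρ m), fun m => ?_, fun _ i j => ?_⟩
      · refine (ContinuousLinearMap.le_opNorm _ _).trans ?_
        gcongr
        · exact hK _ ⟨by linarith [ht.2], by linarith [ht.1]⟩
        · exact h2 m
      · simp only [linFlow_apply_neg]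
        exact h1 i j
    · exact ⟨0, fun m => by simpa using by positivity, fun h => absurd h ht⟩
  choose σ hσ1 hσ2 using hρ
  have heq : ∀ t x, g (t, x) = dd (1, 0) v (t, x) + dd (0, e) (dd (0, e) v) (t, x) +
      ∑ m, dd (0, σ t m) (dd (0, σ t m) v) (t, x) := by
    intro t x
    simp only [hv, dd_time_flowLift hη hw, dd_dd_flowLift hη hw]
    simp only [hg, Pi.add_apply, flowLift]
    by_cases ht : t ∈ Set.Ioo (0 : ℝ) 1
    · rw [ouOp, sum_mul_dd_dd_eq hw (hσ2 t ht), ← Finset.mul_sum]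
      ring
    · simp [hη0 t ht]
  have hmain := hC0 d hd v g hvs hvc hgs hgc e he0 (K * S) (fun m t => σ t m)
    (fun m t => hσ1 t m) heq (fun t ht x => by simp [hv, flowLift, hη0 t ht])
    (fun t ht x => by simp [hg, flowLift, hη0 t ht, hη1 t ht])
  have hscale : dd (0, e) (dd (0, e) v) = (c ^ 2 * lam) • dd (0, q) (dd (0, q) v) := by
    ext z
    have h1 : ((0 : ℝ), e) = (c * Real.sqrt lam) • ((0 : ℝ), q) := by simp [he]
    simp only [Pi.smul_apply, dd_dd hvs, h1, map_smul, smul_apply, smul_eq_mul]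
    rw [← mul_assoc]
    congr 1
    rw [← Real.sq_sqrt hlam.le]
    simp only [Real.sqrt_sq (Real.sqrt_nonneg lam)]
    ring
  have hpos : 0 < c ^ 2 * lam := by positivity
  rw [hscale, eLpNorm_const_smul, Real.enorm_eq_ofReal hpos.le] at hmain
  have hne : ENNReal.ofReal (c ^ 2 * lam) ≠ 0 := (ENNReal.ofReal_pos.2 hpos).ne'
  calc _ = ENNReal.ofReal (c ^ 2 * lam)⁻¹ * (ENNReal.ofReal (c ^ 2 * lam) *
        eLpNorm (dd (0, q) (dd (0, q) v)) (ENNReal.ofReal p) volume) := by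
        rw [← mul_assoc, ENNReal.ofReal_inv_of_pos hpos, ENNReal.inv_mul_cancel hne ofReal_ne_top,
          one_mul]
    _ ≤ ENNReal.ofReal (c ^ 2 * lam)⁻¹ * (ENNReal.ofReal (C0 + 1) *
        eLpNorm g (ENNReal.ofReal p) volume) := by
        refine mul_le_mul' le_rfl (hmain.trans (mul_le_mul' ?_ le_rfl))
        rw [← ENNReal.ofReal_coe_nnreal]
        exact ENNReal.ofReal_le_ofReal (by linarith)
    _ = _ := by
        rw [← mul_assoc, ← ENNReal.ofReal_mul (by positivity)]
        congr 2
        field_simp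

end

section

variable {d : ℕ}

theorem eLpNorm_le_of_norm_le_mul_sum {α ι : Type*} [MeasurableSpace α] {μ : Measure α}
    [Fintype ι] {p : ℝ≥0∞} (hp : 1 ≤ p) {f : α → ℝ} {h : ι → α → ℝ} {c : ℝ} {B : ℝ≥0∞}
    (hh : ∀ i, AEStronglyMeasurable (h i) μ) (hf : ∀ x, ‖f x‖ ≤ c * ∑ i, ‖h i x‖)
    (hB : ∀ i, eLpNorm (h i) p μ ≤ B) :
    eLpNorm f p μ ≤ ENNReal.ofReal c * (Fintype.card ι * B) := by
  have h1 : eLpNorm f p μ ≤ ENNReal.ofReal c * eLpNorm (∑ i, fun x => ‖h i x‖) p μ := by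
    refine eLpNorm_le_mul_eLpNorm_of_ae_le_mul (Filter.Eventually.of_forall fun x => ?_) p
    rw [Finset.sum_apply, Real.norm_of_nonneg (Finset.sum_nonneg fun i _ => norm_nonneg _)]
    exact hf x
  refine h1.trans (mul_le_mul' le_rfl ((eLpNorm_sum_le (fun i _ => (hh i).norm) hp).trans ?_))
  simp only [eLpNorm_norm]
  refine (Finset.sum_le_sum fun i _ => hB i).trans ?_
  simp

theorem norm_dd_dd_le {E : Type*} [NormedAddCommGroup E] [NormedSpace ℝ E] {v : E → ℝ}
    (hv : ContDiff ℝ (⊤ : ℕ∞) v) (a b x : E) :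
    ‖dd a (dd b v) x‖ ≤ ∑ k, ‖dd ((![a + b, a, b] : Fin 3 → E) k)
      (dd ((![a + b, a, b] : Fin 3 → E) k) v) x‖ := by
  have h1 : dd (a + b) (dd (a + b) v) x =
      dd a (dd a v) x + 2 * dd a (dd b v) x + dd b (dd b v) x := by
    have h2 : dd b (dd a v) x = dd a (dd b v) x := by rw [dd_comm hv]
    rw [dd_dd hv] at h2 ⊢
    rw [dd_dd hv] at h2 ⊢
    simp only [dd_dd hv, map_add, add_apply]
    linarith
  rw [Fin.sum_univ_three]
  change |dd a (dd b v) x| ≤ |dd (a + b) (dd (a + b) v) x| + |dd a (dd a v) x| +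
    |dd b (dd b v) x|
  have h3 : dd a (dd b v) x =
      (dd (a + b) (dd (a + b) v) x - dd a (dd a v) x - dd b (dd b v) x) / 2 := by linarith
  rw [h3, abs_div, abs_two]
  have h4 := abs_sub (dd (a + b) (dd (a + b) v) x - dd a (dd a v) x) (dd b (dd b v) x)
  have h5 := abs_sub (dd (a + b) (dd (a + b) v) x) (dd a (dd a v) x)
  have h6 := abs_nonneg (dd (a + b) (dd (a + b) v) x)
  have h7 := abs_nonneg (dd a (dd a v) x)
  have h8 := abs_nonneg (dd b (dd b v) x)
  linarith

/-- The directions `eᵢ + eⱼ`, `eᵢ`, `eⱼ` recovering mixed derivatives by polarization. -/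
def polarDir (i : (Fin d × Fin d) × Fin 3) : Fin d → ℝ :=
  (![Pi.single i.1.1 1 + Pi.single i.1.2 1, Pi.single i.1.1 1, Pi.single i.1.2 1] :
    Fin 3 → Fin d → ℝ) i.2

theorem polarDir_ne_zero (i : (Fin d × Fin d) × Fin 3) : polarDir i ≠ 0 := by
  obtain ⟨⟨i, j⟩, k⟩ := i
  intro h
  fin_cases k
  · have h1 := congrFun h i
    simp only [polarDir, Fin.zero_eta, Matrix.cons_val_zero, Pi.add_apply, Pi.single_eq_same,
      Pi.zero_apply] at h1
    have h2 : (0 : ℝ) ≤ (Pi.single j 1 : Fin d → ℝ) i := by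
      rw [Pi.single_apply]; split_ifs <;> simp
    linarith
  · simpa [polarDir] using congrFun h i
  · simpa [polarDir] using congrFun h j

theorem norm_polarDir_le (i : (Fin d × Fin d) × Fin 3) : ‖polarDir i‖ ≤ 2 := by
  obtain ⟨⟨i, j⟩, k⟩ := i
  have h : ∀ l : Fin d, ‖(Pi.single l 1 : Fin d → ℝ)‖ = 1 := fun l => by simp [Pi.norm_single]
  fin_cases k
  · refine (norm_add_le _ _).trans ?_
    simp only [h]; norm_num
  · simp [polarDir, h]
  · simp [polarDir, h]

theorem norm_dd_dd_le_sum_polarDir {v : ℝ × (Fin d → ℝ) → ℝ} (hv : ContDiff ℝ (⊤ : ℕ∞) v)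
    {a b : Fin d → ℝ} {K : ℝ} (hK : 0 ≤ K) (ha : ‖a‖ ≤ K) (hb : ‖b‖ ≤ K)
    (x : ℝ × (Fin d → ℝ)) :
    ‖dd (0, a) (dd (0, b) v) x‖ ≤
      K ^ 2 * ∑ i, ‖dd (0, polarDir i) (dd (0, polarDir i) v) x‖ := by
  have hsum : ∀ a : Fin d → ℝ,
      ((0 : ℝ), a) = ∑ i, a i • ((0 : ℝ), (Pi.single i 1 : Fin d → ℝ)) := fun a => by
    conv_lhs => rw [← sum_smul_single a]
    ext1
    · simp [Prod.fst_sum]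
    · simp [Prod.snd_sum]
  rw [hsum a, hsum b, dd_dd_sum_smul hv, Fintype.sum_prod_type, Fintype.sum_prod_type,
    Finset.mul_sum]
  refine (norm_sum_le _ _).trans (Finset.sum_le_sum fun i _ => ?_)
  rw [Finset.mul_sum]
  refine (norm_sum_le _ _).trans (Finset.sum_le_sum fun j _ => ?_)
  rw [norm_mul, norm_mul, sq]
  have h1 := (norm_le_pi_norm a i).trans ha
  have h2 := (norm_le_pi_norm b j).trans hb
  refine mul_le_mul (mul_le_mul h1 h2 (norm_nonneg _) hK) ?_ (norm_nonneg _) (by positivity)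
  refine (norm_dd_dd_le hv _ _ x).trans (le_of_eq ?_)
  refine Finset.sum_congr rfl fun k _ => ?_
  fin_cases k <;> simp [polarDir]

theorem exists_timeCutoff : ∃ η : ℝ → ℝ, ContDiff ℝ (⊤ : ℕ∞) η ∧ HasCompactSupport η ∧
    (∀ t ∉ Set.Ioo (0 : ℝ) 1, η t = 0) ∧ (∀ t ∉ Set.Ioo (0 : ℝ) 1, deriv η t = 0) ∧
    ∃ t, η t ≠ 0 := by
  let f : ContDiffBump (1 / 2 : ℝ) := ⟨1 / 8, 1 / 4, by norm_num, by norm_num⟩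
  have hs : ∀ t ∉ Set.Ioo (0 : ℝ) 1, t ∉ tsupport f := fun t ht h => ht <| by
    rw [f.tsupport_eq, Metric.mem_closedBall, Real.dist_eq, abs_le] at h
    change -(1 / 4) ≤ _ ∧ _ ≤ 1 / 4 at h
    exact ⟨by linarith [h.1], by linarith [h.2]⟩
  refine ⟨f, f.contDiff, f.hasCompactSupport, fun t ht =>
    image_eq_zero_of_notMem_tsupport (hs t ht),
    fun t ht => ?_, 1 / 2, ?_⟩
  · by_contra h
    exact hs t ht (support_deriv_subset h)
  · rw [f.one_of_mem_closedBall (Metric.mem_closedBall_self f.rIn_pos.le)]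
    exact one_ne_zero

theorem norm_flowLift_dd_dd_le {L : (Fin d → ℝ) →L[ℝ] (Fin d → ℝ)} {η : ℝ → ℝ}
    {w : (Fin d → ℝ) → ℝ} (hη : ContDiff ℝ (⊤ : ℕ∞) η) (hη0 : ∀ t ∉ Set.Ioo (0 : ℝ) 1, η t = 0)
    (hw : ContDiff ℝ (⊤ : ℕ∞) w) {K : ℝ} (hK1 : 1 ≤ K)
    (hK : ∀ t ∈ Set.Icc (-1 : ℝ) 1, ‖linFlow L t‖ ≤ K) (i j : Fin d) (z : ℝ × (Fin d → ℝ)) :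
    ‖flowLift L η (dd (Pi.single i 1) (dd (Pi.single j 1) w)) z‖ ≤
      K ^ 2 * ∑ i, ‖dd (0, polarDir i) (dd (0, polarDir i) (flowLift L η w)) z‖ := by
  obtain ⟨t, x⟩ := z
  by_cases ht : t ∈ Set.Ioo (0 : ℝ) 1
  · have h1 : flowLift L η (dd (Pi.single i 1) (dd (Pi.single j 1) w)) (t, x) =
        dd (0, linFlow L (-t) (Pi.single i 1)) (dd (0, linFlow L (-t) (Pi.single j 1))
          (flowLift L η w)) (t, x) := by
      rw [dd_dd_flowLift hη hw, linFlow_apply_neg, linFlow_apply_neg]; rfl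
    have h2 : ∀ l : Fin d, ‖linFlow L (-t) (Pi.single l 1)‖ ≤ K := fun l => by
      refine (ContinuousLinearMap.le_opNorm _ _).trans ?_
      rw [Pi.norm_single, norm_one, mul_one]
      exact hK _ ⟨by linarith [ht.2], by linarith [ht.1]⟩
    rw [h1]
    exact norm_dd_dd_le_sum_polarDir (contDiff_flowLift hη hw) (by linarith) (h2 i) (h2 j) _
  · simp only [flowLift, hη0 t ht, zero_mul, norm_zero]
    positivity

theorem exists_eLpNorm_dd_dd_le_ouOp {p : ℝ} (hp : 1 < p) (hd : 1 ≤ d)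
    (L : (Fin d → ℝ) →L[ℝ] (Fin d → ℝ)) :
    ∃ C : ℝ, 0 < C ∧ ∀ lam : ℝ, 0 < lam → ∀ Q : Matrix (Fin d) (Fin d) ℝ, Q.IsSymm →
      (∀ ξ : Fin d → ℝ, lam * ∑ k, ξ k ^ 2 ≤ ∑ i, ∑ j, Q i j * ξ i * ξ j) →
      ∀ w : (Fin d → ℝ) → ℝ, ContDiff ℝ (⊤ : ℕ∞) w → HasCompactSupport w → ∀ i j : Fin d,
      eLpNorm (dd (Pi.single i 1) (dd (Pi.single j 1) w)) (ENNReal.ofReal p) volume ≤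
        ENNReal.ofReal (C / lam) * (eLpNorm (ouOp Q L w) (ENNReal.ofReal p) volume +
          eLpNorm w (ENNReal.ofReal p) volume) := by
  obtain ⟨η, hη, hηc, hη0, hη1, hηt⟩ := exists_timeCutoff
  have hdη : ContDiff ℝ (⊤ : ℕ∞) (deriv η) := (contDiff_infty_iff_deriv.1 hη).2
  obtain ⟨K, hK1, hK⟩ := exists_norm_linFlow_le L
  obtain ⟨C, hC0, hC⟩ := exists_eLpNorm_dd_dd_flowLift_le hp hd L hη hη0 hη1
  obtain ⟨κ, hκt, hκ0, hκ⟩ := exists_eLpNorm_flowLift_eq (μ := (volume : Measure (Fin d → ℝ)))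
    hp L hη.continuous hηc
  obtain ⟨κ', hκ't, -, hκ'⟩ := exists_eLpNorm_flowLift_eq (μ := (volume : Measure (Fin d → ℝ)))
    hp L hdη.continuous hηc.deriv
  replace hκ0 := hκ0 hηt
  rw [← Measure.volume_eq_prod] at hκ hκ'
  have hp1 : 1 ≤ ENNReal.ofReal p := by simpa using ENNReal.ofReal_le_ofReal hp.le
  set r := (max κ κ' / κ).toReal with hr
  have hrt : max κ κ' / κ ≠ ∞ := ENNReal.div_ne_top (by simp [hκt, hκ't]) hκ0
  have hr0 : 0 < r := ENNReal.toReal_pos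
    (ENNReal.div_ne_zero.2 ⟨(lt_max_of_lt_left (pos_iff_ne_zero.2 hκ0)).ne', hκt⟩) hrt
  have hd0 : (0 : ℝ) < d := by exact_mod_cast hd
  set N : ℕ := Fintype.card ((Fin d × Fin d) × Fin 3) with hN
  have hN0 : 0 < (N : ℝ) := by
    simp only [hN, Fintype.card_prod, Fintype.card_fin]
    push_cast
    positivity
  refine ⟨K ^ 2 * N * C * r, by positivity, fun lam hlam Q hQ hQlam w hw hwc i j => ?_⟩
  have hv : ContDiff ℝ (⊤ : ℕ∞) (flowLift L η w) := contDiff_flowLift hη hw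
  have hO := contDiff_ouOp (Q := Q) (L := L) hw
  set W := eLpNorm w (ENNReal.ofReal p) volume
  set O := eLpNorm (ouOp Q L w) (ENNReal.ofReal p) volume
  have hg : eLpNorm (flowLift L η (ouOp Q L w) + flowLift L (deriv η) w) (ENNReal.ofReal p) volume
      ≤ max κ κ' * (O + W) := by
    refine (eLpNorm_add_le (contDiff_flowLift hη hO).continuous.aestronglyMeasurable
      (contDiff_flowLift hdη hw).continuous.aestronglyMeasurable hp1).trans ?_
    rw [hκ _ hO.continuous.measurable, hκ' _ hw.continuous.measurable, mul_add]
    exact add_le_add (mul_le_mul' (le_max_left _ _) le_rfl)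
      (mul_le_mul' (le_max_right _ _) le_rfl)
  have hmain := eLpNorm_le_of_norm_le_mul_sum (μ := volume) hp1
    (fun i => (contDiff_dd (0, polarDir i) (contDiff_dd (0, polarDir i)
      hv)).continuous.aestronglyMeasurable)
    (norm_flowLift_dd_dd_le hη hη0 hw hK1 hK i j)
    (fun i => (hC lam hlam Q hQ hQlam w hw hwc _ (polarDir_ne_zero i) (norm_polarDir_le i)).trans
      (mul_le_mul' le_rfl hg))
  rw [hκ _ (contDiff_dd _ (contDiff_dd _ hw)).continuous.measurable, mul_comm κ,
    ← ENNReal.le_div_iff_mul_le (Or.inl hκ0) (Or.inl hκt)] at hmain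
  refine hmain.trans (le_of_eq ?_)
  have hrr : ENNReal.ofReal r = max κ κ' * κ⁻¹ := ENNReal.ofReal_toReal hrt
  have hCr : K ^ 2 * N * C * r / lam = K ^ 2 * (N * (C / lam * r)) := by ring
  rw [hCr, ENNReal.ofReal_mul (by positivity), ENNReal.ofReal_mul (by positivity),
    ENNReal.ofReal_mul (by positivity), hrr, ENNReal.ofReal_natCast, ENNReal.div_eq_inv_mul]
  ring

end

theorem ouOp_toLin'_eq {d : ℕ} (Q A : Matrix (Fin d) (Fin d) ℝ) (w : (Fin d → ℝ) → ℝ) :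
    ouOp Q (Matrix.toLin' A).toContinuousLinearMap w =
      fun x => (∑ i', ∑ j', Q i' j' * pd2 i' j' w x) + ∑ i', ∑ j', A i' j' * x j' * pd1 i' w x := by
  ext x
  rw [ouOp, dd_eq_sum]
  congr 1
  refine Finset.sum_congr rfl fun i _ => ?_
  rw [LinearMap.coe_toContinuousLinearMap', Matrix.toLin'_apply, Matrix.mulVec, dotProduct,
    Finset.sum_mul]
  rfl

/-- Corollary: elliptic estimates for non-degenerate
Ornstein–Uhlenbeck operators `𝒜w = Tr(Q D²w) + ⟨Ax, Dw⟩`.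
For `1 < p < ∞` and a drift matrix `A` there is `C = C(d,p,A) > 0`, independent of `Q`
and `λ`, such that for every `λ > 0`, every symmetric positive definite `Q` with
`⟨Qξ,ξ⟩ ≥ λ|ξ|²`, every `w ∈ C_0^∞(ℝᵈ)` and all `i,j`,
`‖∂²_{xᵢxⱼ} w‖_{L^p(ℝᵈ)} ≤ (C/λ)(‖𝒜w‖_{L^p(ℝᵈ)} + ‖w‖_{L^p(ℝᵈ)})`. -/
theorem ou_elliptic_Lp_estimate
    (d : ℕ) (hd : 1 ≤ d) (p : ℝ) (hp : 1 < p)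
    (A : Matrix (Fin d) (Fin d) ℝ) :
    ∃ C : ℝ, 0 < C ∧
      ∀ lam : ℝ, 0 < lam →
      ∀ Q : Matrix (Fin d) (Fin d) ℝ, Q.IsSymm →
        (∀ ξ : Fin d → ℝ, lam * ∑ k, ξ k ^ 2 ≤ ∑ i, ∑ j, Q i j * ξ i * ξ j) →
      ∀ w : (Fin d → ℝ) → ℝ, ContDiff ℝ (⊤ : ℕ∞) w → HasCompactSupport w →
      ∀ i j : Fin d,
        eLpNorm (pd2 i j w) (ENNReal.ofReal p) volume
          ≤ ENNReal.ofReal (C / lam) *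
            (eLpNorm
                (fun x => (∑ i', ∑ j', Q i' j' * pd2 i' j' w x)
                  + ∑ i', ∑ j', A i' j' * x j' * pd1 i' w x)
                (ENNReal.ofReal p) volume
              + eLpNorm w (ENNReal.ofReal p) volume) := by
  obtain ⟨C, hC0, hC⟩ := exists_eLpNorm_dd_dd_le_ouOp hp hd (Matrix.toLin' A).toContinuousLinearMap
  refine ⟨C, hC0, fun lam hlam Q hQ hQlam w hw hwc i j => ?_⟩
  rw [← ouOp_toLin'_eq]
  exact hC lam hlam Q hQ hQlam w hw hwc i j
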